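/- arXiv:2106.06643 — 6 statements merged into one kernel-verified Lean document; each statement's English description precedes it below -/
import Mathlib

section
/- Let K be an algebraically closed field of characteristic 2 and let X = {F = 0} ⊂ ℙ³_K be an irreducible quartic surface with Sing(X) finite, where F(x₁,x₂,x₃,z) = z²·x₁² + z·G(x₁,x₂,x₃) + B(x₁,x₂,x₃) with B homogeneous of degree 4 and G = x₁²·L(x₁,x₂) + x₂x₃·N(x₁,x₂) for some linear forms L, N in x₁, x₂, with G ≢ 0. Then |Sing(X)| ≤ 19. -/
open MvPolynomial

noncomputable section

/-- The singular locus of the surface `{F = 0} ⊆ ℙ³_K`: the set of points of `ℙ³_K` at which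
`F` and all four partial derivatives of `F` vanish (tested on every representative vector). -/
def singLocus {K : Type*} [Field K] (F : MvPolynomial (Fin 4) K) :
    Set (Projectivization K (Fin 4 → K)) :=
  {p | ∀ (v : Fin 4 → K) (hv : v ≠ 0), Projectivization.mk K v hv = p →
      (eval v F = 0 ∧ ∀ i, eval v (pderiv i F) = 0)}

section Helpers

/-- The affine cone form of `B` with explicit coefficients. -/
def quarticB {K : Type*} [Field K] (a : ℕ → ℕ → K) (x y w : K) : K :=
  a 0 0 * x ^ 4 + a 1 0 * x ^ 3 * y + a 2 0 * x ^ 2 * y ^ 2 + a 3 0 * x * y ^ 3 + a 4 0 * y ^ 4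
    + a 0 1 * x ^ 3 * w + a 1 1 * x ^ 2 * y * w + a 2 1 * x * y ^ 2 * w + a 3 1 * y ^ 3 * w
    + a 0 2 * x ^ 2 * w ^ 2 + a 1 2 * x * y * w ^ 2 + a 2 2 * y ^ 2 * w ^ 2
    + a 0 3 * x * w ^ 3 + a 1 3 * y * w ^ 3 + a 0 4 * w ^ 4

/-- `∂B/∂x` in characteristic two. -/
def quarticBx {K : Type*} [Field K] (a : ℕ → ℕ → K) (x y w : K) : K :=
  a 1 0 * x ^ 2 * y + a 3 0 * y ^ 3 + a 0 1 * x ^ 2 * w + a 2 1 * y ^ 2 * w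
    + a 1 2 * y * w ^ 2 + a 0 3 * w ^ 3

/-- `∂B/∂y` in characteristic two. -/
def quarticBy {K : Type*} [Field K] (a : ℕ → ℕ → K) (x y w : K) : K :=
  a 1 0 * x ^ 3 + a 3 0 * x * y ^ 2 + a 1 1 * x ^ 2 * w + a 3 1 * y ^ 2 * w
    + a 1 2 * x * w ^ 2 + a 1 3 * w ^ 3

/-- `∂B/∂w` in characteristic two. -/
def quarticBw {K : Type*} [Field K] (a : ℕ → ℕ → K) (x y w : K) : K :=
  a 0 1 * x ^ 3 + a 1 1 * x ^ 2 * y + a 2 1 * x * y ^ 2 + a 3 1 * y ^ 3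
    + a 0 3 * x * w ^ 2 + a 1 3 * y * w ^ 2

/-- Explicit singularity conditions. -/
def Sg {K : Type*} [Field K] (l₁ l₂ n₁ n₂ : K) (a : ℕ → ℕ → K) (x y w z : K) : Prop :=
  z ^ 2 * x ^ 2 + quarticB a x y w = 0 ∧
  x ^ 2 * (l₁ * x + l₂ * y) + y * w * (n₁ * x + n₂ * y) = 0 ∧
  z * (l₁ * x ^ 2 + n₁ * y * w) + quarticBx a x y w = 0 ∧
  z * (l₂ * x ^ 2 + n₁ * x * w) + quarticBy a x y w = 0 ∧
  z * (n₁ * x * y + n₂ * y ^ 2) + quarticBw a x y w = 0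

theorem quartic_explicit {K : Type*} [Field K] (B : MvPolynomial (Fin 3) K)
    (hB : B.IsHomogeneous 4) : ∃ a : ℕ → ℕ → K,
    B = ∑ i ∈ Finset.range 5, ∑ j ∈ Finset.range (5 - i),
      C (a i j) * X 0 ^ (4 - i - j) * X 1 ^ i * X 2 ^ j := by
  classical
  have key : ∀ s : Finset (Fin 3 →₀ ℕ), (∀ m ∈ s, m 0 + m 1 + m 2 = 4) →
      ∃ a : ℕ → ℕ → K, (∑ m ∈ s, monomial m (coeff m B)) =
        ∑ i ∈ Finset.range 5, ∑ j ∈ Finset.range (5 - i),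
        C (a i j) * X 0 ^ (4 - i - j) * X 1 ^ i * X 2 ^ j := by
    intro s
    induction s using Finset.induction_on with
    | empty => intro _; exact ⟨fun _ _ => 0, by simp⟩
    | insert m s hm ih =>
      intro h
      obtain ⟨a, ha⟩ := ih (fun m' hm' => h m' (Finset.mem_insert_of_mem hm'))
      have h4 := h m (Finset.mem_insert_self _ _)
      refine ⟨fun i j => a i j + if m 1 = i ∧ m 2 = j then coeff m B else 0, ?_⟩
      rw [Finset.sum_insert hm, ha]
      simp only [C_add, add_mul, Finset.sum_add_distrib]
      rw [add_comm]
      congr 1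
      rw [Finset.sum_eq_single (m 1), Finset.sum_eq_single (m 2)]
      · rw [monomial_eq, Finsupp.prod_fintype _ _ (by simp)]
        simp only [and_self, if_true, Fin.prod_univ_three]
        have : 4 - m 1 - m 2 = m 0 := by omega
        rw [this]; ring
      · intro j _ hj
        simp [hj.symm]
      · intro hh
        exfalso; apply hh; simp; omega
      · intro i _ hi
        simp [hi.symm]
      · intro hh
        exfalso; apply hh; simp; omega
  obtain ⟨a, ha⟩ := key B.support (by
    intro m hm
    have := hB (mem_support_iff.mp hm)
    rw [Finsupp.weight_apply, Finsupp.sum_fintype _ _ (by simp)] at this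
    simpa [Fin.sum_univ_three] using this)
  exact ⟨a, by rw [← ha]; exact B.as_sum⟩

theorem sg_iff_eval {K : Type*} [Field K] [CharP K 2]
    (l₁ l₂ n₁ n₂ : K) (a : ℕ → ℕ → K) (F : MvPolynomial (Fin 4) K)
    (hF : F = X 3 ^ 2 * X 0 ^ 2 + X 3 * (X 0 ^ 2 * (C l₁ * X 0 + C l₂ * X 1)
        + X 1 * X 2 * (C n₁ * X 0 + C n₂ * X 1))
        + rename (Fin.castLE (by norm_num : (3:ℕ) ≤ 4)) (∑ i ∈ Finset.range 5,
          ∑ j ∈ Finset.range (5 - i), C (a i j) * X 0 ^ (4 - i - j) * X 1 ^ i * X 2 ^ j))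
    (v : Fin 4 → K) :
    (eval v F = 0 ∧ ∀ i, eval v (pderiv i F) = 0) ↔
      Sg l₁ l₂ n₁ n₂ a (v 0) (v 1) (v 2) (v 3) := by
  have h2 : (2 : K) = 0 := CharP.cast_eq_zero K 2
  have h3 : (3 : K) = 1 := by linear_combination h2
  have h4 : (4 : K) = 0 := by linear_combination 2 * h2
  have e0 : Fin.castLE (by norm_num : (3:ℕ) ≤ 4) 0 = 0 := rfl
  have e1 : Fin.castLE (by norm_num : (3:ℕ) ≤ 4) 1 = 1 := rfl
  have e2 : Fin.castLE (by norm_num : (3:ℕ) ≤ 4) 2 = 2 := rfl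
  simp only [map_sum, map_mul, map_pow, rename_C, rename_X, e0, e1, e2, Finset.sum_range_succ,
    Finset.sum_range_zero] at hF
  norm_num [Finset.sum_range_succ] at hF
  have d01 : pderiv (0 : Fin 4) (X 1 : MvPolynomial (Fin 4) K) = 0 := pderiv_X_of_ne (by decide)
  have d02 : pderiv (0 : Fin 4) (X 2 : MvPolynomial (Fin 4) K) = 0 := pderiv_X_of_ne (by decide)
  have d03 : pderiv (0 : Fin 4) (X 3 : MvPolynomial (Fin 4) K) = 0 := pderiv_X_of_ne (by decide)
  have d10 : pderiv (1 : Fin 4) (X 0 : MvPolynomial (Fin 4) K) = 0 := pderiv_X_of_ne (by decide)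
  have d12 : pderiv (1 : Fin 4) (X 2 : MvPolynomial (Fin 4) K) = 0 := pderiv_X_of_ne (by decide)
  have d13 : pderiv (1 : Fin 4) (X 3 : MvPolynomial (Fin 4) K) = 0 := pderiv_X_of_ne (by decide)
  have d20 : pderiv (2 : Fin 4) (X 0 : MvPolynomial (Fin 4) K) = 0 := pderiv_X_of_ne (by decide)
  have d21 : pderiv (2 : Fin 4) (X 1 : MvPolynomial (Fin 4) K) = 0 := pderiv_X_of_ne (by decide)
  have d23 : pderiv (2 : Fin 4) (X 3 : MvPolynomial (Fin 4) K) = 0 := pderiv_X_of_ne (by decide)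
  have d30 : pderiv (3 : Fin 4) (X 0 : MvPolynomial (Fin 4) K) = 0 := pderiv_X_of_ne (by decide)
  have d31 : pderiv (3 : Fin 4) (X 1 : MvPolynomial (Fin 4) K) = 0 := pderiv_X_of_ne (by decide)
  have d32 : pderiv (3 : Fin 4) (X 2 : MvPolynomial (Fin 4) K) = 0 := pderiv_X_of_ne (by decide)
  have E : eval v F = (v 3) ^ 2 * (v 0) ^ 2
      + v 3 * ((v 0) ^ 2 * (l₁ * v 0 + l₂ * v 1) + v 1 * v 2 * (n₁ * v 0 + n₂ * v 1))
      + quarticB a (v 0) (v 1) (v 2) := by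
    subst hF
    simp [quarticB]
    ring
  have E3 : eval v (pderiv 3 F) =
      (v 0) ^ 2 * (l₁ * v 0 + l₂ * v 1) + v 1 * v 2 * (n₁ * v 0 + n₂ * v 1) := by
    subst hF
    simp [pderiv_mul, pderiv_pow, d30, d31, d32]
    exact Or.inr (Or.inl h2)
  have E0 : eval v (pderiv 0 F) =
      v 3 * (l₁ * (v 0) ^ 2 + n₁ * v 1 * v 2) + quarticBx a (v 0) (v 1) (v 2) := by
    subst hF
    simp [pderiv_mul, pderiv_pow, d01, d02, d03, quarticBx]
    ring_nf
    simp only [h2, h3, h4, mul_zero, add_zero, mul_one]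
    try ring
  have E1 : eval v (pderiv 1 F) =
      v 3 * (l₂ * (v 0) ^ 2 + n₁ * v 0 * v 2) + quarticBy a (v 0) (v 1) (v 2) := by
    subst hF
    simp [pderiv_mul, pderiv_pow, d10, d12, d13, quarticBy]
    ring_nf
    simp only [h2, h3, h4, mul_zero, add_zero, mul_one]
    try ring
  have E2 : eval v (pderiv 2 F) =
      v 3 * (n₁ * v 0 * v 1 + n₂ * (v 1) ^ 2) + quarticBw a (v 0) (v 1) (v 2) := by
    subst hF
    simp [pderiv_mul, pderiv_pow, d20, d21, d23, quarticBw]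
    ring_nf
    simp only [h2, h3, h4, mul_zero, add_zero, mul_one]
    try ring
  clear hF
  constructor
  · rintro ⟨h, hi⟩
    have h0 := hi 0
    have h1 := hi 1
    have h2' := hi 2
    have h3' := hi 3
    rw [E0] at h0; rw [E1] at h1; rw [E2] at h2'; rw [E3] at h3'; rw [E, h3'] at h
    exact ⟨by simpa using h, h3', h0, h1, h2'⟩
  · rintro ⟨h, h3, h0, h1, h2'⟩
    refine ⟨by rw [E, h3]; simpa using h, fun i => ?_⟩
    fin_cases i
    · exact E0.trans h0
    · exact E1.trans h1
    · exact E2.trans h2'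
    · exact E3.trans h3

theorem sg_smul {K : Type*} [Field K] {l₁ l₂ n₁ n₂ : K} {a : ℕ → ℕ → K} {x y w z : K} (c : K)
    (h : Sg l₁ l₂ n₁ n₂ a x y w z) :
    Sg l₁ l₂ n₁ n₂ a (c * x) (c * y) (c * w) (c * z) := by
  obtain ⟨h1, h2, h3, h4, h5⟩ := h
  simp only [Sg, quarticB, quarticBx, quarticBy, quarticBw] at *
  refine ⟨?_, ?_, ?_, ?_, ?_⟩
  · linear_combination c ^ 4 * h1
  · linear_combination c ^ 3 * h2
  · linear_combination c ^ 3 * h3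
  · linear_combination c ^ 3 * h4
  · linear_combination c ^ 3 * h5

/-- point `[1:y:w:z]` -/
def pA {K : Type*} [Field K] (y w z : K) : Projectivization K (Fin 4 → K) :=
  Projectivization.mk K ![1, y, w, z] (fun h => one_ne_zero (congrFun h 0))
/-- point `[0:1:w:z]` -/
def pB {K : Type*} [Field K] (w z : K) : Projectivization K (Fin 4 → K) :=
  Projectivization.mk K ![0, 1, w, z] (fun h => one_ne_zero (congrFun h 1))
/-- point `[0:0:1:z]` -/
def pC {K : Type*} [Field K] (z : K) : Projectivization K (Fin 4 → K) :=
  Projectivization.mk K ![0, 0, 1, z] (fun h => one_ne_zero (congrFun h 2))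
/-- point `[0:0:0:1]` -/
def pP {K : Type*} [Field K] : Projectivization K (Fin 4 → K) :=
  Projectivization.mk K ![0, 0, 0, 1] (fun h => one_ne_zero (congrFun h 3))

theorem pA_inj {K : Type*} [Field K] {y w z y' w' z' : K} (h : pA y w z = pA y' w' z') :
    y = y' ∧ w = w' ∧ z = z' := by
  rw [pA, pA, Projectivization.mk_eq_mk_iff'] at h
  obtain ⟨c, hc⟩ := h
  have h0 := congrFun hc 0
  have h1 := congrFun hc 1
  have h2 := congrFun hc 2
  have h3 := congrFun hc 3
  simp at h0 h1 h2 h3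
  subst h0
  simp_all

theorem pB_inj {K : Type*} [Field K] {w z w' z' : K} (h : pB w z = pB w' z') :
    w = w' ∧ z = z' := by
  rw [pB, pB, Projectivization.mk_eq_mk_iff'] at h
  obtain ⟨c, hc⟩ := h
  have h1 := congrFun hc 1
  have h2 := congrFun hc 2
  have h3 := congrFun hc 3
  simp at h1 h2 h3
  subst h1
  simp_all

theorem pC_inj {K : Type*} [Field K] {z z' : K} (h : pC z = pC z') : z = z' := by
  rw [pC, pC, Projectivization.mk_eq_mk_iff'] at h
  obtain ⟨c, hc⟩ := h
  have h2 := congrFun hc 2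
  have h3 := congrFun hc 3
  simp at h2 h3
  subst h2
  simp_all

theorem point_cases {K : Type*} [Field K] (p : Projectivization K (Fin 4 → K)) :
    (∃ y w z, p = pA y w z) ∨ (∃ w z, p = pB w z) ∨ (∃ z, p = pC z) ∨ p = pP := by
  induction p using Projectivization.ind with
  | h v hv =>
  by_cases h0 : v 0 = 0
  · by_cases h1 : v 1 = 0
    · by_cases h2 : v 2 = 0
      · have h3 : v 3 ≠ 0 := by
          intro h3; apply hv; ext i; fin_cases i <;> simp_all
        right; right; right
        rw [pP, Projectivization.mk_eq_mk_iff']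
        refine ⟨v 3, ?_⟩
        ext i; fin_cases i <;> simp [h0, h1, h2]
      · right; right; left
        refine ⟨v 3 / v 2, ?_⟩
        rw [pC, Projectivization.mk_eq_mk_iff']
        refine ⟨v 2, ?_⟩
        ext i; fin_cases i <;> simp [h0, h1] ; field_simp
    · right; left
      refine ⟨v 2 / v 1, v 3 / v 1, ?_⟩
      rw [pB, Projectivization.mk_eq_mk_iff']
      refine ⟨v 1, ?_⟩
      ext i; fin_cases i <;> simp [h0] <;> field_simp
  · left
    refine ⟨v 1 / v 0, v 2 / v 0, v 3 / v 0, ?_⟩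
    rw [pA, Projectivization.mk_eq_mk_iff']
    refine ⟨v 0, ?_⟩
    ext i; fin_cases i <;> simp <;> field_simp

theorem mem_iff_sg {K : Type*} [Field K] [CharP K 2]
    (l₁ l₂ n₁ n₂ : K) (a : ℕ → ℕ → K) (F : MvPolynomial (Fin 4) K)
    (h : ∀ v : Fin 4 → K, (eval v F = 0 ∧ ∀ i, eval v (pderiv i F) = 0) ↔
      Sg l₁ l₂ n₁ n₂ a (v 0) (v 1) (v 2) (v 3))
    (v : Fin 4 → K) (hv : v ≠ 0) :
    Projectivization.mk K v hv ∈ singLocus F ↔ Sg l₁ l₂ n₁ n₂ a (v 0) (v 1) (v 2) (v 3) := by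
  constructor
  · intro hm
    exact (h v).1 (hm v hv rfl)
  · intro hs u hu he
    rw [Projectivization.mk_eq_mk_iff'] at he
    obtain ⟨c, rfl⟩ := he
    rw [h]
    simpa using sg_smul c hs

theorem no_infinite_family {K P : Type*} {S : Set P} (hS : S.Finite) (s : Set K)
    (hs : s.Infinite) (g : K → P) (hg : Set.InjOn g s) (hm : ∀ t ∈ s, g t ∈ S) : False :=
  (Set.infinite_of_injOn_mapsTo hg hm hs) hS

theorem sg_one_iff {K : Type*} [Field K] [CharP K 2] (l₁ l₂ n₁ n₂ : K) (a : ℕ → ℕ → K)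
    (y w z : K) : Sg l₁ l₂ n₁ n₂ a 1 y w z ↔
      (quarticB a 1 y w = z ^ 2 ∧ l₁ + l₂ * y = w * (n₁ * y + n₂ * y ^ 2) ∧
        quarticBy a 1 y w = z * (l₂ + n₁ * w) ∧
        quarticBw a 1 y w = z * (n₁ * y + n₂ * y ^ 2)) := by
  have h2 : (2 : K) = 0 := CharP.cast_eq_zero K 2
  have hadd : ∀ u v : K, u + v = 0 ↔ v = u := by
    intro u v
    constructor
    · intro h; linear_combination h - u * h2
    · intro h; linear_combination h + u * h2
  have euler : quarticBx a 1 y w + y * quarticBy a 1 y w + w * quarticBw a 1 y w = 0 := by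
    simp only [quarticBx, quarticBy, quarticBw]
    linear_combination (a 1 0 * y + a 3 0 * y ^ 3 + a 0 1 * w + a 2 1 * y ^ 2 * w + a 1 2 * y * w ^ 2
      + a 0 3 * w ^ 3 + a 1 1 * y * w + a 3 1 * y ^ 3 * w + a 1 3 * y * w ^ 3) * h2
  constructor
  · rintro ⟨h1, hg, -, hy, hw⟩
    rw [hadd] at h1 hy hw
    refine ⟨by rw [h1]; ring, ?_, by rw [hy]; ring, by rw [hw]; ring⟩
    linear_combination hg - (w * (n₁ * y + n₂ * y ^ 2)) * h2
  · rintro ⟨h1, hg, hy, hw⟩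
    refine ⟨by rw [hadd, h1]; ring, ?_, ?_, by rw [hadd, hy]; ring, by rw [hadd, hw]; ring⟩
    · linear_combination hg + (w * (n₁ * y + n₂ * y ^ 2)) * h2
    · linear_combination euler - y * hy - w * hw + z * hg + (n₁ * y * w * z - z * l₂ * y - z * w * (n₁ * y)
        + z * n₁ * y * w - z * n₁ * y * w + 0) * h2

theorem sq_inj_two {K : Type*} [Field K] [CharP K 2] {u v : K} (h : u ^ 2 = v ^ 2) : u = v := by
  have h2 : (2 : K) = 0 := CharP.cast_eq_zero K 2
  have : (u - v) ^ 2 = 0 := by linear_combination h + (v ^ 2 - u * v) * h2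
  exact sub_eq_zero.mp (pow_eq_zero_iff (by norm_num) |>.mp this)

theorem exists_sqrt_poly {K : Type*} [Field K] [IsAlgClosed K] [CharP K 2] (P : Polynomial K)
    (h : Polynomial.derivative P = 0) : ∃ S : Polynomial K, P = S ^ 2 := by
  have : Fact (Nat.Prime 2) := ⟨Nat.prime_two⟩
  have : ExpChar K 2 := ExpChar.prime Nat.prime_two
  have h1 := Polynomial.expand_contract 2 h (by norm_num)
  refine ⟨(Polynomial.contract 2 P).map ((frobeniusEquiv K 2).symm : K →+* K), ?_⟩
  rw [← polynomial_expand_eq, h1]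

/-- Cover by the roots of a nonzero polynomial. -/
theorem cover_roots {K P : Type*} [Field K] (Q : Polynomial K) (hQ : Q ≠ 0) (n : ℕ)
    (hn : Q.natDegree ≤ n) (g : K → P) :
    ∃ T : Finset P, T.card ≤ n ∧ ∀ t, Q.eval t = 0 → g t ∈ T := by
  classical
  refine ⟨Q.roots.toFinset.image g, ?_, ?_⟩
  · calc _ ≤ Q.roots.toFinset.card := Finset.card_image_le
      _ ≤ Multiset.card Q.roots := Multiset.toFinset_card_le _
      _ ≤ Q.natDegree := Polynomial.card_roots' _
      _ ≤ n := hn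
  · intro t ht
    apply Finset.mem_image_of_mem
    simp [hQ, ht]

/-- `B(1, t, L/D) D^4`. -/
def polyP {K : Type*} [Field K] (a : ℕ → ℕ → K) (L D : Polynomial K) : Polynomial K :=
  (Polynomial.C (a 0 0) + Polynomial.C (a 1 0) * Polynomial.X
    + Polynomial.C (a 2 0) * Polynomial.X ^ 2 + Polynomial.C (a 3 0) * Polynomial.X ^ 3
    + Polynomial.C (a 4 0) * Polynomial.X ^ 4) * D ^ 4
  + (Polynomial.C (a 0 1) + Polynomial.C (a 1 1) * Polynomial.X
    + Polynomial.C (a 2 1) * Polynomial.X ^ 2 + Polynomial.C (a 3 1) * Polynomial.X ^ 3)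
      * L * D ^ 3
  + (Polynomial.C (a 0 2) + Polynomial.C (a 1 2) * Polynomial.X
    + Polynomial.C (a 2 2) * Polynomial.X ^ 2) * L ^ 2 * D ^ 2
  + (Polynomial.C (a 0 3) + Polynomial.C (a 1 3) * Polynomial.X) * L ^ 3 * D
  + Polynomial.C (a 0 4) * L ^ 4

/-- `B_w(1, t, L/D) D^3`. -/
def polyM {K : Type*} [Field K] (a : ℕ → ℕ → K) (L D : Polynomial K) : Polynomial K :=
  (Polynomial.C (a 0 1) + Polynomial.C (a 1 1) * Polynomial.X
    + Polynomial.C (a 2 1) * Polynomial.X ^ 2 + Polynomial.C (a 3 1) * Polynomial.X ^ 3) * D ^ 3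
  + (Polynomial.C (a 0 3) + Polynomial.C (a 1 3) * Polynomial.X) * L ^ 2 * D

theorem polyP_eval {K : Type*} [Field K] (a : ℕ → ℕ → K) (L D : Polynomial K) (t w : K)
    (h : L.eval t = w * D.eval t) :
    (polyP a L D).eval t = (D.eval t) ^ 4 * quarticB a 1 t w := by
  simp [polyP, quarticB, h]
  ring

theorem polyM_eval {K : Type*} [Field K] (a : ℕ → ℕ → K) (L D : Polynomial K) (t w : K)
    (h : L.eval t = w * D.eval t) :
    (polyM a L D).eval t = (D.eval t) ^ 3 * quarticBw a 1 t w := by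
  simp [polyM, quarticBw, h]
  ring

theorem polyP_deriv_eval {K : Type*} [Field K] [CharP K 2] (a : ℕ → ℕ → K) (L D : Polynomial K)
    (t w l n : K) (h : L.eval t = w * D.eval t) (hL : (Polynomial.derivative L).eval t = l)
    (hD : (Polynomial.derivative D).eval t = n) :
    (Polynomial.derivative (polyP a L D)).eval t = (D.eval t) ^ 3 *
      (D.eval t * quarticBy a 1 t w + quarticBw a 1 t w * (l + n * w)) := by
  have h2 : (2 : K) = 0 := CharP.cast_eq_zero K 2
  have h3 : (3 : K) = 1 := by linear_combination h2
  have h4 : (4 : K) = 0 := by linear_combination 2 * h2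
  simp [polyP, quarticBy, quarticBw, h, Polynomial.derivative_mul, Polynomial.derivative_pow, hL, hD,
    h2, h3, h4]
  ring_nf
  try simp only [h2, h3, h4, mul_zero, add_zero, mul_one]

theorem curve_bound {K : Type*} [Field K] [IsAlgClosed K] [CharP K 2] (l₁ l₂ n₁ n₂ : K)
    (a : ℕ → ℕ → K) (S : Set (Projectivization K (Fin 4 → K))) (hfin : S.Finite)
    (hS : ∀ y w z, pA y w z ∈ S ↔ Sg l₁ l₂ n₁ n₂ a 1 y w z) (hn : n₁ ≠ 0 ∨ n₂ ≠ 0) :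
    ∃ T : Finset (Projectivization K (Fin 4 → K)), T.card ≤ 11 ∧
      ∀ y w z, n₁ * y + n₂ * y ^ 2 ≠ 0 → Sg l₁ l₂ n₁ n₂ a 1 y w z → pA y w z ∈ T := by
  classical
  have h2 : (2 : K) = 0 := CharP.cast_eq_zero K 2
  set L : Polynomial K := Polynomial.C l₁ + Polynomial.C l₂ * Polynomial.X with hL
  set D : Polynomial K := Polynomial.C n₁ * Polynomial.X + Polynomial.C n₂ * Polynomial.X ^ 2
    with hD
  have eL : ∀ t, L.eval t = l₁ + l₂ * t := by intro t; simp [hL]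
  have eD : ∀ t, D.eval t = n₁ * t + n₂ * t ^ 2 := by intro t; simp [hD]
  have eL' : ∀ t, (Polynomial.derivative L).eval t = l₂ := by intro t; simp [hL]
  have eD' : ∀ t, (Polynomial.derivative D).eval t = n₁ := by intro t; simp [hD]; exact Or.inr (Or.inl (by rw [one_add_one_eq_two, h2]))
  have D0 : D ≠ 0 := by
    intro h
    have c1 := congrArg (fun p => Polynomial.coeff p 1) h
    have c2 := congrArg (fun p => Polynomial.coeff p 2) h
    simp [hD, Polynomial.coeff_X] at c1 c2
    tauto
  have dP : (polyP a L D).natDegree ≤ 12 := by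
    unfold polyP; rw [hL, hD]; compute_degree
  have dM : (polyM a L D).natDegree ≤ 10 := by
    unfold polyM; rw [hL, hD]
    refine le_trans (b := 9) ?_ (by norm_num)
    compute_degree
  have key : ∀ y w z, n₁ * y + n₂ * y ^ 2 ≠ 0 → Sg l₁ l₂ n₁ n₂ a 1 y w z →
      pA y w z = pA y ((l₁ + l₂ * y) / (n₁ * y + n₂ * y ^ 2)) (quarticBw a 1 y
        ((l₁ + l₂ * y) / (n₁ * y + n₂ * y ^ 2)) / (n₁ * y + n₂ * y ^ 2)) := by
    intro y w z hd hs
    rw [sg_one_iff] at hs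
    obtain ⟨h1, hg, hy, hw⟩ := hs
    have : (l₁ + l₂ * y) / (n₁ * y + n₂ * y ^ 2) = w := by rw [hg, mul_div_assoc, div_self hd, mul_one]
    rw [this, hw, mul_div_assoc, div_self hd, mul_one]
  by_cases hP' : Polynomial.derivative (polyP a L D) = 0
  · obtain ⟨R, hR⟩ := exists_sqrt_poly _ hP'
    have dR : R.natDegree ≤ 6 := by
      rw [hR, Polynomial.natDegree_pow] at dP; omega
    have dD : D.natDegree ≤ 2 := by rw [hD]; compute_degree
    by_cases hQ : polyM a L D - D ^ 2 * R = 0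
    · exfalso
      refine no_infinite_family hfin {t | D.eval t ≠ 0} ?_
        (fun t => pA t (L.eval t / D.eval t) (R.eval t / (D.eval t) ^ 2)) ?_ ?_
      · have : {t | D.eval t ≠ 0} = ((D.roots.toFinset : Finset K) : Set K)ᶜ := by
          ext t; simp [D0]
        rw [this]
        exact (Finset.finite_toSet _).infinite_compl
      · intro t _ t' _ h
        exact (pA_inj h).1
      · intro t ht
        have ht' : D.eval t ≠ 0 := ht
        rw [hS, sg_one_iff, ← eL, ← eD]
        set w := L.eval t / D.eval t with hw
        have hLw : L.eval t = w * D.eval t := by rw [hw]; field_simp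
        have p1 := polyP_eval a L D t w hLw
        have p2 := polyM_eval a L D t w hLw
        have p3 := polyP_deriv_eval a L D t w l₂ n₁ hLw (eL' t) (eD' t)
        rw [hP'] at p3
        rw [hR] at p1
        rw [sub_eq_zero.mp hQ] at p2
        simp only [Polynomial.eval_zero, Polynomial.eval_pow, Polynomial.eval_mul] at p1 p2 p3
        set d := D.eval t with hd
        set r := R.eval t
        have hBw : quarticBw a 1 t w = r / d ^ 2 * d := by
          field_simp
          apply mul_left_cancel₀ (pow_ne_zero 2 ht')
          linear_combination -p2
        refine ⟨?_, hLw, ?_, hBw⟩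
        · field_simp
          linear_combination -p1
        · have p4 := (mul_eq_zero.mp p3.symm).resolve_left (pow_ne_zero 3 ht')
          rw [hBw] at p4
          apply mul_left_cancel₀ ht'
          linear_combination p4 - (r / d ^ 2 * d * (l₂ + n₁ * w)) * h2
    · obtain ⟨T, hT, hT'⟩ := cover_roots _ hQ 11 (by
        refine le_trans (Polynomial.natDegree_sub_le _ _) ?_
        refine max_le (by omega) ?_
        refine le_trans Polynomial.natDegree_mul_le ?_
        rw [Polynomial.natDegree_pow]; omega)
        (fun y => pA y ((l₁ + l₂ * y) / (n₁ * y + n₂ * y ^ 2)) (quarticBw a 1 y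
          ((l₁ + l₂ * y) / (n₁ * y + n₂ * y ^ 2)) / (n₁ * y + n₂ * y ^ 2)))
      refine ⟨T, hT, ?_⟩
      intro y w z hd hs
      rw [key y w z hd hs]
      apply hT'
      rw [sg_one_iff] at hs
      obtain ⟨h1, hg, hy, hw⟩ := hs
      rw [← eL, ← eD] at hg
      have p1 := polyP_eval a L D y w hg
      have p2 := polyM_eval a L D y w hg
      rw [hR, h1, Polynomial.eval_pow] at p1
      have p5 : R.eval y = (D.eval y) ^ 2 * z := sq_inj_two (by rw [p1]; ring)
      simp only [Polynomial.eval_sub, Polynomial.eval_mul, Polynomial.eval_pow]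
      rw [p2, p5, hw, ← eD]; ring
  · obtain ⟨T, hT, hT'⟩ := cover_roots _ hP' 11 (by
        refine le_trans (Polynomial.natDegree_derivative_le _) (by omega))
        (fun y => pA y ((l₁ + l₂ * y) / (n₁ * y + n₂ * y ^ 2)) (quarticBw a 1 y
          ((l₁ + l₂ * y) / (n₁ * y + n₂ * y ^ 2)) / (n₁ * y + n₂ * y ^ 2)))
    refine ⟨T, hT, ?_⟩
    intro y w z hd hs
    rw [key y w z hd hs]
    apply hT'
    rw [sg_one_iff] at hs
    obtain ⟨h1, hg, hy, hw⟩ := hs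
    rw [← eL, ← eD] at hg
    rw [polyP_deriv_eval a L D y w l₂ n₁ hg (eL' y) (eD' y), hy, hw, eD]
    linear_combination ((n₁ * y + n₂ * y ^ 2) ^ 4 * z * (l₂ + n₁ * w)) * h2

theorem line_bound {K : Type*} [Field K] [IsAlgClosed K] [CharP K 2] (l₁ l₂ n₁ n₂ : K)
    (a : ℕ → ℕ → K) (S : Set (Projectivization K (Fin 4 → K))) (hfin : S.Finite)
    (hS : ∀ y w z, pA y w z ∈ S ↔ Sg l₁ l₂ n₁ n₂ a 1 y w z) (c : K)
    (hc : n₁ * c + n₂ * c ^ 2 = 0) :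
    ∃ T : Finset (Projectivization K (Fin 4 → K)), T.card ≤ 3 ∧
      ∀ w z, Sg l₁ l₂ n₁ n₂ a 1 c w z → pA c w z ∈ T := by
  classical
  have h2 : (2 : K) = 0 := CharP.cast_eq_zero K 2
  by_cases hl : l₁ + l₂ * c = 0
  swap
  · refine ⟨∅, by simp, ?_⟩
    intro w z hs
    rw [sg_one_iff] at hs
    exact absurd (by rw [hs.2.1, hc, mul_zero]) hl
  have hsq : ∀ u : K, ∃ s : K, s ^ 2 = u := fun u => IsAlgClosed.exists_pow_nat_eq u (by norm_num)
  choose sq hsq using hsq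
  let f : Polynomial K := Polynomial.C (a 0 0 + a 1 0 * c + a 2 0 * c ^ 2 + a 3 0 * c ^ 3
      + a 4 0 * c ^ 4)
    + Polynomial.C (a 0 1 + a 1 1 * c + a 2 1 * c ^ 2 + a 3 1 * c ^ 3) * Polynomial.X
    + Polynomial.C (a 0 2 + a 1 2 * c + a 2 2 * c ^ 2) * Polynomial.X ^ 2
    + Polynomial.C (a 0 3 + a 1 3 * c) * Polynomial.X ^ 3
    + Polynomial.C (a 0 4) * Polynomial.X ^ 4
  let fy : Polynomial K := Polynomial.C (a 1 0 + a 3 0 * c ^ 2)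
    + Polynomial.C (a 1 1 + a 3 1 * c ^ 2) * Polynomial.X
    + Polynomial.C (a 1 2) * Polynomial.X ^ 2 + Polynomial.C (a 1 3) * Polynomial.X ^ 3
  have ef : ∀ w, f.eval w = quarticB a 1 c w := by
    intro w; simp [f, quarticB]; ring
  have efy : ∀ w, fy.eval w = quarticBy a 1 c w := by
    intro w; simp [fy, quarticBy]; ring
  have efw : ∀ w, (Polynomial.derivative f).eval w = quarticBw a 1 c w := by
    intro w
    simp [f, quarticBw, ← Polynomial.C_pow, -map_pow]
    linear_combination ((a 0 2 + a 1 2 * c + a 2 2 * c ^ 2) * w + (a 0 3 + a 1 3 * c) * w ^ 2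
      + 2 * a 0 4 * w ^ 3) * h2
  have df : f.natDegree ≤ 4 := by unfold f; compute_degree
  have dfy : fy.natDegree ≤ 3 := by unfold fy; compute_degree
  have key : ∀ w z, Sg l₁ l₂ n₁ n₂ a 1 c w z → pA c w z = pA c w (sq (quarticB a 1 c w)) := by
    intro w z hs
    rw [sg_one_iff] at hs
    have : z = sq (quarticB a 1 c w) := sq_inj_two (by rw [hsq, hs.1])
    rw [← this]
  by_cases hf' : Polynomial.derivative f = 0
  · obtain ⟨R, hR⟩ := exists_sqrt_poly _ hf'
    have dR : R.natDegree ≤ 2 := by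
      rw [hR, Polynomial.natDegree_pow] at df; omega
    by_cases hQ : fy - R * (Polynomial.C l₂ + Polynomial.C n₁ * Polynomial.X) = 0
    · exfalso
      refine no_infinite_family hfin Set.univ Set.infinite_univ (fun w => pA c w (R.eval w)) ?_ ?_
      · intro t _ t' _ h
        exact (pA_inj h).2.1
      · intro w _
        rw [hS, sg_one_iff, ← ef, ← efy, ← efw, hf', hR, sub_eq_zero.mp hQ, hc, hl]
        simp
    · obtain ⟨T, hT, hT'⟩ := cover_roots _ hQ 3 (by
        refine le_trans (Polynomial.natDegree_sub_le _ _) ?_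
        refine max_le (by omega) ?_
        refine le_trans Polynomial.natDegree_mul_le ?_
        have : (Polynomial.C l₂ + Polynomial.C n₁ * Polynomial.X).natDegree ≤ 1 := by
          compute_degree
        omega) (fun w => pA c w (sq (quarticB a 1 c w)))
      refine ⟨T, hT, ?_⟩
      intro w z hs
      rw [key w z hs]
      apply hT'
      rw [sg_one_iff] at hs
      obtain ⟨h1, -, hy, -⟩ := hs
      rw [← ef, hR, Polynomial.eval_pow] at h1
      simp only [Polynomial.eval_sub, efy, hy, Polynomial.eval_mul, sq_inj_two h1]
      simp
  · obtain ⟨T, hT, hT'⟩ := cover_roots _ hf' 3 (by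
        refine le_trans (Polynomial.natDegree_derivative_le _) (by omega))
        (fun w => pA c w (sq (quarticB a 1 c w)))
    refine ⟨T, hT, ?_⟩
    intro w z hs
    rw [key w z hs]
    apply hT'
    rw [sg_one_iff] at hs
    rw [efw, hs.2.2.2, hc, mul_zero]

/-- No singular points `[0:0:1:z]`. -/
theorem no_pC {K : Type*} [Field K] [IsAlgClosed K] (l₁ l₂ n₁ n₂ : K)
    (a : ℕ → ℕ → K) (S : Set (Projectivization K (Fin 4 → K))) (hfin : S.Finite)
    (hS : ∀ z, pC z ∈ S ↔ Sg l₁ l₂ n₁ n₂ a 0 0 1 z) (z : K) : ¬ Sg l₁ l₂ n₁ n₂ a 0 0 1 z := by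
  intro h
  refine no_infinite_family hfin Set.univ Set.infinite_univ pC (fun _ _ _ _ h => pC_inj h) ?_
  intro z' _
  rw [hS]
  simpa [Sg] using h

theorem infinity_bound_of_ne {K : Type*} [Field K] (l₁ l₂ n₁ n₂ : K)
    (a : ℕ → ℕ → K) (hn : n₂ ≠ 0) :
    ∃ T : Finset (Projectivization K (Fin 4 → K)), T.card ≤ 1 ∧
      ∀ w z, Sg l₁ l₂ n₁ n₂ a 0 1 w z → pB w z ∈ T := by
  refine ⟨{pB 0 (-quarticBw a 0 1 0 / n₂)}, by simp, ?_⟩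
  rintro w z ⟨-, h1, -, -, h2⟩
  have hw : w = 0 := by simpa [hn] using h1
  subst hw
  have : z = -quarticBw a 0 1 0 / n₂ := by
    field_simp
    linear_combination h2
  rw [← this]
  simp

theorem infinity_bound_of_eq {K : Type*} [Field K] [IsAlgClosed K] (l₁ l₂ n₁ : K)
    (a : ℕ → ℕ → K) (S : Set (Projectivization K (Fin 4 → K))) (hfin : S.Finite)
    (hS : ∀ w z, pB w z ∈ S ↔ Sg l₁ l₂ n₁ 0 a 0 1 w z) :
    ∃ T : Finset (Projectivization K (Fin 4 → K)), T.card ≤ 4 ∧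
      ∀ w z, Sg l₁ l₂ n₁ 0 a 0 1 w z → pB w z ∈ T := by
  have free : ∀ w z, n₁ * w = 0 → ¬ Sg l₁ l₂ n₁ 0 a 0 1 w z := by
    intro w z h0 h
    refine no_infinite_family hfin Set.univ Set.infinite_univ (pB w)
      (fun _ _ _ _ h => (pB_inj h).2) ?_
    intro z' _
    rw [hS]
    obtain ⟨h1, h2, h3, h4, h5⟩ := h
    refine ⟨?_, ?_, ?_, ?_, ?_⟩
    · linear_combination h1
    · linear_combination h2
    · linear_combination h3 + (z' - z) * h0
    · linear_combination h4
    · linear_combination h5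
  by_cases hn : n₁ = 0
  · exact ⟨∅, by simp, fun w z h => absurd h (free w z (by rw [hn, zero_mul]))⟩
  let b : Polynomial K := Polynomial.C (a 4 0) + Polynomial.C (a 3 1) * Polynomial.X
    + Polynomial.C (a 2 2) * Polynomial.X ^ 2 + Polynomial.C (a 1 3) * Polynomial.X ^ 3
    + Polynomial.C (a 0 4) * Polynomial.X ^ 4
  have eb : ∀ w, b.eval w = quarticB a 0 1 w := by
    intro w; simp [b, quarticB]
  have db : b.natDegree ≤ 4 := by unfold b; compute_degree
  by_cases hb : b = 0
  · exfalso
    have c0 := congrArg (fun p => Polynomial.coeff p 0) hb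
    have c1 := congrArg (fun p => Polynomial.coeff p 1) hb
    have c2 := congrArg (fun p => Polynomial.coeff p 2) hb
    have c3 := congrArg (fun p => Polynomial.coeff p 3) hb
    have c4 := congrArg (fun p => Polynomial.coeff p 4) hb
    simp [b, Polynomial.coeff_X, Polynomial.coeff_C] at c0 c1 c2 c3 c4
    refine no_infinite_family hfin ({0}ᶜ) (Set.finite_singleton 0).infinite_compl
      (fun w => pB w (-quarticBx a 0 1 w / (n₁ * w))) (fun _ _ _ _ h => (pB_inj h).1) ?_
    intro w hw
    have hw' : w ≠ 0 := hw
    rw [hS]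
    refine ⟨?_, ?_, ?_, ?_, ?_⟩
    · simp [quarticB, c0, c1, c2, c3, c4]
    · simp
    · field_simp; ring
    · simp [quarticBy, c1, c3]
    · simp [quarticBw, c1, c3]
  · obtain ⟨T, hT, hT'⟩ := cover_roots _ hb 4 db (fun w => pB w (-quarticBx a 0 1 w / (n₁ * w)))
    refine ⟨T, hT, ?_⟩
    intro w z hs
    have hw : n₁ * w ≠ 0 := fun h => free w z h hs
    obtain ⟨h1, -, h3, -, -⟩ := hs
    have : z = -quarticBx a 0 1 w / (n₁ * w) := by
      rw [eq_div_iff hw]; linear_combination h3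
    rw [this]
    apply hT'
    rw [eb]; linear_combination h1

end Helpers

/-- Uniplanar separable case ii): `F = z²x₁² + zG + B` with
`G = x₁²L(x₁,x₂) + x₂x₃N(x₁,x₂)` for linear forms `L, N` in `x₁, x₂`, `G ≢ 0`, `B`
homogeneous of degree 4, `X` irreducible with finite singular locus, over an algebraically
closed field of characteristic 2.  Then `|Sing(X)| ≤ 19`. -/
theorem uniplanar_case_ii_singular_count_le_nineteen
    {K : Type*} [Field K] [IsAlgClosed K] [CharP K 2]
    (l₁ l₂ n₁ n₂ : K)
    (G : MvPolynomial (Fin 4) K)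
    (hG : G = X 0 ^ 2 * (C l₁ * X 0 + C l₂ * X 1)
        + X 1 * X 2 * (C n₁ * X 0 + C n₂ * X 1))
    (hG0 : G ≠ 0)
    (B : MvPolynomial (Fin 3) K) (hBhom : B.IsHomogeneous 4)
    (F : MvPolynomial (Fin 4) K)
    (hF : F = X 3 ^ 2 * X 0 ^ 2 + X 3 * G
        + rename (Fin.castLE (by norm_num : (3:ℕ) ≤ 4)) B)
    (hFirr : Irreducible F) (hfin : (singLocus F).Finite) :
    (singLocus F).ncard ≤ 19 := by
  classical
  obtain ⟨a, ha⟩ := quartic_explicit B hBhom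
  have hmem := mem_iff_sg l₁ l₂ n₁ n₂ a F
    (sg_iff_eval l₁ l₂ n₁ n₂ a F (by rw [hF, hG, ha]))
  have hA : ∀ y w z, pA y w z ∈ singLocus F ↔ Sg l₁ l₂ n₁ n₂ a 1 y w z :=
    fun y w z => hmem _ _
  have hB : ∀ w z, pB w z ∈ singLocus F ↔ Sg l₁ l₂ n₁ n₂ a 0 1 w z := fun w z => hmem _ _
  have hC : ∀ z, pC z ∈ singLocus F ↔ Sg l₁ l₂ n₁ n₂ a 0 0 1 z := fun z => hmem _ _
  have noC := no_pC l₁ l₂ n₁ n₂ a _ hfin hC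
  -- it suffices to cover the affine part and the part at infinity
  have fin_step : ∀ TA TB : Finset (Projectivization K (Fin 4 → K)),
      (∀ y w z, Sg l₁ l₂ n₁ n₂ a 1 y w z → pA y w z ∈ TA) →
      (∀ w z, Sg l₁ l₂ n₁ n₂ a 0 1 w z → pB w z ∈ TB) →
      TA.card + TB.card ≤ 18 → (singLocus F).ncard ≤ 19 := by
    intro TA TB h1 h2 h3
    have hsub : singLocus F ⊆ ((insert pP (TA ∪ TB) : Finset _) : Set _) := by
      intro p hp
      rw [Finset.mem_coe, Finset.mem_insert, Finset.mem_union]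
      rcases point_cases p with ⟨y, w, z, rfl⟩ | ⟨w, z, rfl⟩ | ⟨z, rfl⟩ | rfl
      · exact Or.inr (Or.inl (h1 y w z ((hA y w z).1 hp)))
      · exact Or.inr (Or.inr (h2 w z ((hB w z).1 hp)))
      · exact absurd ((hC z).1 hp) (noC z)
      · exact Or.inl rfl
    have := Set.ncard_le_ncard hsub (Finset.finite_toSet _)
    rw [Set.ncard_coe_finset] at this
    have h4 := Finset.card_insert_le pP (TA ∪ TB)
    have h5 := Finset.card_union_le TA TB
    omega
  by_cases hn2 : n₂ = 0
  · subst hn2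
    obtain ⟨TB, cB, hTB⟩ := infinity_bound_of_eq l₁ l₂ n₁ a _ hfin hB
    by_cases hn1 : n₁ = 0
    · subst hn1
      by_cases hl2 : l₂ = 0
      · subst hl2
        have hl1 : l₁ ≠ 0 := by
          rintro rfl
          exact hG0 (by rw [hG]; simp)
        refine fin_step ∅ TB ?_ hTB (by simp; omega)
        rintro y w z ⟨-, h, -⟩
        exact absurd (by simpa using h) hl1
      · obtain ⟨TA, cA, hTA⟩ := line_bound l₁ l₂ 0 0 a _ hfin hA (-l₁ / l₂) (by simp)
        refine fin_step TA TB ?_ hTB (by omega)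
        intro y w z hs
        have hy : y = -l₁ / l₂ := by
          have h := hs.2.1
          rw [eq_div_iff hl2]
          linear_combination h
        subst hy
        exact hTA w z hs
    · obtain ⟨TA, cA, hTA⟩ := line_bound l₁ l₂ n₁ 0 a _ hfin hA 0 (by simp)
      obtain ⟨TD, cD, hTD⟩ := curve_bound l₁ l₂ n₁ 0 a _ hfin hA (Or.inl hn1)
      refine fin_step (TA ∪ TD) TB ?_ hTB (by have := Finset.card_union_le TA TD; omega)
      intro y w z hs
      rw [Finset.mem_union]
      by_cases hy : y = 0
      · subst hy; exact Or.inl (hTA w z hs)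
      · exact Or.inr (hTD y w z (by simp [hn1, hy]) hs)
  · obtain ⟨TB, cB, hTB⟩ := infinity_bound_of_ne l₁ l₂ n₁ n₂ a hn2
    obtain ⟨TA, cA, hTA⟩ := line_bound l₁ l₂ n₁ n₂ a _ hfin hA 0 (by simp)
    obtain ⟨TE, cE, hTE⟩ := line_bound l₁ l₂ n₁ n₂ a _ hfin hA (-n₁ / n₂) (by field_simp; ring)
    obtain ⟨TD, cD, hTD⟩ := curve_bound l₁ l₂ n₁ n₂ a _ hfin hA (Or.inr hn2)
    refine fin_step (TA ∪ TE ∪ TD) TB ?_ hTB (by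
      have := Finset.card_union_le TA TE
      have := Finset.card_union_le (TA ∪ TE) TD
      omega)
    intro y w z hs
    rw [Finset.mem_union, Finset.mem_union]
    by_cases hy : y = 0
    · subst hy; exact Or.inl (Or.inl (hTA w z hs))
    · by_cases hy' : y = -n₁ / n₂
      · subst hy'; exact Or.inl (Or.inr (hTE w z hs))
      · refine Or.inr (hTD y w z ?_ hs)
        intro h0
        apply hy'
        rw [eq_div_iff hn2]
        apply mul_left_cancel₀ hy
        linear_combination h0

end
end

section
/- Let K be an algebraically closed field of characteristic 2 and let X = {F = 0} ⊂ ℙ³_K be an irreducible quartic surface with Sing(X) finite, where F(x₁,x₂,x₃,z) = z²·x₁² + z·G(x₁,x₂,x₃) + B(x₁,x₂,x₃) with B homogeneous of degree 4 and G = x₁²·L(x₁,x₂,x₃) + x₁x₂·M(x₂,x₃) + x₂³ for some linear forms L in x₁, x₂, x₃ and M in x₂, x₃. Then |Sing(X)| ≤ 19. -/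
open MvPolynomial

noncomputable section

lemma eval_smul_hom {K : Type*} [Field K] {n m : ℕ} {B : MvPolynomial (Fin m) K}
    (hB : B.IsHomogeneous n) (c : K) (v w : Fin m → K) (hw : ∀ i, w i = c * v i) :
    eval w B = c ^ n * eval v B := by
  rw [eval_eq', eval_eq', Finset.mul_sum]
  refine Finset.sum_congr rfl fun d hd => ?_
  have h := hB (mem_support_iff.1 hd)
  rw [Finsupp.weight_apply, Finsupp.sum_fintype _ _ (by simp)] at h
  simp only [Pi.one_apply, smul_eq_mul, mul_one] at h
  simp only [hw, mul_pow, Finset.prod_mul_distrib, Finset.prod_pow_eq_pow_sum, h]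
  ring

lemma chain_rule {K : Type*} [Field K] (f : Fin 3 → Polynomial K) (B : MvPolynomial (Fin 3) K) :
    Polynomial.derivative (aeval f B) =
      ∑ i, aeval f (pderiv i B) * Polynomial.derivative (f i) := by
  induction B using MvPolynomial.induction_on with
  | C a => simp
  | add p q hp hq => simp [hp, hq, add_mul, Finset.sum_add_distrib]
  | mul_X p a h =>
    simp only [map_mul, aeval_X, Polynomial.derivative_mul, h, pderiv_mul, map_add, add_mul,
      Finset.sum_add_distrib, pderiv_X, Pi.single_apply]
    congr 1
    · rw [Finset.sum_mul]; exact Finset.sum_congr rfl fun _ _ => by ring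
    · rw [Finset.sum_eq_single a]
      · simp
      · intro b _ hb; simp [hb.symm]
      · simp

lemma eval_aeval_poly {K : Type*} [Field K] (f : Fin 3 → Polynomial K) (B : MvPolynomial (Fin 3) K)
    (t : K) : (aeval f B).eval t = eval (fun i => (f i).eval t) B := by
  induction B using MvPolynomial.induction_on with
  | C a => simp
  | add p q hp hq => simp [hp, hq]
  | mul_X p a h => simp [h]

lemma euler_eval {K : Type*} [Field K] [CharP K 2] {B : MvPolynomial (Fin 3) K}
    (hB : B.IsHomogeneous 4) (v : Fin 3 → K) :
    v 0 * eval v (pderiv 0 B) + v 1 * eval v (pderiv 1 B) + v 2 * eval v (pderiv 2 B) = 0 := by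
  have h := congrArg (eval v) hB.sum_X_mul_pderiv
  have h2 : (2 : K) = 0 := CharTwo.two_eq_zero
  simp [Fin.sum_univ_three] at h
  rw [h]; linear_combination 2 * eval v B * h2

lemma euler_aeval {K : Type*} [Field K] [CharP K 2] {B : MvPolynomial (Fin 3) K}
    (hB : B.IsHomogeneous 4) (v : Fin 3 → Polynomial K) :
    v 0 * aeval v (pderiv 0 B) + v 1 * aeval v (pderiv 1 B) + v 2 * aeval v (pderiv 2 B) = 0 := by
  have h := congrArg (aeval v) hB.sum_X_mul_pderiv
  have h2 : (2 : Polynomial K) = 0 := CharTwo.two_eq_zero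
  simp [Fin.sum_univ_three] at h
  rw [h]; linear_combination 2 * aeval v B * h2

/-- affine singular point conditions in the chart `x₁ = 1`. -/
def Aff {K : Type*} [Field K] (l₁ l₂ l₃ m₂ m₃ : K) (B : MvPolynomial (Fin 3) K)
    (y w z : K) : Prop :=
  l₁ + l₂ * y + l₃ * w + y * (m₂ * y + m₃ * w) + y ^ 3 = 0 ∧
  z ^ 2 = eval ![1, y, w] B ∧
  z * (l₂ + m₃ * w + y ^ 2) = eval ![1, y, w] (pderiv 1 B) ∧
  z * (l₃ + m₃ * y) = eval ![1, y, w] (pderiv 2 B)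

lemma sq_inj2 {K : Type*} [Field K] [CharP K 2] {a b : K} (h : a ^ 2 = b ^ 2) : a = b := by
  have h2 : (2 : K) = 0 := CharTwo.two_eq_zero
  have : (a - b) ^ 2 = 0 := by linear_combination h + (b ^ 2 - a * b) * h2
  exact sub_eq_zero.1 (pow_eq_zero_iff (two_ne_zero)|>.1 this)

/-- vertical lines -/
lemma vertical {K : Type*} [Field K] [IsAlgClosed K] [CharP K 2] (l₁ l₂ l₃ m₂ m₃ : K)
    (B : MvPolynomial (Fin 3) K) (hB : B.IsHomogeneous 4)
    (hfin : {p : K × K × K | Aff l₁ l₂ l₃ m₂ m₃ B p.1 p.2.1 p.2.2}.Finite)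
    (y₀ : K) (hd : l₃ + m₃ * y₀ = 0) (hq : l₁ + l₂ * y₀ + m₂ * y₀ ^ 2 + y₀ ^ 3 = 0) :
    {p : K × K × K | Aff l₁ l₂ l₃ m₂ m₃ B p.1 p.2.1 p.2.2 ∧ p.1 = y₀}.ncard ≤ 6 := by
  have h2 : (2 : K) = 0 := CharTwo.two_eq_zero
  set f : Fin 3 → Polynomial K := ![1, Polynomial.C y₀, Polynomial.X] with hf
  have hev : ∀ (P : MvPolynomial (Fin 3) K) t, (aeval f P).eval t = eval ![1, y₀, t] P := by
    intro P t
    rw [eval_aeval_poly]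
    congr 2
    funext i; fin_cases i <;> simp [hf]
  have hfd : ∀ i, (f i).natDegree ≤ 1 := by
    intro i; fin_cases i <;> simp [hf]
  have key : ∀ H : Polynomial K, H ≠ 0 → H.natDegree ≤ 6 →
      (∀ w z, Aff l₁ l₂ l₃ m₂ m₃ B y₀ w z → H.eval w = 0) →
      {p : K × K × K | Aff l₁ l₂ l₃ m₂ m₃ B p.1 p.2.1 p.2.2 ∧ p.1 = y₀}.ncard ≤ 6 := by
    intro H hH hdeg hroot
    have h1 := Set.ncard_le_ncard_of_injOn (s := {p : K × K × K | Aff l₁ l₂ l₃ m₂ m₃ B p.1 p.2.1 p.2.2 ∧ p.1 = y₀})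
      (t := (H.rootSet K)) (fun p => p.2.1) ?_ ?_ (H.rootSet_finite K)
    · exact h1.trans ((Polynomial.ncard_rootSet_le H K).trans hdeg)
    · rintro ⟨y, w, z⟩ ⟨h, rfl⟩
      rw [Polynomial.mem_rootSet]
      exact ⟨hH, by simpa using hroot _ _ h⟩
    · rintro ⟨y, w, z⟩ ⟨h, rfl⟩ ⟨y', w', z'⟩ ⟨h', e⟩ hw
      simp only at e hw
      subst e hw
      simp only [Prod.mk.injEq, true_and]
      exact sq_inj2 (h.2.1.trans h'.2.1.symm)
  by_cases h1 : aeval f (pderiv 2 B) = 0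
  · set H := aeval f (pderiv 1 B) ^ 2 +
      aeval f B * (Polynomial.C (l₂ + y₀ ^ 2) + Polynomial.C m₃ * Polynomial.X) ^ 2 with hH
    have hHev : ∀ t, H.eval t = eval ![1, y₀, t] (pderiv 1 B) ^ 2 +
        eval ![1, y₀, t] B * (l₂ + m₃ * t + y₀ ^ 2) ^ 2 := by
      intro t
      simp only [hH, Polynomial.eval_add, Polynomial.eval_mul, Polynomial.eval_pow, hev,
        Polynomial.eval_C, Polynomial.eval_X]
      ring
    by_cases h0 : H = 0
    · exfalso
      have hs : ∀ t : K, ∃ z, z ^ 2 = eval ![1, y₀, t] B := fun t =>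
        IsAlgClosed.exists_pow_nat_eq _ (by norm_num)
      choose s hs using hs
      refine Set.infinite_of_injOn_mapsTo (f := fun t : K => ((y₀, t, s t) : K × K × K))
        (s := Set.univ) ?_ ?_ Set.infinite_univ hfin
      · intro a _ b _ h
        simp only [Prod.mk.injEq] at h
        exact h.2.1
      · intro t _
        refine ⟨?_, hs t, ?_, ?_⟩
        · linear_combination hq + t * hd
        · apply sq_inj2
          have := hHev t
          rw [h0, Polynomial.eval_zero] at this
          rw [mul_pow, hs]
          linear_combination -this - (eval ![1, y₀, t] (pderiv 1 B)) ^ 2 * h2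
        · have := hev (pderiv 2 B) t
          rw [h1, Polynomial.eval_zero] at this
          rw [← this]
          linear_combination s t * hd
    · refine key H h0 ?_ ?_
      · rw [hH]
        have a1 := aeval_natDegree_le B hB.totalDegree_le f hfd
        have a2 := aeval_natDegree_le (pderiv 1 B) (hB.pderiv (i := 1)).totalDegree_le f hfd
        refine (Polynomial.natDegree_add_le _ _).trans (max_le ?_ ?_)
        · refine Polynomial.natDegree_pow_le.trans ?_
          omega
        · refine Polynomial.natDegree_mul_le.trans ?_
          have a3 : ((Polynomial.C (l₂ + y₀ ^ 2) + Polynomial.C m₃ * Polynomial.X) ^ 2).natDegree ≤ 2 := by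
            compute_degree
          omega
      · intro w z h
        rw [hHev, ← h.2.1, ← h.2.2.1]
        linear_combination (z * (l₂ + m₃ * w + y₀ ^ 2)) ^ 2 * h2
  · refine key _ h1 ?_ ?_
    · have a2 := aeval_natDegree_le (pderiv 2 B) (hB.pderiv (i := 2)).totalDegree_le f hfd
      omega
    · intro w z h
      rw [hev, ← h.2.2.2, hd, mul_zero]

/-- the part of the curve which is a graph over the `y`-line -/
lemma graph {K : Type*} [Field K] [IsAlgClosed K] [CharP K 2] (l₁ l₂ l₃ m₂ m₃ : K)
    (B : MvPolynomial (Fin 3) K) (hB : B.IsHomogeneous 4)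
    (hfin : {p : K × K × K | Aff l₁ l₂ l₃ m₂ m₃ B p.1 p.2.1 p.2.2}.Finite)
    (d q e r : Polynomial K) (hd : d = Polynomial.C l₃ + Polynomial.C m₃ * Polynomial.X)
    (hq : q = Polynomial.C l₁ + Polynomial.C l₂ * Polynomial.X +
      Polynomial.C m₂ * Polynomial.X ^ 2 + Polynomial.X ^ 3)
    (hd0 : d ≠ 0) (he0 : e ≠ 0) (hde : ∀ t, d.eval t ≠ 0 → e.eval t ≠ 0)
    (hdr : d * r = e * q) (n : ℕ)
    (hn : (aeval ![e, Polynomial.X * e, r] (pderiv 2 B) ^ 2 +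
      d ^ 2 * e ^ 2 * aeval ![e, Polynomial.X * e, r] B).natDegree ≤ n) :
    {p : K × K × K | Aff l₁ l₂ l₃ m₂ m₃ B p.1 p.2.1 p.2.2 ∧ l₃ + m₃ * p.1 ≠ 0}.ncard ≤ n := by
  have h2 : (2 : K) = 0 := CharTwo.two_eq_zero
  have hp2 : (2 : Polynomial K) = 0 := CharTwo.two_eq_zero
  set f : Fin 3 → Polynomial K := ![e, Polynomial.X * e, r] with hf
  have hdev : ∀ t, d.eval t = l₃ + m₃ * t := by intro t; simp [hd]
  have hqev : ∀ t, q.eval t = l₁ + l₂ * t + m₂ * t ^ 2 + t ^ 3 := by intro t; simp [hq]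
  have hdrev : ∀ t, d.eval t * r.eval t = e.eval t * q.eval t := by
    intro t; rw [← Polynomial.eval_mul, hdr, Polynomial.eval_mul]
  have hev : ∀ (P : MvPolynomial (Fin 3) K) (m : ℕ), P.IsHomogeneous m → ∀ t w,
      r.eval t = e.eval t * w →
      (aeval f P).eval t = (e.eval t) ^ m * eval ![1, t, w] P := by
    intro P m hP t w hw
    rw [eval_aeval_poly]
    apply eval_smul_hom hP
    intro i; fin_cases i <;> simp [hf, hw, mul_comm]
  set H := aeval f (pderiv 2 B) ^ 2 + d ^ 2 * e ^ 2 * aeval f B with hH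
  have hgr : ∀ t w, d.eval t ≠ 0 →
      (l₁ + l₂ * t + l₃ * w + t * (m₂ * t + m₃ * w) + t ^ 3 = 0 ↔ r.eval t = e.eval t * w) := by
    intro t w ht
    have h1 := hdrev t
    constructor
    · intro h
      apply mul_left_cancel₀ ht
      rw [h1, hqev, hdev]
      linear_combination e.eval t * h - e.eval t * (l₃ + m₃ * t) * w * h2
    · intro h
      apply mul_left_cancel₀ (hde t ht)
      rw [h, hqev, hdev] at h1
      linear_combination -h1 + e.eval t * (l₃ + m₃ * t) * w * h2
  by_cases h0 : H = 0
  · exfalso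
    have hB' : Polynomial.derivative (aeval f B) = 0 := by
      have := congrArg Polynomial.derivative h0
      rw [hH] at this
      have h3 : d ^ 2 * e ^ 2 * Polynomial.derivative (aeval f B) = 0 := by
        simp only [Polynomial.derivative_add, Polynomial.derivative_mul, Polynomial.derivative_pow,
          Polynomial.derivative_zero] at this
        simp only [Nat.cast_ofNat, map_zero, CharTwo.two_eq_zero] at this
        simpa using this
      rcases mul_eq_zero.1 h3 with h | h
      · exact absurd h (mul_ne_zero (pow_ne_zero _ hd0) (pow_ne_zero _ he0))
      · exact h
    have hch := chain_rule f B
    rw [hB', Fin.sum_univ_three] at hch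
    have heu := euler_aeval hB f
    simp only [hf, Matrix.cons_val_zero, Matrix.cons_val_one, Matrix.cons_val_two,
      Matrix.vecHead, Matrix.vecTail, Function.comp, Matrix.cons_val_succ, Polynomial.derivative_mul, Polynomial.derivative_X] at hch heu
    rw [← hf] at hch heu
    set e' := Polynomial.derivative e with he'
    set r' := Polynomial.derivative r with hr'
    have hrel : e ^ 2 * aeval f (pderiv 1 B) = (e' * r + e * r') * aeval f (pderiv 2 B) := by
      linear_combination -e * hch - e' * heu - e * r' * aeval f (pderiv 2 B) * hp2
    have hdiff := congrArg Polynomial.derivative hdr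
    have hdd : Polynomial.derivative d = Polynomial.C m₃ := by simp [hd]
    have hqd : ∀ t, (Polynomial.derivative q).eval t = l₂ + 2 * m₂ * t + 3 * t ^ 2 := by
      intro t; simp [hq]; ring
    rw [Polynomial.derivative_mul, Polynomial.derivative_mul, hdd, ← he', ← hr'] at hdiff
    have hinf : {t : K | d.eval t ≠ 0}.Infinite := by
      have h3 : {t : K | d.eval t = 0}.Finite :=
        (d.rootSet_finite K).subset fun t ht => by
          rw [Polynomial.mem_rootSet]; exact ⟨hd0, by simpa using ht⟩
      exact h3.infinite_compl
    refine Set.infinite_of_injOn_mapsTo (f := fun t : K => ((t, r.eval t / e.eval t,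
        eval ![1, t, r.eval t / e.eval t] (pderiv 2 B) / d.eval t) : K × K × K))
        (s := {t : K | d.eval t ≠ 0}) ?_ ?_ hinf hfin
    · intro a _ b _ h
      simp only [Prod.mk.injEq] at h
      exact h.1
    · intro t ht
      have hdt : d.eval t ≠ 0 := ht
      have het := hde t hdt
      change Aff l₁ l₂ l₃ m₂ m₃ B t (r.eval t / e.eval t)
        (eval ![1, t, r.eval t / e.eval t] (pderiv 2 B) / d.eval t)
      obtain ⟨w, hw⟩ : ∃ w, w = r.eval t / e.eval t := ⟨_, rfl⟩
      have hr : r.eval t = e.eval t * w := by rw [hw]; field_simp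
      rw [← hw]
      have hB0 := hev _ _ hB t w hr
      have hB1 := hev _ _ (hB.pderiv (i := 1)) t w hr
      have hB2 := hev _ _ (hB.pderiv (i := 2)) t w hr
      obtain ⟨z, hz⟩ : ∃ z, z = eval ![1, t, w] (pderiv 2 B) / d.eval t := ⟨_, rfl⟩
      have hz' : z * d.eval t = eval ![1, t, w] (pderiv 2 B) := by rw [hz]; field_simp
      rw [← hz]
      have hHt := congrArg (Polynomial.eval t) h0
      rw [hH] at hHt
      have hrelt := congrArg (Polynomial.eval t) hrel
      have hdifft := congrArg (Polynomial.eval t) hdiff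
      have hdrt := hdrev t
      simp only [Polynomial.eval_add, Polynomial.eval_mul, Polynomial.eval_pow, hB0, hB1, hB2,
        Polynomial.eval_C, Polynomial.eval_zero, hqd, hr, ← hz'] at hHt hrelt hdifft hdrt
      have hq' : q.eval t = d.eval t * w := by
        apply mul_left_cancel₀ het
        linear_combination -hdrt
      rw [hq'] at hdifft
      norm_num at hHt hrelt
      refine ⟨(hgr t w hdt).2 hr, ?_, ?_, ?_⟩
      · have : (d.eval t ^ 2 * e.eval t ^ 6) * (z ^ 2) =
            (d.eval t ^ 2 * e.eval t ^ 6) * (eval ![1, t, w] B) := by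
          linear_combination hHt - (d.eval t ^ 2 * e.eval t ^ 6) * (eval ![1, t, w] B) * h2
        exact mul_left_cancel₀ (mul_ne_zero (pow_ne_zero _ hdt) (pow_ne_zero _ het)) this
      · have : (e.eval t ^ 5) * (z * (l₂ + m₃ * w + t ^ 2)) =
            (e.eval t ^ 5) * (eval ![1, t, w] (pderiv 1 B)) := by
          linear_combination -hrelt - e.eval t ^ 4 * z * hdifft +
            e.eval t ^ 4 * z * (m₃ * e.eval t * w
              - e.eval t * m₂ * t - e.eval t * t ^ 2 - d.eval t * w * e'.eval t) * h2
        exact mul_left_cancel₀ (pow_ne_zero _ het) this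
      · rw [← hz', hdev]
  · have h1 := Set.ncard_le_ncard_of_injOn
      (s := {p : K × K × K | Aff l₁ l₂ l₃ m₂ m₃ B p.1 p.2.1 p.2.2 ∧ l₃ + m₃ * p.1 ≠ 0})
      (t := (H.rootSet K)) (fun p => p.1) ?_ ?_ (H.rootSet_finite K)
    · exact h1.trans ((Polynomial.ncard_rootSet_le H K).trans hn)
    · rintro ⟨y, w, z⟩ ⟨h, hy⟩
      rw [← hdev] at hy
      rw [Polynomial.mem_rootSet]
      refine ⟨h0, ?_⟩
      have hr := (hgr y w hy).1 h.1
      simp only [Polynomial.coe_aeval_eq_eval, hH, Polynomial.eval_add, Polynomial.eval_mul,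
        Polynomial.eval_pow, hev _ _ hB y w hr, hev _ _ (hB.pderiv (i := 2)) y w hr]
      rw [← h.2.1, ← h.2.2.2, hdev]
      norm_num
      linear_combination (e.eval y ^ 3 * (z * (l₃ + m₃ * y))) ^ 2 * h2
    · rintro ⟨y, w, z⟩ ⟨h, hy⟩ ⟨y', w', z'⟩ ⟨h', hy'⟩ hyy
      simp only at hyy
      subst hyy
      rw [← hdev] at hy
      have hr := (hgr y w hy).1 h.1
      have hr' := (hgr y w' hy).1 h'.1
      have : w = w' := mul_left_cancel₀ (hde y hy) (hr.symm.trans hr')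
      subst this
      simp only [Prod.mk.injEq, true_and]
      exact sq_inj2 (h.2.1.trans h'.2.1.symm)

lemma core_bound {K : Type*} [Field K] [IsAlgClosed K] [CharP K 2] (l₁ l₂ l₃ m₂ m₃ : K)
    (B : MvPolynomial (Fin 3) K) (hB : B.IsHomogeneous 4)
    (hfin : {p : K × K × K | Aff l₁ l₂ l₃ m₂ m₃ B p.1 p.2.1 p.2.2}.Finite) :
    {p : K × K × K | Aff l₁ l₂ l₃ m₂ m₃ B p.1 p.2.1 p.2.2}.ncard ≤ 18 := by
  classical
  obtain ⟨d, hd⟩ : ∃ d : Polynomial K,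
    d = Polynomial.C l₃ + Polynomial.C m₃ * Polynomial.X := ⟨_, rfl⟩
  obtain ⟨q, hq⟩ : ∃ q : Polynomial K, q = Polynomial.C l₁ + Polynomial.C l₂ * Polynomial.X +
      Polynomial.C m₂ * Polynomial.X ^ 2 + Polynomial.X ^ 3 := ⟨_, rfl⟩
  have hdev : ∀ t, d.eval t = l₃ + m₃ * t := by intro t; simp [hd]
  have hqev : ∀ t, q.eval t = l₁ + l₂ * t + m₂ * t ^ 2 + t ^ 3 := by intro t; simp [hq]
  have hddeg : d.natDegree ≤ 1 := by rw [hd]; compute_degree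
  have hqdeg : q.natDegree = 3 := by rw [hq]; compute_degree!
  have hq0 : q ≠ 0 := by rintro rfl; simp at hqdeg
  have hvq : ∀ y w z, Aff l₁ l₂ l₃ m₂ m₃ B y w z → d.eval y = 0 → q.eval y = 0 := by
    intro y w z h h'
    rw [hdev] at h'
    rw [hqev]
    linear_combination h.1 - w * h'
  by_cases hd0 : d = 0
  · have hdz : ∀ t, l₃ + m₃ * t = 0 := by intro t; rw [← hdev, hd0]; simp
    rw [Set.ncard_eq_toFinset_card _ hfin]
    have h1 := Finset.card_le_mul_card_image (f := fun p : K × K × K => p.1) hfin.toFinset 6 ?_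
    · have h3 : (hfin.toFinset.image (fun p : K × K × K => p.1)) ⊆ q.roots.toFinset := by
        intro y hy
        rw [Finset.mem_image] at hy
        obtain ⟨⟨y', w, z⟩, h, rfl⟩ := hy
        rw [Set.Finite.mem_toFinset] at h
        rw [Multiset.mem_toFinset, Polynomial.mem_roots hq0]
        exact hvq _ _ _ h (by rw [hd0]; simp)
      have h4 := Finset.card_le_card h3
      have h5 := q.roots.toFinset_card_le
      have h6 := q.card_roots'
      omega
    · intro y hy
      rw [Finset.mem_image] at hy
      obtain ⟨⟨y', w, z⟩, h, rfl⟩ := hy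
      rw [Set.Finite.mem_toFinset] at h
      have h7 := hvq _ _ _ h (by rw [hd0]; simp)
      rw [hqev] at h7
      have h8 := vertical l₁ l₂ l₃ m₂ m₃ B hB hfin y' (hdz _) h7
      rw [← Set.ncard_coe_finset]
      convert h8 using 2
      ext p
      simp
  by_cases hv : ∃ y₀, d.eval y₀ = 0 ∧ q.eval y₀ = 0
  · obtain ⟨y₀, hy1, hy2⟩ := hv
    have hdy : l₃ + m₃ * y₀ = 0 := by rw [← hdev, hy1]
    have hm : m₃ ≠ 0 := by
      rintro rfl
      apply hd0
      have : l₃ = 0 := by simpa using hdy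
      rw [hd, this]; simp
    have hdfac : d = Polynomial.C m₃ * (Polynomial.X - Polynomial.C y₀) := by
      have : l₃ = - (m₃ * y₀) := by linear_combination hdy
      rw [hd, this]; simp; ring
    obtain ⟨q₁, hq₁⟩ := Polynomial.dvd_iff_isRoot.2 hy2
    have hdr : d * (Polynomial.C m₃⁻¹ * q₁) = 1 * q := by
      rw [hdfac, hq₁]
      have : Polynomial.C m₃ * Polynomial.C m₃⁻¹ = 1 := by
        rw [← Polynomial.C_mul, mul_inv_cancel₀ hm, Polynomial.C_1]
      linear_combination (Polynomial.X - Polynomial.C y₀) * q₁ * this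
    have hq₁0 : q₁ ≠ 0 := by rintro rfl; simp at hq₁; exact hq0 hq₁
    have hq₁deg : q₁.natDegree = 2 := by
      have := congrArg Polynomial.natDegree hq₁
      rw [Polynomial.natDegree_mul (Polynomial.X_sub_C_ne_zero _) hq₁0,
        Polynomial.natDegree_X_sub_C] at this
      omega
    have hrdeg : (Polynomial.C m₃⁻¹ * q₁).natDegree ≤ 2 :=
      (Polynomial.natDegree_C_mul_le _ _).trans hq₁deg.le
    have hfd : ∀ i, ((![1, Polynomial.X * 1, Polynomial.C m₃⁻¹ * q₁] : Fin 3 → Polynomial K)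
        i).natDegree ≤ 2 := by
      intro i; fin_cases i
      · simp
      · simp
      · exact hrdeg
    have hN := graph l₁ l₂ l₃ m₂ m₃ B hB hfin d q 1 (Polynomial.C m₃⁻¹ * q₁) hd hq hd0
      one_ne_zero (by simp) hdr 12 (by
        have a1 := aeval_natDegree_le B hB.totalDegree_le _ hfd
        have a2 := aeval_natDegree_le (pderiv 2 B) (hB.pderiv (i := 2)).totalDegree_le _ hfd
        refine (Polynomial.natDegree_add_le _ _).trans (max_le ?_ ?_)
        · refine Polynomial.natDegree_pow_le.trans ?_
          omega
        · refine Polynomial.natDegree_mul_le.trans ?_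
          have a3 : (d ^ 2 * 1 ^ 2).natDegree ≤ 2 := by
            rw [one_pow, mul_one]
            refine Polynomial.natDegree_pow_le.trans ?_
            omega
          omega)
    have hV := vertical l₁ l₂ l₃ m₂ m₃ B hB hfin y₀ hdy (by rw [← hqev, hy2])
    have hsub : {p : K × K × K | Aff l₁ l₂ l₃ m₂ m₃ B p.1 p.2.1 p.2.2} =
      {p : K × K × K | Aff l₁ l₂ l₃ m₂ m₃ B p.1 p.2.1 p.2.2 ∧ l₃ + m₃ * p.1 ≠ 0} ∪
      {p : K × K × K | Aff l₁ l₂ l₃ m₂ m₃ B p.1 p.2.1 p.2.2 ∧ p.1 = y₀} := by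
      ext p
      simp only [Set.mem_ofPred_eq, Set.mem_union]
      constructor
      · intro h
        by_cases h' : l₃ + m₃ * p.1 = 0
        · right
          refine ⟨h, mul_left_cancel₀ hm ?_⟩
          linear_combination h' - hdy
        · exact Or.inl ⟨h, h'⟩
      · rintro (h | h) <;> exact h.1
    rw [hsub]
    exact (Set.ncard_union_le _ _).trans (by omega)
  · have hfd : ∀ i, ((![d, Polynomial.X * d, q] : Fin 3 → Polynomial K) i).natDegree ≤ 3 := by
      intro i; fin_cases i
      · exact hddeg.trans (by norm_num)
      · refine Polynomial.natDegree_mul_le.trans ?_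
        rw [Polynomial.natDegree_X]; omega
      · exact hqdeg.le
    have hN := graph l₁ l₂ l₃ m₂ m₃ B hB hfin d q d q hd hq hd0 hd0 (fun _ h => h) rfl 18 (by
        have a1 := aeval_natDegree_le B hB.totalDegree_le _ hfd
        have a2 := aeval_natDegree_le (pderiv 2 B) (hB.pderiv (i := 2)).totalDegree_le _ hfd
        refine (Polynomial.natDegree_add_le _ _).trans (max_le ?_ ?_)
        · refine Polynomial.natDegree_pow_le.trans ?_
          omega
        · refine Polynomial.natDegree_mul_le.trans ?_
          have a3 : (d ^ 2).natDegree ≤ 2 := by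
            refine Polynomial.natDegree_pow_le.trans ?_
            omega
          have a4 : (d ^ 2 * d ^ 2).natDegree ≤ 4 := by
            refine Polynomial.natDegree_mul_le.trans ?_
            omega
          omega)
    have hsub : {p : K × K × K | Aff l₁ l₂ l₃ m₂ m₃ B p.1 p.2.1 p.2.2} =
      {p : K × K × K | Aff l₁ l₂ l₃ m₂ m₃ B p.1 p.2.1 p.2.2 ∧ l₃ + m₃ * p.1 ≠ 0} := by
      ext p
      simp only [Set.mem_ofPred_eq]
      constructor
      · intro h
        refine ⟨h, fun h' => hv ⟨p.1, ?_, hvq _ _ _ h ?_⟩⟩ <;> rw [hdev, h']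
      · exact fun h => h.1
    rw [hsub]
    exact hN

lemma mem_singLocus_of {K : Type*} [Field K] {F : MvPolynomial (Fin 4) K} {n : ℕ}
    (hF : F.IsHomogeneous n) (v : Fin 4 → K) (hv : v ≠ 0)
    (h : eval v F = 0 ∧ ∀ i, eval v (pderiv i F) = 0) :
    Projectivization.mk K v hv ∈ singLocus F := by
  intro u hu huv
  rw [Projectivization.mk_eq_mk_iff'] at huv
  obtain ⟨a, rfl⟩ := huv
  refine ⟨?_, fun i => ?_⟩
  · rw [eval_smul_hom hF a v (a • v) (fun i => rfl), h.1, mul_zero]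
  · rw [eval_smul_hom hF.pderiv a v (a • v) (fun i => rfl), h.2 i, mul_zero]

/-- explicit form of the singularity conditions at a vector -/
lemma sing_cond {K : Type*} [Field K] [CharP K 2]
    (l₁ l₂ l₃ m₂ m₃ : K)
    (G : MvPolynomial (Fin 4) K)
    (hG : G = X 0 ^ 2 * (C l₁ * X 0 + C l₂ * X 1 + C l₃ * X 2)
        + X 0 * X 1 * (C m₂ * X 1 + C m₃ * X 2) + X 1 ^ 3)
    (B : MvPolynomial (Fin 3) K)
    (F : MvPolynomial (Fin 4) K)
    (hF : F = X 3 ^ 2 * X 0 ^ 2 + X 3 * G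
        + rename (Fin.castLE (by norm_num : (3:ℕ) ≤ 4)) B) (x y w z : K) :
    (eval ![x, y, w, z] F = 0 ∧ ∀ i, eval ![x, y, w, z] (pderiv i F) = 0) ↔
    (x ^ 2 * (l₁ * x + l₂ * y + l₃ * w) + x * y * (m₂ * y + m₃ * w) + y ^ 3 = 0 ∧
     z ^ 2 * x ^ 2 = eval ![x, y, w] B ∧
     z * (x ^ 2 * l₁ + y * (m₂ * y + m₃ * w)) = eval ![x, y, w] (pderiv 0 B) ∧
     z * (x ^ 2 * l₂ + x * m₃ * w + y ^ 2) = eval ![x, y, w] (pderiv 1 B) ∧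
     z * (x ^ 2 * l₃ + x * y * m₃) = eval ![x, y, w] (pderiv 2 B)) := by
  have h2 : (2 : K) = 0 := CharTwo.two_eq_zero
  have hinj : Function.Injective (Fin.castLE (by norm_num : (3:ℕ) ≤ 4)) := Fin.castLE_injective _
  have hcomp : (![x, y, w, z] ∘ Fin.castLE (by norm_num : (3:ℕ) ≤ 4)) = ![x, y, w] := by
    funext i; fin_cases i <;> rfl
  have r0 := pderiv_rename hinj 0 B
  have r1 := pderiv_rename hinj 1 B
  have r2 := pderiv_rename hinj 2 B
  have r3 : pderiv 3 (rename (Fin.castLE (by norm_num : (3:ℕ) ≤ 4)) B) = 0 := by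
    apply pderiv_eq_zero_of_notMem_vars
    intro h
    have := vars_rename _ _ h
    rw [Finset.mem_image] at this
    obtain ⟨i, _, hi⟩ := this
    fin_cases i <;> simp [Fin.ext_iff] at hi
  change pderiv 0 _ = _ at r0
  change pderiv 1 _ = _ at r1
  change pderiv 2 _ = _ at r2
  have e0 : eval ![x, y, w, z] F = z ^ 2 * x ^ 2 + z * (x ^ 2 * (l₁ * x + l₂ * y + l₃ * w) + x * y * (m₂ * y + m₃ * w) + y ^ 3) + eval ![x, y, w] B := by
    simp [hF, hG, eval_rename, hcomp]
  have d0 : eval ![x, y, w, z] (pderiv 0 F) = z * (x ^ 2 * l₁ + y * (m₂ * y + m₃ * w))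
      + eval ![x, y, w] (pderiv 0 B) := by
    rw [hF, map_add, r0]
    simp [hG, eval_rename, hcomp, pderiv_X, -mul_eq_mul_left_iff, -mul_eq_zero]
    linear_combination (z ^ 2 * x + z * x * (l₁ * x + l₂ * y + l₃ * w)) * h2
  have d1 : eval ![x, y, w, z] (pderiv 1 F) = z * (x ^ 2 * l₂ + x * m₃ * w + y ^ 2)
      + eval ![x, y, w] (pderiv 1 B) := by
    rw [hF, map_add, r1]
    simp [hG, eval_rename, hcomp, pderiv_X, -mul_eq_mul_left_iff, -mul_eq_zero]
    linear_combination (z * x * y * m₂ + z * y ^ 2) * h2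
  have d2 : eval ![x, y, w, z] (pderiv 2 F) = z * (x ^ 2 * l₃ + x * y * m₃)
      + eval ![x, y, w] (pderiv 2 B) := by
    rw [hF, map_add, r2]
    simp [hG, eval_rename, hcomp, pderiv_X, -mul_eq_mul_left_iff, -mul_eq_zero]
  have d3 : eval ![x, y, w, z] (pderiv 3 F) =
      x ^ 2 * (l₁ * x + l₂ * y + l₃ * w) + x * y * (m₂ * y + m₃ * w) + y ^ 3 := by
    rw [hF, map_add, r3]
    simp [hG, pderiv_X, -mul_eq_mul_left_iff, -mul_eq_zero]
    linear_combination (z * x ^ 2) * h2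
  rw [Fin.forall_fin_succ, Fin.forall_fin_succ, Fin.forall_fin_succ, Fin.forall_fin_one]
  change (_ ∧ eval ![x, y, w, z] (pderiv 0 F) = 0 ∧ eval ![x, y, w, z] (pderiv 1 F) = 0 ∧
    eval ![x, y, w, z] (pderiv 2 F) = 0 ∧ eval ![x, y, w, z] (pderiv 3 F) = 0) ↔ _
  rw [e0, d0, d1, d2, d3]
  constructor
  · rintro ⟨h1, h3, h4, h5, h6⟩
    rw [h6, mul_zero, add_zero] at h1
    exact ⟨h6, CharTwo.add_eq_zero.1 h1, CharTwo.add_eq_zero.1 h3, CharTwo.add_eq_zero.1 h4,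
      CharTwo.add_eq_zero.1 h5⟩
  · rintro ⟨h6, h1, h3, h4, h5⟩
    rw [h6, mul_zero, add_zero]
    exact ⟨CharTwo.add_eq_zero.2 h1, CharTwo.add_eq_zero.2 h3, CharTwo.add_eq_zero.2 h4,
      CharTwo.add_eq_zero.2 h5, rfl⟩

/-- Uniplanar separable case iii): `F = z²x₁² + zG + B` with
`G = x₁²L(x₁,x₂,x₃) + x₁x₂M(x₂,x₃) + x₂³` for linear forms `L` in `x₁,x₂,x₃` and `M` in
`x₂,x₃`, `B` homogeneous of degree 4, `X` irreducible with finite singular locus, over an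
algebraically closed field of characteristic 2.  Then `|Sing(X)| ≤ 19`. -/
theorem uniplanar_case_iii_singular_count_le_nineteen
    {K : Type*} [Field K] [IsAlgClosed K] [CharP K 2]
    (l₁ l₂ l₃ m₂ m₃ : K)
    (G : MvPolynomial (Fin 4) K)
    (hG : G = X 0 ^ 2 * (C l₁ * X 0 + C l₂ * X 1 + C l₃ * X 2)
        + X 0 * X 1 * (C m₂ * X 1 + C m₃ * X 2) + X 1 ^ 3)
    (B : MvPolynomial (Fin 3) K) (hBhom : B.IsHomogeneous 4)
    (F : MvPolynomial (Fin 4) K)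
    (hF : F = X 3 ^ 2 * X 0 ^ 2 + X 3 * G
        + rename (Fin.castLE (by norm_num : (3:ℕ) ≤ 4)) B)
    (hFirr : Irreducible F) (hfin : (singLocus F).Finite) :
    (singLocus F).ncard ≤ 19 := by
  have hsc := sing_cond l₁ l₂ l₃ m₂ m₃ G hG B F hF
  have hC : ∀ (a : K) (i : Fin 4), (C a * X i : MvPolynomial (Fin 4) K).IsHomogeneous 1 :=
    fun a i => by simpa using (isHomogeneous_C _ a).mul (isHomogeneous_X K i)
  have hX := fun i : Fin 4 => isHomogeneous_X K i
  have hGhom : G.IsHomogeneous 3 := by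
    rw [hG]
    refine ((((hX 0).pow 2).mul (((hC _ _).add (hC _ _)).add (hC _ _))).add ?_).add ((hX 1).pow 3)
    exact ((hX 0).mul (hX 1)).mul ((hC _ _).add (hC _ _))
  have hFhom : F.IsHomogeneous 4 := by
    rw [hF]
    exact ((((hX 3).pow 2).mul ((hX 0).pow 2)).add ((hX 3).mul hGhom)).add
      hBhom.rename_isHomogeneous
  have hne1 : ∀ y w z : K, ![1, y, w, z] ≠ 0 := fun y w z h => by
    simpa using congrFun h 0
  have hneP : (![0, 0, 0, 1] : Fin 4 → K) ≠ 0 := fun h => by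
    simpa using congrFun h 3
  have hAff : ∀ y w z, Aff l₁ l₂ l₃ m₂ m₃ B y w z ↔
      (eval ![1, y, w, z] F = 0 ∧ ∀ i, eval ![1, y, w, z] (pderiv i F) = 0) := by
    intro y w z
    rw [hsc]
    have heu := euler_eval hBhom ![1, y, w]
    have h2 : (2 : K) = 0 := CharTwo.two_eq_zero
    simp only [Matrix.cons_val_zero, Matrix.cons_val_one, Matrix.cons_val_two,
      Matrix.vecHead, Matrix.vecTail, Function.comp, Matrix.cons_val_succ] at heu
    constructor
    · rintro ⟨h1, h3, h4, h5⟩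
      refine ⟨by linear_combination h1, by linear_combination h3, ?_, by linear_combination h4,
        by linear_combination h5⟩
      linear_combination z * h1 - heu - y * h4 - w * h5 + z * y * m₃ * w * h2
    · rintro ⟨h1, h3, h4, h5, h6⟩
      exact ⟨by linear_combination h1, by linear_combination h3, by linear_combination h5,
        by linear_combination h6⟩
  obtain ⟨φ, hφ⟩ : ∃ φ : K × K × K → Projectivization K (Fin 4 → K),
    φ = fun p => Projectivization.mk K ![1, p.1, p.2.1, p.2.2] (hne1 _ _ _) := ⟨_, rfl⟩
  have hφinj : Function.Injective φ := by
    rintro ⟨y, w, z⟩ ⟨y', w', z'⟩ h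
    rw [hφ] at h
    simp only [Projectivization.mk_eq_mk_iff'] at h
    obtain ⟨a, ha⟩ := h
    have h0 := congrFun ha 0
    have h1 := congrFun ha 1
    have h2 := congrFun ha 2
    have h3 := congrFun ha 3
    simp at h0 h1 h2 h3
    subst h0
    simp at h1 h2 h3
    simp [h1, h2, h3]
  have hSfin : {p : K × K × K | Aff l₁ l₂ l₃ m₂ m₃ B p.1 p.2.1 p.2.2}.Finite := by
    refine Set.Finite.of_injOn (f := φ) ?_ hφinj.injOn hfin
    intro p hp
    rw [hφ]
    exact mem_singLocus_of hFhom _ _ ((hAff _ _ _).1 hp)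
  have hcore := core_bound l₁ l₂ l₃ m₂ m₃ B hBhom hSfin
  have hsub : singLocus F ⊆ insert (Projectivization.mk K ![0, 0, 0, 1] hneP)
      (φ '' {p : K × K × K | Aff l₁ l₂ l₃ m₂ m₃ B p.1 p.2.1 p.2.2}) := by
    intro p hp
    induction p using Projectivization.ind with | _ v hv => ?_
    obtain ⟨x, y, w, z, rfl⟩ : ∃ x y w z, v = ![x, y, w, z] :=
      ⟨v 0, v 1, v 2, v 3, by funext i; fin_cases i <;> rfl⟩
    by_cases hx : x = 0
    · left
      subst hx
      have h := (hsc _ _ _ _).1 (hp _ hv rfl)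
      have hy : y = 0 := by
        have h1 := h.1
        have : y ^ 3 = 0 := by linear_combination h1
        exact pow_eq_zero_iff (by norm_num) |>.1 this
      subst hy
      by_cases hw : w = 0
      · subst hw
        rw [Projectivization.mk_eq_mk_iff']
        exact ⟨z, by funext i; fin_cases i <;> simp⟩
      · exfalso
        have hne : ∀ t : K, (![0, 0, w, t] : Fin 4 → K) ≠ 0 := fun t h => by
          have := congrFun h 2
          simp at this
          exact hw this
        refine Set.infinite_of_injOn_mapsTo
          (f := fun t : K => Projectivization.mk K ![0, 0, w, t] (hne t))
          (s := Set.univ) ?_ ?_ Set.infinite_univ hfin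
        · intro a _ b _ hab
          simp only [Projectivization.mk_eq_mk_iff'] at hab
          obtain ⟨c, hc⟩ := hab
          have h2 := congrFun hc 2
          have h3 := congrFun hc 3
          simp only [Pi.smul_apply, Matrix.cons_val, smul_eq_mul] at h2 h3
          have hc1 : c = 1 := mul_right_cancel₀ hw (by linear_combination h2)
          rw [← h3, hc1, one_mul]
        · intro t _
          apply mem_singLocus_of hFhom
          rw [hsc]
          obtain ⟨h1, h3, h4, h5, h6⟩ := h
          rw [← h3, ← h4, ← h5, ← h6]
          simp
    · right
      refine ⟨(y / x, w / x, z / x), ?_, ?_⟩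
      · simp only [Set.mem_ofPred_eq]
        rw [hAff]
        apply hp _ (hne1 _ _ _)
        rw [Projectivization.mk_eq_mk_iff']
        refine ⟨x⁻¹, ?_⟩
        funext i; fin_cases i <;> simp [hx, div_eq_inv_mul]
      · rw [hφ]
        simp only
        rw [Projectivization.mk_eq_mk_iff']
        refine ⟨x⁻¹, ?_⟩
        funext i; fin_cases i <;> simp [hx, div_eq_inv_mul]
  calc (singLocus F).ncard ≤ _ := Set.ncard_le_ncard hsub ((hSfin.image φ).insert _)
    _ ≤ (φ '' {p : K × K × K | Aff l₁ l₂ l₃ m₂ m₃ B p.1 p.2.1 p.2.2}).ncard + 1 :=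
        Set.ncard_insert_le _ _
    _ ≤ _ := by
        have := Set.ncard_image_le (f := φ) hSfin
        omega
end
end

section
/- Let K be an algebraically closed field of characteristic 2 and let X = {F = 0} ⊂ ℙ³_K be an irreducible quartic surface whose singular locus Sing(X) is a finite set. Then |Sing(X)| ≤ 20. -/
open MvPolynomial

noncomputable section

/-! ### Linear forms -/

/-- The linear form attached to a functional. -/
def linForm {K : Type*} [Field K] (φ : (Fin 4 → K) →ₗ[K] K) : MvPolynomial (Fin 4) K :=
  ∑ i, C (φ (Pi.single i 1)) * X i

theorem eval_linForm {K : Type*} [Field K] (φ : (Fin 4 → K) →ₗ[K] K) (w : Fin 4 → K) :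
    eval w (linForm φ) = φ w := by
  rw [linForm, map_sum]
  conv_rhs => rw [pi_eq_sum_univ' w, map_sum]
  refine Finset.sum_congr rfl fun i _ => ?_
  have : (fun j => if i = j then (1 : K) else 0) = Pi.single i 1 := by
    ext j; simp [Pi.single_apply, eq_comm]
  simp [mul_comm]

theorem linForm_hom {K : Type*} [Field K] (φ : (Fin 4 → K) →ₗ[K] K) :
    (linForm φ).IsHomogeneous 1 := by
  refine IsHomogeneous.sum _ _ _ fun i _ => isHomogeneous_C_mul_X _ _

theorem linForm_pderiv {K : Type*} [Field K] (φ : (Fin 4 → K) →ₗ[K] K) (i : Fin 4) :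
    pderiv i (linForm φ) = C (φ (Pi.single i 1)) := by
  simp [linForm, pderiv_X, Pi.single_apply]

/-- Substitution that kills the coordinate forms in `T`. -/
def killSubst {K τ : Type*} [Field K] [Fintype τ] [DecidableEq τ]
    (b : Module.Basis τ K (Fin 4 → K)) (T : Finset τ) :
    MvPolynomial (Fin 4) K →ₐ[K] MvPolynomial (Fin 4) K :=
  aeval fun i => ∑ j ∈ Finset.univ \ T, C (b j i) * linForm (b.coord j)

theorem X_eq_sum {K τ : Type*} [Field K] [Fintype τ]
    (b : Module.Basis τ K (Fin 4 → K)) (i : Fin 4) :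
    (X i : MvPolynomial (Fin 4) K) = ∑ j, C (b j i) * linForm (b.coord j) := by
  simp only [linForm, Finset.mul_sum]
  rw [Finset.sum_comm]
  have h : ∀ k : Fin 4, ∑ j, b j i * b.coord j (Pi.single k 1) = if k = i then 1 else 0 := by
    intro k
    have := congrFun (b.sum_repr (Pi.single k 1)) i
    simp only [Finset.sum_apply, Pi.smul_apply, smul_eq_mul, Pi.single_apply] at this
    simp only [Module.Basis.coord_apply]
    rw [show (if k = i then (1 : K) else 0) = if i = k then 1 else 0 by simp [eq_comm], ← this]
    exact Finset.sum_congr rfl fun j _ => mul_comm _ _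
  have : ∀ k : Fin 4, ∑ j, C (b j i) * (C (b.coord j (Pi.single k 1)) * X k)
      = (if k = i then (X k : MvPolynomial (Fin 4) K) else 0) := by
    intro k
    simp_rw [← mul_assoc, ← C_mul, ← Finset.sum_mul, ← map_sum, h]
    split <;> simp
  simp_rw [this]
  simp

theorem killSubst_linForm {K τ : Type*} [Field K] [Fintype τ] [DecidableEq τ]
    (b : Module.Basis τ K (Fin 4 → K)) (T : Finset τ) (φ : (Fin 4 → K) →ₗ[K] K) :
    killSubst b T (linForm φ) = ∑ j ∈ Finset.univ \ T, C (φ (b j)) * linForm (b.coord j) := by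
  have h : ∀ j, φ (b j) = ∑ i, φ (Pi.single i 1) * b j i := by
    intro j
    rw [← eval_linForm φ (b j)]; simp [linForm]
  conv_lhs => rw [linForm]
  simp only [killSubst, map_sum, map_mul, aeval_X, algHom_C, algebraMap_eq, Finset.mul_sum]
  rw [Finset.sum_comm]
  refine Finset.sum_congr rfl fun j _ => ?_
  rw [h, map_sum, Finset.sum_mul]
  simp [mul_assoc]

theorem killSubst_ker {K τ : Type*} [Field K] [Fintype τ] [DecidableEq τ]
    (b : Module.Basis τ K (Fin 4 → K)) (T : Finset τ) (f : MvPolynomial (Fin 4) K) :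
    f ∈ Ideal.span (Set.image (fun j => linForm (b.coord j)) (T : Set τ)) ↔ killSubst b T f = 0 := by
  constructor
  · intro hf
    have : Ideal.span (Set.image (fun j => linForm (b.coord j)) (T : Set τ))
        ≤ RingHom.ker (killSubst b T) := by
      rw [Ideal.span_le]
      rintro _ ⟨j, hj, rfl⟩
      simp only [SetLike.mem_coe, RingHom.mem_ker]
      rw [killSubst_linForm]
      refine Finset.sum_eq_zero fun k hk => ?_
      have : k ≠ j := by
        rintro rfl
        simp at hk; exact hk (by simpa using hj)
      simp [this]
    exact this hf
  · intro hf
    have key : ∀ p : MvPolynomial (Fin 4) K,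
        Ideal.Quotient.mkₐ K (Ideal.span (Set.image (fun j => linForm (b.coord j)) (T : Set τ))) p
        = Ideal.Quotient.mkₐ K (Ideal.span (Set.image (fun j => linForm (b.coord j)) (T : Set τ)))
          (killSubst b T p) := by
      intro p
      rw [← AlgHom.comp_apply]
      congr 1
      apply MvPolynomial.algHom_ext
      intro i
      simp only [AlgHom.comp_apply, killSubst, aeval_X, Ideal.Quotient.mkₐ_eq_mk]
      rw [Ideal.Quotient.eq, X_eq_sum b i, ← Finset.sum_sdiff (Finset.subset_univ T),
        add_sub_cancel_left]
      refine Ideal.sum_mem _ fun j hj => Ideal.mul_mem_left _ _ (Ideal.subset_span ⟨j, ?_, rfl⟩)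
      simpa using hj
    have := key f
    rw [hf, map_zero] at this
    exact Ideal.Quotient.eq_zero_iff_mem.mp this

theorem exists_basis {K : Type*} [Field K] (v w : Fin 4 → K) (h : LinearIndependent K ![v, w]) :
    ∃ b : Module.Basis (Fin 4) K (Fin 4 → K), b 2 = v ∧ b 3 = w := by
  obtain ⟨x, hx⟩ := exists_linearIndependent_cons_of_lt_finrank h (by simp)
  obtain ⟨y, hy⟩ := exists_linearIndependent_cons_of_lt_finrank hx (by simp)
  refine ⟨basisOfLinearIndependentOfCardEqFinrank hy (by simp), ?_, ?_⟩
  · rw [coe_basisOfLinearIndependentOfCardEqFinrank]; rfl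
  · rw [coe_basisOfLinearIndependentOfCardEqFinrank]; rfl

theorem exists_functional {K : Type*} [Field K] (v w : Fin 4 → K)
    (h : LinearIndependent K ![v, w]) (s t : K) :
    ∃ θ : (Fin 4 → K) →ₗ[K] K, θ v = s ∧ θ w = t := by
  obtain ⟨b, h2, h3⟩ := exists_basis v w h
  refine ⟨s • b.coord 2 + t • b.coord 3, ?_, ?_⟩
  · rw [← h2]; simp
  · rw [← h3]; simp

theorem linForm_coord_ne_zero {K : Type*} [Field K] (b : Module.Basis (Fin 4) K (Fin 4 → K))
    (j : Fin 4) : linForm (b.coord j) ≠ 0 := by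
  intro h
  have := eval_linForm (b.coord j) (b j)
  rw [h] at this
  simp at this

theorem eval_killSubst {K : Type*} [Field K] (b : Module.Basis (Fin 4) K (Fin 4 → K))
    (T : Finset (Fin 4)) (k : Fin 4) (hk : k ∉ T) (f : MvPolynomial (Fin 4) K) :
    eval (b k) (killSubst b T f) = eval (b k) f := by
  have : ((aeval (b k)).comp (killSubst b T) : MvPolynomial (Fin 4) K →ₐ[K] K)
      = aeval (b k) := by
    apply MvPolynomial.algHom_ext
    intro i
    simp only [AlgHom.comp_apply, killSubst, aeval_X, map_sum, map_mul, algHom_C]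
    rw [Finset.sum_eq_single k]
    · simp [eval_linForm]
    · intro j _ hj
      simp [eval_linForm, hj.symm]
    · simp [hk]
  have := DFunLike.congr_fun this f
  simpa [coe_aeval_eq_eval] using this

/-- A line through `v` not contained in `{F = 0}` is cut out by a regular sequence of linear
forms modulo which `F` is a non-zero-divisor. -/
theorem exists_line {K : Type*} [Field K] (v w : Fin 4 → K) (h : LinearIndependent K ![v, w]) :
    ∃ φ ψ : (Fin 4 → K) →ₗ[K] K, φ v = 0 ∧ ψ v = 0 ∧ Prime (linForm φ) ∧
      ¬ linForm φ ∣ linForm ψ ∧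
      ∀ f g : MvPolynomial (Fin 4) K, eval w f ≠ 0 →
        f * g ∈ Ideal.span {linForm φ, linForm ψ} → g ∈ Ideal.span {linForm φ, linForm ψ} := by
  obtain ⟨b, h2, h3⟩ := exists_basis v w h
  have k1 : ∀ f, linForm (b.coord 0) ∣ f ↔ killSubst b {0} f = 0 := by
    intro f
    rw [← killSubst_ker]; simp [Ideal.mem_span_singleton]
  refine ⟨b.coord 0, b.coord 1, ?_, ?_, ⟨linForm_coord_ne_zero b 0, ?_, ?_⟩, ?_, ?_⟩
  · rw [← h2]; simp
  · rw [← h2]; simp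
  · rw [isUnit_iff_dvd_one, k1]; simp
  · intro f g
    rw [k1, k1, k1, map_mul, mul_eq_zero]; exact id
  · rw [k1, killSubst_linForm, Finset.sum_eq_single 1]
    · simpa using linForm_coord_ne_zero b 1
    · intro j _ hj
      simp [hj]
    · simp
  · have hs : ({linForm (b.coord 0), linForm (b.coord 1)} : Set (MvPolynomial (Fin 4) K)) =
        Set.image (fun j => linForm (b.coord j)) (({0, 1} : Finset (Fin 4)) : Set (Fin 4)) := by
      simp [Set.image_insert_eq]
    intro f g hf
    rw [hs, killSubst_ker, killSubst_ker, map_mul, mul_eq_zero]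
    rintro (h | h)
    · exfalso
      apply hf
      rw [← h3, ← eval_killSubst b {0, 1} 3 (by decide), h, map_zero]
    · exact h

/-- The depth argument: an element of `S` multiplied into `(F, g)` by all linear forms
vanishing at `v` lies in `(F, g)`. -/
theorem depth_trick {K : Type*} [Field K] (F g u : MvPolynomial (Fin 4) K) (hF : Prime F)
    (hFd : ∀ φ : (Fin 4 → K) →ₗ[K] K, linForm φ ≠ 0 → ¬ F ∣ linForm φ)
    (hg : ¬ F ∣ g) (v w : Fin 4 → K) (h : LinearIndependent K ![v, w])
    (hw : eval w F ≠ 0)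
    (hu : ∀ φ : (Fin 4 → K) →ₗ[K] K, φ v = 0 → linForm φ * u ∈ Ideal.span {F, g}) :
    u ∈ Ideal.span {F, g} := by
  obtain ⟨φ, ψ, hφ, hψ, hp, hnd, hreg⟩ := exists_line v w h
  obtain ⟨a1, v1, e1⟩ := Ideal.mem_span_pair.mp (hu φ hφ)
  obtain ⟨a2, w1, e2⟩ := Ideal.mem_span_pair.mp (hu ψ hψ)
  set ℓ := linForm φ
  set y := linForm ψ
  have d1 : F ∣ g * (y * v1 - ℓ * w1) := ⟨ℓ * a2 - y * a1, by linear_combination y * e1 - ℓ * e2⟩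
  obtain ⟨b, hb⟩ := (hF.dvd_or_dvd d1).resolve_left hg
  have m : F * b ∈ Ideal.span {ℓ, y} :=
    Ideal.mem_span_pair.mpr ⟨-w1, v1, by linear_combination hb⟩
  obtain ⟨b1, b2, hb'⟩ := Ideal.mem_span_pair.mp (hreg F b hw m)
  have d2 : ℓ ∣ y * (v1 - F * b2) := ⟨w1 + F * b1, by linear_combination hb - F * hb'⟩
  obtain ⟨e, he⟩ := (hp.dvd_or_dvd d2).resolve_left hnd
  have d3 : F ∣ ℓ * (u - g * e) := ⟨a1 + g * b2, by linear_combination -e1 + g * he⟩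
  obtain ⟨c, hc⟩ := (hF.dvd_or_dvd d3).resolve_left (hFd φ hp.ne_zero)
  exact Ideal.mem_span_pair.mpr ⟨c, e, by linear_combination -hc⟩

/-! ### Primes containing the Jacobian ideal -/

theorem prime_contains {K ι : Type*} [Field K] [IsAlgClosed K] [Fintype ι] [Nonempty ι]
    (F : MvPolynomial (Fin 4) K) (v : ι → Fin 4 → K)
    (hcov : ∀ w : Fin 4 → K, w ≠ 0 → eval w F = 0 → (∀ i, eval w (pderiv i F) = 0) →
      ∃ k, ∃ t : K, w = t • v k)
    (p : Ideal (MvPolynomial (Fin 4) K)) (hp : p.IsPrime) (hF : F ∈ p)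
    (hd : ∀ i, pderiv i F ∈ p) :
    ∃ k, ∀ φ : (Fin 4 → K) →ₗ[K] K, φ (v k) = 0 → linForm φ ∈ p := by
  by_contra! hcon
  choose φ hφ hφp using hcon
  have hprod : ∏ k, linForm (φ k) ∈ vanishingIdeal K (zeroLocus K p) := by
    rw [mem_vanishingIdeal_iff]
    intro w hw
    rw [mem_zeroLocus_iff] at hw
    have hex : ∃ k, φ k w = 0 := by
      by_cases h0 : w = 0
      · exact ⟨Classical.arbitrary ι, by simp [h0]⟩
      · obtain ⟨k, t, ht⟩ := hcov w h0 (by simpa using hw F hF)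
          (fun i => by simpa using hw _ (hd i))
        exact ⟨k, by rw [ht, map_smul, hφ, smul_zero]⟩
    obtain ⟨k, hk⟩ := hex
    rw [map_prod]
    refine Finset.prod_eq_zero (Finset.mem_univ k) ?_
    rw [← hk, ← eval_linForm]
    simp
  rw [vanishingIdeal_zeroLocus_eq_radical, hp.radical, hp.prod_mem_iff] at hprod
  obtain ⟨k, _, hk⟩ := hprod
  exact hφp k hk

theorem exists_regular_third {K ι : Type*} [Field K] [IsAlgClosed K] [Fintype ι] [Nonempty ι]
    (F g : MvPolynomial (Fin 4) K) (hF : Prime F)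
    (hFd : ∀ φ : (Fin 4 → K) →ₗ[K] K, linForm φ ≠ 0 → ¬ F ∣ linForm φ)
    (hg : ¬ F ∣ g) (v : ι → Fin 4 → K)
    (hv0 : ∀ k, v k ≠ 0) (hvF : ∀ k, ∀ t : K, eval (t • v k) F = 0)
    (hcov : ∀ w : Fin 4 → K, w ≠ 0 → eval w F = 0 → (∀ i, eval w (pderiv i F) = 0) →
      ∃ k, ∃ t : K, w = t • v k) :
    ∃ c : Fin 4 → K, ∀ q, (∑ i, c i • pderiv i F) * q ∈ Ideal.span {F, g} →
      q ∈ Ideal.span {F, g} := by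
  classical
  set I : Ideal (MvPolynomial (Fin 4) K) := Ideal.span {F, g} with hI
  obtain ⟨w, hw⟩ : ∃ w, eval w F ≠ 0 := by
    by_contra! hcon
    exact hF.ne_zero (MvPolynomial.funext fun x => by simpa using hcon x)
  have hli : ∀ k, LinearIndependent K ![v k, w] := by
    intro k
    rw [LinearIndependent.pair_iff' (hv0 k)]
    rintro t rfl
    exact hw (hvF k t)
  have hnot : ∀ p ∈ associatedPrimes (MvPolynomial (Fin 4) K) ((MvPolynomial (Fin 4) K) ⧸ I), ∃ i, pderiv i F ∉ p := by
    intro p hpa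
    rw [AssociatedPrimes.mem_iff, isAssociatedPrime_iff] at hpa
    obtain ⟨hp, x, hx⟩ := hpa
    obtain ⟨u, rfl⟩ := Ideal.Quotient.mk_surjective x
    have hmem : ∀ r, r ∈ p ↔ r * u ∈ I := by
      intro r
      rw [hx, Submodule.mem_colon_singleton, Submodule.mem_bot, ← Ideal.Quotient.eq_zero_iff_mem,
        map_mul]
      rfl
    by_contra! hcon
    have hFp : F ∈ p := (hmem F).2 (Ideal.mul_mem_right _ _ (Ideal.subset_span (by simp)))
    obtain ⟨k, hk⟩ := prime_contains F v hcov p hp hFp hcon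
    have hu := depth_trick F g u hF hFd hg (v k) w (hli k) hw
      (fun φ hφ => (hmem _).1 (hk φ hφ))
    apply hp.ne_top
    rw [Ideal.eq_top_iff_one, hmem, one_mul]
    exact hu
  have hfin : (associatedPrimes (MvPolynomial (Fin 4) K) ((MvPolynomial (Fin 4) K) ⧸ I)).Finite := associatedPrimes.finite (MvPolynomial (Fin 4) K) ((MvPolynomial (Fin 4) K) ⧸ I)
  let Λ : (Fin 4 → K) →ₗ[K] (MvPolynomial (Fin 4) K) := Fintype.linearCombination K (fun i => pderiv i F)
  let W : Ideal (MvPolynomial (Fin 4) K) → Submodule K (Fin 4 → K) := fun p => (p.restrictScalars K).comap Λ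
  have hne : (⋃ q ∈ hfin.toFinset.image W, (q : Set (Fin 4 → K))) ≠ Set.univ := by
    have : Infinite K := IsAlgClosed.instInfinite
    apply Subspace.biUnion_ne_univ_of_top_notMem
    intro htop
    obtain ⟨p, hp, hpt⟩ := Finset.mem_image.mp htop
    obtain ⟨i, hi⟩ := hnot p (by simpa using hp)
    apply hi
    have : Pi.single i (1 : K) ∈ W p := hpt ▸ Submodule.mem_top
    simpa [W, Λ, Fintype.linearCombination_apply, Pi.single_apply] using this
  obtain ⟨c, hc⟩ := (Set.ne_univ_iff_exists_notMem _).mp hne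
  refine ⟨c, fun q hq => ?_⟩
  by_contra hqI
  apply hc
  have hz : (∑ i, c i • pderiv i F) ∈ {r : (MvPolynomial (Fin 4) K) | ∃ x : (MvPolynomial (Fin 4) K) ⧸ I, x ≠ 0 ∧ r • x = 0} := by
    refine ⟨Ideal.Quotient.mk I q, ?_, ?_⟩
    · rwa [Ne, Ideal.Quotient.eq_zero_iff_mem]
    · rw [← Ideal.Quotient.eq_zero_iff_mem, map_mul] at hq
      exact hq
  rw [← biUnion_associatedPrimes_eq_zero_divisors] at hz
  obtain ⟨p, hp, hzp⟩ := Set.mem_iUnion₂.mp hz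
  refine Set.mem_iUnion₂.mpr ⟨W p, Finset.mem_image_of_mem _ (by simpa using hp), ?_⟩
  simpa [W, Λ, Fintype.linearCombination_apply] using hzp

/-! ### Hilbert function -/

/-- Graded pieces of an ideal. -/
def grPiece {K : Type*} [Field K] (I : Ideal (MvPolynomial (Fin 4) K)) (n : ℕ) :
    Submodule K (MvPolynomial (Fin 4) K) :=
  I.restrictScalars K ⊓ homogeneousSubmodule (Fin 4) K n

theorem finrank_hom {K : Type*} [Field K] (n : ℕ) :
    Module.finrank K (homogeneousSubmodule (Fin 4) K n) = (n + 3).choose 3 := by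
  rw [homogeneousSubmodule_eq_finsupp_supported]
  have hs : {d : Fin 4 →₀ ℕ | d.degree = n} =
      ((Finset.univ : Finset (Fin 4)).finsuppAntidiag n : Set (Fin 4 →₀ ℕ)) := by
    ext d
    simp [Finsupp.degree_eq_sum]
  rw [hs]
  rw [(AddMonoidAlgebra.supportedEquivFinsupp (R := K) (S := K)
    ((Finset.univ : Finset (Fin 4)).finsuppAntidiag n : Set (Fin 4 →₀ ℕ))).finrank_eq]
  rw [Module.finrank_finsupp_self]
  simp only [Finset.coe_sort_coe, Fintype.card_coe]
  rw [Finset.card_finsuppAntidiag_nat_eq_choose]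
  simp only [Finset.card_univ, Fintype.card_fin]
  rw [show 4 + n - 1 = n + 3 by omega]
  exact Nat.choose_symm_add

instance finite_hom {K : Type*} [Field K] (n : ℕ) :
    Module.Finite K (homogeneousSubmodule (Fin 4) K n) :=
  Module.Finite.iff_fg.mpr (homogeneousSubmodule_fg _ _ n)

instance finite_gr {K : Type*} [Field K] (I : Ideal (MvPolynomial (Fin 4) K)) (n : ℕ) :
    Module.Finite K (grPiece I n) :=
  Submodule.finiteDimensional_of_le (S₂ := homogeneousSubmodule (Fin 4) K n) inf_le_right

theorem homComp_mul {K : Type*} [Field K] {f b : MvPolynomial (Fin 4) K} {d : ℕ}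
    (hf : f.IsHomogeneous d) (n : ℕ) :
    homogeneousComponent (n + d) (f * b) = f * homogeneousComponent n b := by
  conv_lhs => rw [← sum_homogeneousComponent b]
  rw [Finset.mul_sum, map_sum]
  have : ∀ i, homogeneousComponent (n + d) (f * homogeneousComponent i b)
      = if i = n then f * homogeneousComponent n b else 0 := by
    intro i
    rw [homogeneousComponent_of_mem (n := d + i)
      (hf.mul (homogeneousComponent_isHomogeneous i b))]
    by_cases h : i = n
    · subst h; simp [add_comm]
    · rw [if_neg (by omega), if_neg h]
  simp_rw [this]
  rw [Finset.sum_ite_eq']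
  split_ifs with h
  · rfl
  · rw [homogeneousComponent_eq_zero, mul_zero]
    simpa [Nat.lt_succ_iff] using h

/-- A homogeneous ideal, in elementary terms. -/
def IsHomIdeal {K : Type*} [Field K] (I : Ideal (MvPolynomial (Fin 4) K)) : Prop :=
  ∀ p ∈ I, ∀ n, homogeneousComponent n p ∈ I

theorem homComp_mul_mem {K : Type*} [Field K] {f b : MvPolynomial (Fin 4) K} {d : ℕ}
    (hf : f.IsHomogeneous d) (n : ℕ) :
    ∃ c, homogeneousComponent n (f * b) = f * c := by
  rcases le_or_gt d n with h | h
  · obtain ⟨m, rfl⟩ := Nat.exists_eq_add_of_le' h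
    exact ⟨_, homComp_mul hf m⟩
  · refine ⟨0, ?_⟩
    conv_lhs => rw [← sum_homogeneousComponent b]
    rw [Finset.mul_sum, map_sum, mul_zero]
    refine Finset.sum_eq_zero fun i _ => ?_
    rw [homogeneousComponent_of_mem (n := d + i)
      (hf.mul (homogeneousComponent_isHomogeneous i b)), if_neg (by omega)]

theorem IsHomIdeal.sup {K : Type*} [Field K] {I : Ideal (MvPolynomial (Fin 4) K)}
    (hI : IsHomIdeal I) {f : MvPolynomial (Fin 4) K} {d : ℕ} (hf : f.IsHomogeneous d) :
    IsHomIdeal (Ideal.span {f} ⊔ I) := by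
  intro p hp n
  obtain ⟨a, i, hi, rfl⟩ := Ideal.mem_span_singleton_sup.mp hp
  rw [map_add]
  refine Ideal.add_mem _ ?_ (Ideal.mem_sup_right (hI i hi n))
  obtain ⟨c, hc⟩ := homComp_mul_mem (b := a) hf n
  rw [mul_comm, hc]
  exact Ideal.mem_sup_left (Ideal.mul_mem_right _ _ (Ideal.mem_span_singleton_self f))

theorem hilbert_step {K : Type*} [Field K] (I : Ideal (MvPolynomial (Fin 4) K))
    (hI : IsHomIdeal I) (f : MvPolynomial (Fin 4) K) (d : ℕ) (hf : f.IsHomogeneous d)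
    (hreg : ∀ q, f * q ∈ I → q ∈ I) (n : ℕ) :
    Module.finrank K (grPiece (Ideal.span {f} ⊔ I) (n + d)) + Module.finrank K (grPiece I n)
      = Module.finrank K (grPiece I (n + d)) + (n + 3).choose 3 := by
  have hmulf : ∀ q ∈ homogeneousSubmodule (Fin 4) K n,
      f * q ∈ homogeneousSubmodule (Fin 4) K (n + d) := by
    intro q hq
    rw [mem_homogeneousSubmodule] at hq ⊢
    rw [add_comm n d]
    exact hf.mul hq
  let A : Submodule K (MvPolynomial (Fin 4) K) :=
    (homogeneousSubmodule (Fin 4) K n).map (LinearMap.mulLeft K f)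
  by_cases hf0 : f = 0
  · subst hf0
    have hItop : I = ⊤ := by
      rw [Ideal.eq_top_iff_one]; exact hreg 1 (by simp)
    subst hItop
    have h1 : ∀ m, grPiece (⊤ : Ideal (MvPolynomial (Fin 4) K)) m
        = homogeneousSubmodule (Fin 4) K m := by
      intro m; simp [grPiece]
    rw [sup_top_eq, h1, h1, finrank_hom, finrank_hom]
  have hinj : Function.Injective (LinearMap.mulLeft K f) := by
    intro a b hab
    exact mul_left_cancel₀ hf0 hab
  have hA : Module.finrank K A = (n + 3).choose 3 := by
    rw [← finrank_hom (K := K) n]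
    exact (Submodule.equivMapOfInjective _ hinj _).finrank_eq.symm
  have : Module.Finite K A := Module.Finite.map _ _
  have hsup : grPiece (Ideal.span {f} ⊔ I) (n + d) = grPiece I (n + d) ⊔ A := by
    apply le_antisymm
    · rintro p ⟨hp, hph⟩
      obtain ⟨a, i, hi, rfl⟩ := Ideal.mem_span_singleton_sup.mp hp
      rw [← homogeneousComponent_eq_self (mem_homogeneousSubmodule _ _ |>.1 hph), map_add,
        mul_comm a f, homComp_mul hf, add_comm (f * _)]
      refine Submodule.add_mem_sup ⟨hI i hi _, homogeneousComponent_mem _ _⟩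
        ⟨_, homogeneousComponent_mem _ _, rfl⟩
    · refine sup_le ?_ ?_
      · exact inf_le_inf_right _ (fun x hx => Ideal.mem_sup_right hx)
      · rintro _ ⟨q, hq, rfl⟩
        exact ⟨Ideal.mem_sup_left (Ideal.mul_mem_right _ _ (Ideal.mem_span_singleton_self f)),
          hmulf q hq⟩
  have hinf : grPiece I (n + d) ⊓ A = (grPiece I n).map (LinearMap.mulLeft K f) := by
    apply le_antisymm
    · rintro _ ⟨⟨h1, _⟩, ⟨q, hq, rfl⟩⟩
      exact ⟨q, ⟨hreg q h1, hq⟩, rfl⟩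
    · rintro _ ⟨q, ⟨hqI, hq⟩, rfl⟩
      exact ⟨⟨Ideal.mul_mem_left _ _ hqI, hmulf q hq⟩, ⟨q, hq, rfl⟩⟩
  have h := Submodule.finrank_sup_add_finrank_inf_eq (grPiece I (n + d)) A
  rw [← hsup, hinf, hA,
    ← (Submodule.equivMapOfInjective _ hinj (grPiece I n)).finrank_eq] at h
  exact h

theorem hilbert_36 {K : Type*} [Field K] (F g h : MvPolynomial (Fin 4) K)
    (hF : F.IsHomogeneous 4) (hg : g.IsHomogeneous 3) (hh : h.IsHomogeneous 3)
    (hF0 : F ≠ 0) (hgreg : ∀ q, g * q ∈ Ideal.span {F} → q ∈ Ideal.span {F})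
    (hhreg : ∀ q, h * q ∈ Ideal.span {F, g} → q ∈ Ideal.span {F, g}) (m : ℕ) :
    Module.finrank K (grPiece (Ideal.span {h} ⊔ Ideal.span {F, g}) (m + 10)) + 36
      = (m + 13).choose 3 := by
  have e0 : ∀ n, Module.finrank K (grPiece (⊥ : Ideal (MvPolynomial (Fin 4) K)) n) = 0 := by
    intro n
    have : grPiece (⊥ : Ideal (MvPolynomial (Fin 4) K)) n = ⊥ := by
      rw [eq_bot_iff]; rintro x ⟨hx, _⟩; exact hx
    rw [this]; simp
  have hb : IsHomIdeal (⊥ : Ideal (MvPolynomial (Fin 4) K)) := by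
    intro p hp n
    rw [Ideal.mem_bot] at hp ⊢; simp [hp]
  have hI1 : Ideal.span {F} ⊔ (⊥ : Ideal (MvPolynomial (Fin 4) K)) = Ideal.span {F} := sup_bot_eq _
  have hI2 : Ideal.span {g} ⊔ Ideal.span {F} = Ideal.span {F, g} := by
    rw [sup_comm, ← Ideal.span_union]; rfl
  have hH1 : IsHomIdeal (Ideal.span {F}) := hI1 ▸ hb.sup hF
  have hH2 : IsHomIdeal (Ideal.span {F, g}) := hI2 ▸ hH1.sup hg
  have s1 := hilbert_step ⊥ hb F 4 hF (fun q hq => by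
    rw [Ideal.mem_bot] at hq ⊢; exact (mul_eq_zero.mp hq).resolve_left hF0)
  have s2 := hilbert_step _ hH1 g 3 hg hgreg
  have s3 := hilbert_step _ hH2 h 3 hh hhreg
  rw [hI1] at s1
  rw [hI2] at s2
  simp only [e0] at s1
  have a1 := s1 m
  have a2 := s1 (m + 3)
  have a3 := s1 (m + 6)
  have b1 := s2 (m + 7)
  have b2 := s2 (m + 4)
  have c1 := s3 (m + 7)
  simp only [add_assoc] at a1 a2 a3 b1 b2 c1
  norm_num at a1 a2 a3 b1 b2 c1
  have ch : ∀ k : ℕ, ((k + 3).choose 3) * 6 = (k + 1) * (k + 2) * (k + 3) := by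
    intro k
    induction k with
    | zero => rfl
    | succ k ih =>
      rw [show k + 1 + 3 = (k + 3) + 1 by ring, Nat.choose_succ_succ' (k + 3) 2, add_mul, ih]
      have h2 : (k + 3).choose 2 * 2 = (k + 3) * (k + 2) := by
        rw [Nat.choose_two_right, Nat.div_mul_cancel (Nat.even_mul_pred_self _).two_dvd]; rfl
      linear_combination 3 * h2
  have c0 := ch m
  have c3 := ch (m + 3)
  have c4 := ch (m + 4)
  have c6 := ch (m + 6)
  have c7 := ch (m + 7)
  have c10 := ch (m + 10)
  simp only [add_assoc] at c0 c3 c4 c6 c7 c10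
  norm_num at c0 c3 c4 c6 c7 c10
  zify at *
  ring_nf at *
  linarith

/-! ### Lower bound: values and tangential derivatives at the singular points -/

/-- Directional derivative at `u` in the direction `w`. -/
def dirDeriv {K : Type*} [Field K] (u w : Fin 4 → K) : MvPolynomial (Fin 4) K →ₗ[K] K :=
  ∑ i, w i • ((aeval u).toLinearMap ∘ₗ (pderiv i).toLinearMap)

theorem dirDeriv_apply {K : Type*} [Field K] (u w : Fin 4 → K) (f : MvPolynomial (Fin 4) K) :
    dirDeriv u w f = ∑ i, w i * eval u (pderiv i f) := by
  simp [dirDeriv]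

theorem dirDeriv_mul {K : Type*} [Field K] (u w : Fin 4 → K) (f g : MvPolynomial (Fin 4) K) :
    dirDeriv u w (f * g) = eval u f * dirDeriv u w g + eval u g * dirDeriv u w f := by
  simp only [dirDeriv_apply, Finset.mul_sum, ← Finset.sum_add_distrib]
  refine Finset.sum_congr rfl fun i _ => ?_
  rw [Derivation.leibniz]
  simp only [smul_eq_mul, map_add, map_mul]
  ring

theorem dirDeriv_linForm {K : Type*} [Field K] (u w : Fin 4 → K) (φ : (Fin 4 → K) →ₗ[K] K) :
    dirDeriv u w (linForm φ) = φ w := by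
  rw [← eval_linForm φ w, dirDeriv_apply]
  simp only [linForm_pderiv, eval_C]
  simp [linForm, mul_comm]

theorem exists_interp {K ι : Type*} [Field K] [Fintype ι] [DecidableEq ι]
    (v w : ι → Fin 4 → K)
    (hw : ∀ k, LinearIndependent K ![v k, w k])
    (hv : ∀ j k, j ≠ k → LinearIndependent K ![v j, v k]) (k : ι) (s t : K) :
    ∃ f : MvPolynomial (Fin 4) K, f.IsHomogeneous (2 * Fintype.card ι + 10) ∧
      eval (v k) f = s ∧ dirDeriv (v k) (w k) f = t ∧
      ∀ j, j ≠ k → eval (v j) f = 0 ∧ dirDeriv (v j) (w j) f = 0 := by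
  have hsep : ∀ j, j ≠ k → ∃ φ : (Fin 4 → K) →ₗ[K] K, φ (v j) = 0 ∧ φ (v k) = 1 :=
    fun j hj => exists_functional _ _ (hv j k hj) 0 1
  obtain ⟨ψ, hψ, -⟩ := exists_functional _ _ (hw k) 1 0
  have hsep' : ∀ j, ∃ φ : (Fin 4 → K) →ₗ[K] K, (j ≠ k → φ (v j) = 0) ∧ φ (v k) = 1 := by
    intro j
    by_cases hj : j = k
    · exact ⟨ψ, fun h => absurd hj h, hψ⟩
    · obtain ⟨φ, h1, h2⟩ := hsep j hj
      exact ⟨φ, fun _ => h1, h2⟩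
  choose φ hφ0 hφ1 using hsep'
  set A : MvPolynomial (Fin 4) K := (∏ j, linForm (φ j)) ^ 2 * linForm ψ ^ 9 with hA
  have hAk : eval (v k) A = 1 := by
    simp [hA, map_prod, eval_linForm, hφ1, hψ]
  have hAhom : A.IsHomogeneous (2 * Fintype.card ι + 9) := by
    have h1 : (∏ j, linForm (φ j)).IsHomogeneous (∑ j : ι, 1) :=
      IsHomogeneous.prod _ _ _ fun j _ => linForm_hom _
    have h2 := (h1.pow 2).mul ((linForm_hom ψ).pow 9)
    convert h2 using 1
    simp; ring
  obtain ⟨θ, hθ1, hθ2⟩ := exists_functional _ _ (hw k) s (t - s * dirDeriv (v k) (w k) A)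
  refine ⟨A * linForm θ, ?_, ?_, ?_, ?_⟩
  · exact hAhom.mul (linForm_hom θ)
  · simp [hAk, eval_linForm, hθ1]
  · rw [dirDeriv_mul, dirDeriv_linForm, hAk, eval_linForm, hθ1, hθ2]; ring
  · intro j hj
    have hP : eval (v j) (∏ j, linForm (φ j)) = 0 := by
      rw [map_prod]
      exact Finset.prod_eq_zero (Finset.mem_univ j) (by rw [eval_linForm, hφ0 j hj])
    have hAj : eval (v j) A = 0 := by simp only [hA, map_mul, map_pow, hP]; ring
    have hdA : dirDeriv (v j) (w j) A = 0 := by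
      simp only [hA, pow_two, mul_assoc]
      rw [dirDeriv_mul, map_mul (eval (v j)), hP]; ring
    refine ⟨by rw [map_mul, hAj, zero_mul], ?_⟩
    rw [dirDeriv_mul, hAj, hdA]; ring

/-- Evaluation of values and derivatives at all points. -/
def evMap {K ι : Type*} [Field K] (v w : ι → Fin 4 → K) :
    MvPolynomial (Fin 4) K →ₗ[K] ((ι → K) × (ι → K)) :=
  LinearMap.prod (LinearMap.pi fun k => (aeval (v k)).toLinearMap)
    (LinearMap.pi fun k => dirDeriv (v k) (w k))

theorem evMap_fst {K ι : Type*} [Field K] (v w : ι → Fin 4 → K) (f : MvPolynomial (Fin 4) K)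
    (k : ι) : (evMap v w f).1 k = eval (v k) f := by
  simp [evMap]

theorem evMap_snd {K ι : Type*} [Field K] (v w : ι → Fin 4 → K) (f : MvPolynomial (Fin 4) K)
    (k : ι) : (evMap v w f).2 k = dirDeriv (v k) (w k) f := by
  simp [evMap]

theorem count_bound {K ι : Type*} [Field K] [Fintype ι]
    (v w : ι → Fin 4 → K)
    (hw : ∀ k, LinearIndependent K ![v k, w k])
    (hv : ∀ j k, j ≠ k → LinearIndependent K ![v j, v k])
    (I : Ideal (MvPolynomial (Fin 4) K))
    (hI : ∀ f ∈ I, ∀ k, eval (v k) f = 0 ∧ dirDeriv (v k) (w k) f = 0) :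
    Module.finrank K (grPiece I (2 * Fintype.card ι + 10)) + 2 * Fintype.card ι
      ≤ (2 * Fintype.card ι + 13).choose 3 := by
  classical
  set n := 2 * Fintype.card ι + 10 with hn
  let V := homogeneousSubmodule (Fin 4) K n
  let E : V →ₗ[K] ((ι → K) × (ι → K)) := (evMap v w).domRestrict V
  have hsurj : Function.Surjective E := by
    rintro ⟨s, t⟩
    choose f hf1 hf2 hf3 hf4 using fun k => exists_interp v w hw hv k (s k) (t k)
    refine ⟨⟨∑ k, f k, ?_⟩, ?_⟩
    · exact IsHomogeneous.sum _ _ _ fun k _ => hf1 k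
    · have h1 : E ⟨∑ k, f k, IsHomogeneous.sum _ _ _ fun k _ => hf1 k⟩
          = evMap v w (∑ k, f k) := rfl
      refine h1.trans (Prod.ext ?_ ?_)
      · ext j
        rw [evMap_fst, map_sum, Finset.sum_eq_single j, hf2]
        · intro k _ hk; exact (hf4 k j hk.symm).1
        · simp
      · ext j
        rw [evMap_snd, map_sum, Finset.sum_eq_single j, hf3]
        · intro k _ hk; exact (hf4 k j hk.symm).2
        · simp
  have hrn := LinearMap.finrank_range_add_finrank_ker E
  rw [LinearMap.range_eq_top.mpr hsurj, finrank_top, Module.finrank_prod,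
    Module.finrank_fintype_fun_eq_card, finrank_hom,
    show n + 3 = 2 * Fintype.card ι + 13 by omega] at hrn
  have hle : Module.finrank K (grPiece I n) ≤ Module.finrank K (LinearMap.ker E) := by
    let ι' : grPiece I n →ₗ[K] V := Submodule.inclusion inf_le_right
    have hk : ∀ x, ι' x ∈ LinearMap.ker E := by
      intro x
      rw [LinearMap.mem_ker]
      have h1 : E (ι' x) = evMap v w x.1 := rfl
      rw [h1]
      refine Prod.ext ?_ ?_
      · ext j; rw [evMap_fst]; exact (hI _ x.2.1 j).1
      · ext j; rw [evMap_snd]; exact (hI _ x.2.1 j).2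
    refine LinearMap.finrank_le_finrank_of_injective (f := ι'.codRestrict _ hk) ?_
    intro a b hab
    have := congrArg (fun z => (z.1.1 : MvPolynomial (Fin 4) K)) hab
    exact Subtype.ext this
  omega

theorem exists_tangent {K : Type*} [Field K] (u : Fin 4 → K) (hu : u ≠ 0)
    (g h : MvPolynomial (Fin 4) K) :
    ∃ w, LinearIndependent K ![u, w] ∧ dirDeriv u w g = 0 ∧ dirDeriv u w h = 0 := by
  let L : (Fin 4 → K) →ₗ[K] (Fin 2 → K) := LinearMap.pi ![
    ∑ i, (eval u (pderiv i g)) • LinearMap.proj i, ∑ i, (eval u (pderiv i h)) • LinearMap.proj i]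
  have hrn := LinearMap.finrank_range_add_finrank_ker L
  have h1 : Module.finrank K (LinearMap.range L) ≤ 2 := by
    simpa using Submodule.finrank_le (LinearMap.range L)
  have h2 : ¬ LinearMap.ker L ≤ Submodule.span K {u} := by
    intro hle
    have := Submodule.finrank_mono hle
    rw [finrank_span_singleton hu] at this
    simp at hrn
    omega
  obtain ⟨w, hwk, hws⟩ := SetLike.not_le_iff_exists.mp h2
  refine ⟨w, ?_, ?_, ?_⟩
  · rw [LinearIndependent.pair_iff' hu]
    intro a ha
    exact hws (Submodule.mem_span_singleton.mpr ⟨a, ha⟩)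
  · have := congrFun (LinearMap.mem_ker.mp hwk) 0
    rw [dirDeriv_apply]
    simpa [L, mul_comm] using this
  · have := congrFun (LinearMap.mem_ker.mp hwk) 1
    rw [dirDeriv_apply]
    simpa [L, mul_comm] using this

theorem eval_smul_hom_s14 {K : Type*} [Field K] {f : MvPolynomial (Fin 4) K} {n : ℕ}
    (hf : f.IsHomogeneous n) (t : K) (u : Fin 4 → K) :
    eval (t • u) f = t ^ n * eval u f := by
  rw [eval_eq, eval_eq, Finset.mul_sum]
  refine Finset.sum_congr rfl fun d hd => ?_
  have hdn := hf.degree_eq_sum_deg_support hd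
  rw [hdn]
  simp only [Pi.smul_apply, smul_eq_mul, mul_pow, Finset.prod_mul_distrib, Finset.prod_pow_eq_pow_sum]
  ring

/-- Main theorem: a normal (irreducible, finitely many singular points) quartic surface
`X = {F = 0} ⊆ ℙ³_K` over an algebraically closed field of characteristic 2 has at most 20
singular points. -/
theorem quartic_char_two_singular_count_le_twenty
    {K : Type*} [Field K] [IsAlgClosed K] [CharP K 2]
    (F : MvPolynomial (Fin 4) K) (hFirr : Irreducible F) (hFhom : F.IsHomogeneous 4)
    (hfin : (singLocus F).Finite) :
    (singLocus F).ncard ≤ 20 := by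
  classical
  rcases (singLocus F).eq_empty_or_nonempty with hemp | hne
  · simp [hemp]
  have hFin : Fintype (singLocus F) := hfin.fintype
  have hNe : Nonempty (singLocus F) := hne.to_subtype
  have hcard : (singLocus F).ncard = Fintype.card (singLocus F) := by
    rw [← Nat.card_coe_set_eq, Nat.card_eq_fintype_card]
  have hF : Prime F := hFirr.prime
  have hdhom : ∀ i, (pderiv i F).IsHomogeneous 3 := fun i => hFhom.pderiv
  have hdeg : ∀ f : MvPolynomial (Fin 4) K, ∀ n, n < 4 → f.IsHomogeneous n → f ≠ 0 → ¬ F ∣ f := by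
    rintro f n hn hf hf0 ⟨q, rfl⟩
    have h1 := hf.totalDegree hf0
    rw [totalDegree_mul_of_isDomain hF.ne_zero (right_ne_zero_of_mul hf0),
      hFhom.totalDegree hF.ne_zero] at h1
    omega
  have hFd : ∀ φ : (Fin 4 → K) →ₗ[K] K, linForm φ ≠ 0 → ¬ F ∣ linForm φ :=
    fun φ h => hdeg _ 1 (by norm_num) (linForm_hom φ) h
  let v : singLocus F → Fin 4 → K := fun k => k.1.rep
  have hv0 : ∀ k, v k ≠ 0 := fun k => k.1.rep_nonzero
  have hvs : ∀ k, eval (v k) F = 0 ∧ ∀ i, eval (v k) (pderiv i F) = 0 :=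
    fun k => k.2 _ (hv0 k) (Projectivization.mk_rep _)
  have hvF : ∀ k, ∀ t : K, eval (t • v k) F = 0 := by
    intro k t; rw [eval_smul_hom_s14 hFhom, (hvs k).1, mul_zero]
  have hcov : ∀ w : Fin 4 → K, w ≠ 0 → eval w F = 0 → (∀ i, eval w (pderiv i F) = 0) →
      ∃ k, ∃ t : K, w = t • v k := by
    intro w hw h1 h2
    refine ⟨⟨Projectivization.mk K w hw, ?_⟩, ?_⟩
    · intro u hu huw
      obtain ⟨t, ht⟩ := (Projectivization.mk_eq_mk_iff' K u w hu hw).mp huw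
      rw [← ht]
      exact ⟨by rw [eval_smul_hom_s14 hFhom, h1, mul_zero],
        fun i => by rw [eval_smul_hom_s14 (hdhom i), h2, mul_zero]⟩
    · obtain ⟨t, ht⟩ := (Projectivization.mk_eq_mk_iff' K w _ hw
        (Projectivization.mk K w hw).rep_nonzero).mp (Projectivization.mk_rep _).symm
      exact ⟨t, ht.symm⟩
  have hvli : ∀ j k, j ≠ k → LinearIndependent K ![v j, v k] := by
    intro j k hjk
    rw [LinearIndependent.pair_iff' (hv0 j)]
    intro t ht
    apply hjk
    apply Subtype.ext
    rw [← Projectivization.mk_rep j.1, ← Projectivization.mk_rep k.1]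
    exact ((Projectivization.mk_eq_mk_iff' K _ _ (hv0 k) (hv0 j)).mpr ⟨t, ht⟩).symm
  obtain ⟨i0, hi0⟩ : ∃ i, pderiv i F ≠ 0 := by
    by_contra! hcon
    have hpr : (Ideal.span {F}).IsPrime := (Ideal.span_singleton_prime hF.ne_zero).mpr hF
    obtain ⟨k, hk⟩ := prime_contains F v hcov _ hpr (Ideal.mem_span_singleton_self F)
      (fun i => by rw [hcon i]; exact Ideal.zero_mem _)
    obtain ⟨w, hw, -⟩ := exists_tangent (v k) (hv0 k) 0 0
    obtain ⟨φ, h0, h1⟩ := exists_functional _ _ hw 0 1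
    refine hFd φ ?_ (Ideal.mem_span_singleton.mp (hk φ h0))
    intro hz
    have := eval_linForm φ w
    rw [hz, h1] at this
    simp at this
  have hg : ¬ F ∣ pderiv i0 F := hdeg _ 3 (by norm_num) (hdhom i0) hi0
  obtain ⟨c, hc⟩ := exists_regular_third F (pderiv i0 F) hF hFd hg v hv0 hvF hcov
  set g := pderiv i0 F with hgdef
  set h := ∑ i, c i • pderiv i F with hhdef
  have hhhom : h.IsHomogeneous 3 := by
    refine IsHomogeneous.sum _ _ _ fun i _ => ?_
    rw [smul_eq_C_mul]
    exact (hdhom i).C_mul _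
  have hvh : ∀ k, eval (v k) h = 0 := by
    intro k
    simp [hhdef, map_sum, smul_eval, (hvs k).2]
  have h36 := hilbert_36 F g h hFhom (hdhom i0) hhhom hF.ne_zero
    (fun q hq => by
      rw [Ideal.mem_span_singleton] at hq ⊢
      exact (hF.dvd_or_dvd hq).resolve_left hg) hc (2 * Fintype.card (singLocus F))
  choose w hw hwg hwh using fun k => exists_tangent (v k) (hv0 k) g h
  have hcb := count_bound v w hw hvli (Ideal.span {h} ⊔ Ideal.span {F, g}) (by
    intro f hf k
    obtain ⟨a, r, hr, rfl⟩ := Ideal.mem_span_singleton_sup.mp hf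
    obtain ⟨x, y, rfl⟩ := Ideal.mem_span_pair.mp hr
    have hdF : dirDeriv (v k) (w k) F = 0 := by
      rw [dirDeriv_apply]; simp [(hvs k).2]
    have hgk : eval (v k) g = 0 := (hvs k).2 i0
    refine ⟨by simp [hvh, (hvs k).1, hgk], ?_⟩
    simp only [map_add, dirDeriv_mul, hwg, hwh, hdF, hvh, hgk, (hvs k).1]
    ring)
  omega

end
end

section
/- Let K be an algebraically closed field of characteristic 2 and let a = (a₁,a₂,a₃,a₄) ∈ K⁴, a ≠ 0. Then the symmetric quartic X_a = {a₁σ₁⁴ + a₂σ₁²σ₂ + a₃σ₁σ₃ + a₄σ₄ = 0} ⊂ ℙ³_K satisfies: Sing(X_a) contains the S₄-orbit of [0:0:1:1] (which consists of 6 points), and exactly one of the following holds: |Sing(X_a)| = 6; or |Sing(X_a)| = 10 and the 4 extra singular points form either the S₄-orbit of [0:0:0:1] or the S₄-orbit of a point [1:1:1:b] with b ≠ 1; or Sing(X_a) is infinite. -/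
open MvPolynomial

noncomputable section

/-- The `S₄`-orbit of the point of `ℙ³_K` represented by `v`, for the action of `S₄` permuting
the four coordinates. -/
def s4Orbit {K : Type*} [Field K] (v : Fin 4 → K) : Set (Projectivization K (Fin 4 → K)) :=
  {q | ∃ (g : Equiv.Perm (Fin 4)) (h : v ∘ g ≠ 0), q = Projectivization.mk K (v ∘ g) h}

/-- The symmetric quartic `F_a = a₁σ₁⁴ + a₂σ₁²σ₂ + a₃σ₁σ₃ + a₄σ₄`, where `σᵢ` is the `i`-th
elementary symmetric polynomial in `x₁, x₂, x₃, x₄`. -/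
def symQuartic {K : Type*} [Field K] (a : Fin 4 → K) : MvPolynomial (Fin 4) K :=
  C (a 0) * esymm (Fin 4) K 1 ^ 4 + C (a 1) * esymm (Fin 4) K 1 ^ 2 * esymm (Fin 4) K 2
    + C (a 2) * esymm (Fin 4) K 1 * esymm (Fin 4) K 3 + C (a 3) * esymm (Fin 4) K 4

/-- value of the quartic in coordinates -/
def qF {K : Type*} [Field K] (a : Fin 4 → K) (x y z w : K) : K :=
  a 0 * (x+y+z+w)^4 + a 1 * (x+y+z+w)^2 * (x*y+x*z+x*w+y*z+y*w+z*w)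
   + a 2 * (x+y+z+w) * (x*y*z+x*y*w+x*z*w+y*z*w) + a 3 * (x*y*z*w)

/-- value in characteristic two of the partial derivative with respect to the first variable -/
def qD {K : Type*} [Field K] (a : Fin 4 → K) (x y z w : K) : K :=
  a 1 * (x+y+z+w)^2 * (y+z+w)
   + a 2 * ((x*y*z+x*y*w+x*z*w+y*z*w) + (x+y+z+w) * (y*z+y*w+z*w)) + a 3 * (y*z*w)

/-- the system of equations for a singular point -/
def qE {K : Type*} [Field K] (a : Fin 4 → K) (x y z w : K) : Prop :=
  qF a x y z w = 0 ∧ qD a x y z w = 0 ∧ qD a y x z w = 0 ∧ qD a z x y w = 0 ∧ qD a w x y z = 0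

lemma esymm_one' {K : Type*} [Field K] : esymm (Fin 4) K 1 = X 0 + X 1 + X 2 + X 3 := by
  rw [esymm_one]; simp [Fin.sum_univ_four]

lemma esymm_two' {K : Type*} [Field K] : esymm (Fin 4) K 2 =
    X 0 * X 1 + X 0 * X 2 + X 0 * X 3 + X 1 * X 2 + X 1 * X 3 + X 2 * X 3 := by
  have : Finset.powersetCard 2 (Finset.univ : Finset (Fin 4)) =
    {{0,1},{0,2},{0,3},{1,2},{1,3},{2,3}} := by decide
  rw [esymm, this]
  repeat rw [Finset.sum_insert (by decide)]
  rw [Finset.sum_singleton]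
  repeat rw [Finset.prod_pair (by decide)]
  ring

lemma esymm_three' {K : Type*} [Field K] : esymm (Fin 4) K 3 =
    X 0 * X 1 * X 2 + X 0 * X 1 * X 3 + X 0 * X 2 * X 3 + X 1 * X 2 * X 3 := by
  have : Finset.powersetCard 3 (Finset.univ : Finset (Fin 4)) =
    {{0,1,2},{0,1,3},{0,2,3},{1,2,3}} := by decide
  rw [esymm, this]
  repeat rw [Finset.sum_insert (by decide)]
  rw [Finset.sum_singleton]
  repeat rw [Finset.prod_insert (by decide)]
  repeat rw [Finset.prod_singleton]
  ring

lemma esymm_four' {K : Type*} [Field K] : esymm (Fin 4) K 4 = X 0 * X 1 * X 2 * X 3 := by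
  have : Finset.powersetCard 4 (Finset.univ : Finset (Fin 4)) = {Finset.univ} := by decide
  rw [esymm, this, Finset.sum_singleton, Fin.prod_univ_four]

lemma eval_iff {K : Type*} [Field K] [CharP K 2] (a v : Fin 4 → K) :
    (eval v (symQuartic a) = 0 ∧ ∀ i, eval v (pderiv i (symQuartic a)) = 0) ↔
      qE a (v 0) (v 1) (v 2) (v 3) := by
  have h2 : (2 : K) = 0 := CharP.cast_eq_zero K 2
  have h0 : eval v (symQuartic a) = qF a (v 0) (v 1) (v 2) (v 3) := by
    simp only [symQuartic, esymm_one', esymm_two', esymm_three', esymm_four', qF]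
    simp
  have key : ∀ i, eval v (pderiv i (symQuartic a)) = 
      ![qD a (v 0) (v 1) (v 2) (v 3), qD a (v 1) (v 0) (v 2) (v 3),
        qD a (v 2) (v 0) (v 1) (v 3), qD a (v 3) (v 0) (v 1) (v 2)] i := by
    intro i
    simp only [symQuartic, esymm_one', esymm_two', esymm_three', esymm_four', qD]
    fin_cases i <;> simp [pderiv_X] <;> grind
  rw [h0, qE]
  simp only [key, Fin.forall_fin_succ]
  simp

lemma qE_smul {K : Type*} [Field K] (a : Fin 4 → K) (c x y z w : K) (h : qE a x y z w) :
    qE a (c*x) (c*y) (c*z) (c*w) := by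
  obtain ⟨h0, h1, h2, h3, h4⟩ := h
  simp only [qE, qF, qD] at *
  refine ⟨?_, ?_, ?_, ?_, ?_⟩
  · linear_combination c^4 * h0
  · linear_combination c^3 * h1
  · linear_combination c^3 * h2
  · linear_combination c^3 * h3
  · linear_combination c^3 * h4

lemma mem_sing {K : Type*} [Field K] [CharP K 2] (a v : Fin 4 → K) (hv : v ≠ 0) :
    Projectivization.mk K v hv ∈ singLocus (symQuartic a) ↔ qE a (v 0) (v 1) (v 2) (v 3) := by
  constructor
  · intro h
    exact (eval_iff a v).1 (h v hv rfl)
  · intro h u hu e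
    rw [eval_iff]
    obtain ⟨c, rfl⟩ := (Projectivization.mk_eq_mk_iff' K u v hu hv).1 e
    exact qE_smul a c _ _ _ _ h

lemma qE_s12 {K : Type*} [Field K] {a : Fin 4 → K} {x y z w : K} (h : qE a x y z w) :
    qE a y x z w := by
  obtain ⟨h0, h1, h2, h3, h4⟩ := h
  simp only [qE, qF, qD] at *
  exact ⟨by linear_combination h0, by linear_combination h2, by linear_combination h1,
    by linear_combination h3, by linear_combination h4⟩

lemma qE_s23 {K : Type*} [Field K] {a : Fin 4 → K} {x y z w : K} (h : qE a x y z w) :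
    qE a x z y w := by
  obtain ⟨h0, h1, h2, h3, h4⟩ := h
  simp only [qE, qF, qD] at *
  exact ⟨by linear_combination h0, by linear_combination h1, by linear_combination h3,
    by linear_combination h2, by linear_combination h4⟩

lemma qE_s34 {K : Type*} [Field K] {a : Fin 4 → K} {x y z w : K} (h : qE a x y z w) :
    qE a x y w z := by
  obtain ⟨h0, h1, h2, h3, h4⟩ := h
  simp only [qE, qF, qD] at *
  exact ⟨by linear_combination h0, by linear_combination h1, by linear_combination h2,
    by linear_combination h4, by linear_combination h3⟩

/-- points with vanishing coordinate sum and vanishing first coordinate -/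
lemma zero_case {K : Type*} [Field K] [CharP K 2] {a : Fin 4 → K} (h3 : a 3 ≠ 0) {y z w : K}
    (hs : y + z + w = 0) (h : qE a 0 y z w) :
    (y = 0 ∧ z = w) ∨ (z = 0 ∧ y = w) ∨ (w = 0 ∧ y = z) := by
  have h2 : (2 : K) = 0 := CharP.cast_eq_zero K 2
  obtain ⟨-, h0, h1, -, -⟩ := h
  simp only [qD] at *
  have hw : w = y + z := by grind
  subst hw
  have e : a 3 * (y * z * (y + z)) = 0 := by grind
  have := (mul_eq_zero.1 e).resolve_left h3
  rcases mul_eq_zero.1 this with h | h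
  · rcases mul_eq_zero.1 h with h | h <;> simp [h]
  · right; right; exact ⟨h, by grind⟩

/-- two coordinates coincide -/
lemma two_eq {K : Type*} [Field K] [CharP K 2] {a : Fin 4 → K} (h3 : a 3 ≠ 0) {x y z w : K}
    (h : qE a x y z w) :
    x = y ∨ x = z ∨ x = w ∨ y = z ∨ y = w ∨ z = w := by
  have h2 : (2 : K) = 0 := CharP.cast_eq_zero K 2
  obtain ⟨h0, hx, hy, hz, hw⟩ := h
  simp only [qD] at *
  by_contra! hne
  obtain ⟨n1, n2, n3, n4, n5, n6⟩ := hne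
  have dxy : (x - y) * (a 3 * (z * w) + a 1 * (x+y+z+w)^2 + a 2 * (x+y+z+w) * (z + w)) = 0 := by
    grind
  have dxz : (x - z) * (a 3 * (y * w) + a 1 * (x+y+z+w)^2 + a 2 * (x+y+z+w) * (y + w)) = 0 := by
    grind
  have dxw : (x - w) * (a 3 * (y * z) + a 1 * (x+y+z+w)^2 + a 2 * (x+y+z+w) * (y + z)) = 0 := by
    grind
  have e1 := (mul_eq_zero.1 dxy).resolve_left (sub_ne_zero.2 n1)
  have e2 := (mul_eq_zero.1 dxz).resolve_left (sub_ne_zero.2 n2)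
  have e3 := (mul_eq_zero.1 dxw).resolve_left (sub_ne_zero.2 n3)
  have f1 : (z - y) * (a 3 * w + a 2 * (x+y+z+w)) = 0 := by linear_combination e1 - e2
  have f2 : (w - y) * (a 3 * z + a 2 * (x+y+z+w)) = 0 := by linear_combination e1 - e3
  have g1 := (mul_eq_zero.1 f1).resolve_left (sub_ne_zero.2 n4.symm)
  have g2 := (mul_eq_zero.1 f2).resolve_left (sub_ne_zero.2 n5.symm)
  have : a 3 * (w - z) = 0 := by linear_combination g1 - g2
  exact n6 (sub_eq_zero.1 ((mul_eq_zero.1 this).resolve_left h3)).symm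

lemma core {K : Type*} [Field K] [CharP K 2] {a : Fin 4 → K} (h3 : a 3 ≠ 0) {p z w : K}
    (hs : z + w ≠ 0) (h : qE a p p z w) :
    a 0 * a 3 + a 1 ^ 2 + a 1 * a 2 = 0 ∧ a 3 * p ^ 2 = a 1 * (z + w) ^ 2 ∧
      (a 2 ^ 2 = a 1 * a 3 ∨ p = z ∨ p = w) := by
  have h2 : (2 : K) = 0 := CharP.cast_eq_zero K 2
  obtain ⟨h0, hx, -, hz, hw⟩ := h
  simp only [qD, qF] at *
  have k1 : (z + w) * (a 3 * p ^ 2 - a 1 * (z + w) ^ 2) = 0 := by grind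
  have k2 := sub_eq_zero.1 ((mul_eq_zero.1 k1).resolve_left hs)
  have k3 : (z+w)^2 * (a 0 * (z+w)^2 + a 1 * p^2 + a 2 * p^2) = 0 := by grind
  have k4 := (mul_eq_zero.1 k3).resolve_left (pow_ne_zero 2 hs)
  have k5 : (z+w)^2 * (a 0 * a 3 + a 1 ^ 2 + a 1 * a 2) = 0 := by grind
  refine ⟨(mul_eq_zero.1 k5).resolve_left (pow_ne_zero 2 hs), k2, ?_⟩
  have k6 : (a 3 * p + a 2 * (z+w)) * ((p - z) * (p - w)) = 0 := by grind
  rcases mul_eq_zero.1 k6 with k | k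
  · left
    have : (z+w)^2 * (a 2 ^ 2 - a 1 * a 3) = 0 := by grind
    exact sub_eq_zero.1 ((mul_eq_zero.1 this).resolve_left (pow_ne_zero 2 hs))
  · right
    rcases mul_eq_zero.1 k with k | k
    · exact Or.inl (sub_eq_zero.1 k)
    · exact Or.inr (sub_eq_zero.1 k)

/-- indicator vector of a subset of the coordinates -/
def ind (K : Type*) [Field K] (s : Finset (Fin 4)) : Fin 4 → K := fun i => if i ∈ s then 1 else 0

/-- the vector with all coordinates `r` except for the `i`-th, which is `r + 1` -/
def upd {K : Type*} [Field K] (r : K) (i : Fin 4) : Fin 4 → K := fun j => if j = i then r + 1 else r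

lemma ind_ne {K : Type*} [Field K] {s : Finset (Fin 4)} (hs : s.card = 2) : ind K s ≠ 0 := by
  intro h
  obtain ⟨i, hi⟩ : s.Nonempty := Finset.card_pos.1 (by omega)
  have := congrFun h i
  simp [ind, hi] at this

lemma upd_ne {K : Type*} [Field K] (r : K) (i : Fin 4) : upd r i ≠ 0 := by
  intro h
  have h1 := congrFun h i
  have h2 := congrFun h (i + 1)
  have h3 : i + 1 ≠ i := by clear h h1 h2; revert i; decide
  simp [upd, h3] at h1 h2
  simp [h2] at h1

lemma card_two_cases : ∀ s : Finset (Fin 4), s.card = 2 →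
    s = {0,1} ∨ s = {0,2} ∨ s = {0,3} ∨ s = {1,2} ∨ s = {1,3} ∨ s = {2,3} := by decide

lemma zero_sum {K : Type*} [Field K] [CharP K 2] {a : Fin 4 → K} (h3 : a 3 ≠ 0) {x y z w : K}
    (hs : x + y + z + w = 0) (h : qE a x y z w) :
    (x = y ∧ z = w ∧ (x = 0 ∨ z = 0)) ∨ (x = z ∧ y = w ∧ (x = 0 ∨ y = 0)) ∨
      (x = w ∧ y = z ∧ (x = 0 ∨ y = 0)) := by
  have hF := h.1
  simp only [qF, hs] at hF
  have h4 : a 3 * (x * y * z * w) = 0 := by linear_combination hF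
  have h5 := (mul_eq_zero.1 h4).resolve_left h3
  simp only [mul_eq_zero, or_assoc] at h5
  rcases h5 with rfl | rfl | rfl | rfl
  · have := zero_case h3 (by linear_combination hs) h
    grind
  · have := zero_case h3 (by linear_combination hs) (qE_s12 h)
    grind
  · have := zero_case h3 (by linear_combination hs) (qE_s12 (qE_s23 h))
    grind
  · have := zero_case h3 (by linear_combination hs) (qE_s12 (qE_s23 (qE_s34 h)))
    grind

lemma core' {K : Type*} [Field K] [CharP K 2] {a : Fin 4 → K} (h3 : a 3 ≠ 0) {x y z w : K}
    (hs : x + y + z + w ≠ 0) (hxy : x = y) (h : qE a x y z w) :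
    a 0 * a 3 + a 1 ^ 2 + a 1 * a 2 = 0 ∧ (a 2 ^ 2 = a 1 * a 3 ∨
      ∃ p q, p + q ≠ 0 ∧ a 3 * p ^ 2 = a 1 * (p + q) ^ 2 ∧
        ((x = p ∧ y = p ∧ z = p ∧ w = q) ∨ (x = p ∧ y = p ∧ z = q ∧ w = p))) := by
  have h2 : (2 : K) = 0 := CharP.cast_eq_zero K 2
  subst hxy
  have hs' : z + w ≠ 0 := by
    intro e; apply hs; linear_combination e + x * h2
  obtain ⟨h0, h1, hD | rfl | rfl⟩ := core h3 hs' h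
  · exact ⟨h0, Or.inl hD⟩
  · exact ⟨h0, Or.inr ⟨x, w, hs', h1, by simp⟩⟩
  · exact ⟨h0, Or.inr ⟨x, z, by rwa [add_comm], by rw [add_comm x z]; exact h1, by simp⟩⟩

lemma nonzero_sum {K : Type*} [Field K] [CharP K 2] {a : Fin 4 → K} (h3 : a 3 ≠ 0) {x y z w : K}
    (hs : x + y + z + w ≠ 0) (h : qE a x y z w) :
    a 0 * a 3 + a 1 ^ 2 + a 1 * a 2 = 0 ∧ (a 2 ^ 2 = a 1 * a 3 ∨
      ∃ p q, p + q ≠ 0 ∧ a 3 * p ^ 2 = a 1 * (p + q) ^ 2 ∧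
        ((x = p ∧ y = p ∧ z = p ∧ w = q) ∨ (x = p ∧ y = p ∧ z = q ∧ w = p) ∨
         (x = p ∧ y = q ∧ z = p ∧ w = p) ∨ (x = q ∧ y = p ∧ z = p ∧ w = p))) := by
  have aux : ∀ x' y' z' w', x' + y' + z' + w' = x + y + z + w → x' = y' → qE a x' y' z' w' →
     (∀ p q, ((x' = p ∧ y' = p ∧ z' = p ∧ w' = q) ∨ (x' = p ∧ y' = p ∧ z' = q ∧ w' = p)) → 
        ((x = p ∧ y = p ∧ z = p ∧ w = q) ∨ (x = p ∧ y = p ∧ z = q ∧ w = p) ∨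
         (x = p ∧ y = q ∧ z = p ∧ w = p) ∨ (x = q ∧ y = p ∧ z = p ∧ w = p))) →
     a 0 * a 3 + a 1 ^ 2 + a 1 * a 2 = 0 ∧ (a 2 ^ 2 = a 1 * a 3 ∨
      ∃ p q, p + q ≠ 0 ∧ a 3 * p ^ 2 = a 1 * (p + q) ^ 2 ∧
        ((x = p ∧ y = p ∧ z = p ∧ w = q) ∨ (x = p ∧ y = p ∧ z = q ∧ w = p) ∨
         (x = p ∧ y = q ∧ z = p ∧ w = p) ∨ (x = q ∧ y = p ∧ z = p ∧ w = p))) := by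
    intro x' y' z' w' hsum hxy hE himp
    obtain ⟨h0, hD | ⟨p, q, hpq, h1, hc⟩⟩ := core' h3 (by rwa [hsum]) hxy hE
    · exact ⟨h0, Or.inl hD⟩
    · exact ⟨h0, Or.inr ⟨p, q, hpq, h1, himp p q hc⟩⟩
  rcases two_eq h3 h with e | e | e | e | e | e
  · exact aux x y z w (by ring) e h (by grind)
  · exact aux x z y w (by ring) e (qE_s23 h) (by grind)
  · exact aux x w y z (by ring) e (qE_s23 (qE_s34 h)) (by grind)
  · exact aux y z x w (by ring) e (qE_s23 (qE_s12 h)) (by grind)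
  · exact aux y w x z (by ring) e (qE_s23 (qE_s34 (qE_s12 h))) (by grind)
  · exact aux z w x y (by ring) e (qE_s23 (qE_s34 (qE_s12 (qE_s23 h)))) (by grind)

lemma classify {K : Type*} [Field K] [CharP K 2] {a v : Fin 4 → K} (h3 : a 3 ≠ 0) {r : K}
    (hr : a 3 * r ^ 2 = a 1) (h : qE a (v 0) (v 1) (v 2) (v 3)) :
    (∃ s : Finset (Fin 4), s.card = 2 ∧ ∃ c : K, c • ind K s = v) ∨
    (a 0 * a 3 + a 1 ^ 2 + a 1 * a 2 = 0 ∧ (a 2 ^ 2 = a 1 * a 3 ∨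
      ∃ i, ∃ c : K, c • upd r i = v)) := by
  have h2 : (2 : K) = 0 := CharP.cast_eq_zero K 2
  by_cases hs : v 0 + v 1 + v 2 + v 3 = 0
  · left
    have fin : ∀ (s : Finset (Fin 4)) (c : K), s.card = 2 →
        (∀ i, c * ind K s i = v i) → 
        (∃ s : Finset (Fin 4), s.card = 2 ∧ ∃ c : K, c • ind K s = v) := 
      fun s c hs hc => ⟨s, hs, c, funext hc⟩
    rcases zero_sum h3 hs h with ⟨e1, e2, e3 | e3⟩ | ⟨e1, e2, e3 | e3⟩ | ⟨e1, e2, e3 | e3⟩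
    · exact fin {2,3} (v 2) (by decide) (by simp [Fin.forall_fin_succ, ind]; grind)
    · exact fin {0,1} (v 0) (by decide) (by simp [Fin.forall_fin_succ, ind]; grind)
    · exact fin {1,3} (v 1) (by decide) (by simp [Fin.forall_fin_succ, ind]; grind)
    · exact fin {0,2} (v 0) (by decide) (by simp [Fin.forall_fin_succ, ind]; grind)
    · exact fin {1,2} (v 1) (by decide) (by simp [Fin.forall_fin_succ, ind]; grind)
    · exact fin {0,3} (v 0) (by decide) (by simp [Fin.forall_fin_succ, ind]; grind)
  · right
    obtain ⟨h0, hD | ⟨p, q, hpq, h1, hc⟩⟩ := nonzero_sum h3 hs h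
    · exact ⟨h0, Or.inl hD⟩
    · refine ⟨h0, Or.inr ?_⟩
      have hp : p = (p + q) * r := by
        have e : a 3 * (p - (p + q) * r) ^ 2 = 0 := by
          rw [← hr] at h1; grind
        have := (mul_eq_zero.1 e).resolve_left h3
        exact sub_eq_zero.1 (pow_eq_zero_iff (two_ne_zero) |>.1 this)
      have hq : q = (p + q) * (r + 1) := by grind
      have fin : ∀ (i : Fin 4), (∀ j, (p + q) * upd r i j = v j) →
        ∃ i, ∃ c : K, c • upd r i = v := 
        fun i hc => ⟨i, p + q, funext hc⟩
      rcases hc with ⟨e1, e2, e3, e4⟩ | ⟨e1, e2, e3, e4⟩ | ⟨e1, e2, e3, e4⟩ | ⟨e1, e2, e3, e4⟩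
      · apply fin 3
        simp [Fin.forall_fin_succ, upd, e1, e2, e3, e4, ← hp, ← hq]
      · apply fin 2
        simp [Fin.forall_fin_succ, upd, e1, e2, e3, e4, ← hp, ← hq]
      · apply fin 1
        simp [Fin.forall_fin_succ, upd, e1, e2, e3, e4, ← hp, ← hq]
      · apply fin 0
        simp [Fin.forall_fin_succ, upd, e1, e2, e3, e4, ← hp, ← hq]

lemma qE_ind {K : Type*} [Field K] [CharP K 2] (a : Fin 4 → K) {s : Finset (Fin 4)}
    (hs : s.card = 2) : qE a (ind K s 0) (ind K s 1) (ind K s 2) (ind K s 3) := by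
  have h2 : (2 : K) = 0 := CharP.cast_eq_zero K 2
  rcases card_two_cases s hs with rfl | rfl | rfl | rfl | rfl | rfl <;>
  simp [ind, qE, qF, qD] <;> grind

lemma qE_gen {K : Type*} [Field K] [CharP K 2] {a : Fin 4 → K} (h3 : a 3 ≠ 0) {r : K}
    (hr : a 3 * r ^ 2 = a 1) (hC : a 0 * a 3 + a 1 ^ 2 + a 1 * a 2 = 0) (t : K)
    (ht : a 2 = a 3 * r ∨ t = r) : qE a r r t (t + 1) := by
  have h2 : (2 : K) = 0 := CharP.cast_eq_zero K 2
  have e0 : a 3 * (a 0 + a 3 * r ^ 4 + r ^ 2 * a 2) = 0 := by rw [← hr] at hC; linear_combination hC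
  have e1 := (mul_eq_zero.1 e0).resolve_left h3
  have e2 : a 0 = a 3 * r ^ 4 + r ^ 2 * a 2 := by grind
  simp only [qE, qF, qD, ← hr, e2]
  rcases ht with ht | rfl
  · rw [ht]; refine ⟨?_, ?_, ?_, ?_, ?_⟩ <;> grind
  · refine ⟨?_, ?_, ?_, ?_, ?_⟩ <;> grind

lemma qE_upd {K : Type*} [Field K] [CharP K 2] {a : Fin 4 → K} (h3 : a 3 ≠ 0) {r : K}
    (hr : a 3 * r ^ 2 = a 1) (hC : a 0 * a 3 + a 1 ^ 2 + a 1 * a 2 = 0) (i : Fin 4) :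
    qE a (upd r i 0) (upd r i 1) (upd r i 2) (upd r i 3) := by
  have h := qE_gen h3 hr hC r (Or.inr rfl)
  fin_cases i
  · simpa [upd] using qE_s12 (qE_s23 (qE_s34 h))
  · simpa [upd] using (qE_s23 (qE_s34 h))
  · simpa [upd] using ((qE_s34 h))
  · simpa [upd] using h

lemma perm_card : ∀ g : Equiv.Perm (Fin 4),
    (Finset.univ.filter (fun i => 2 ≤ g i)).card = 2 := by decide

lemma perm_exists : ∀ s : Finset (Fin 4), s.card = 2 →
    ∃ g : Equiv.Perm (Fin 4), (Finset.univ.filter (fun i => 2 ≤ g i)) = s := by decide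

lemma comp_ind {K : Type*} [Field K] (g : Equiv.Perm (Fin 4)) :
    (![0, 0, 1, 1] : Fin 4 → K) ∘ g = ind K (Finset.univ.filter (fun i => 2 ≤ g i)) := by
  funext i
  simp only [Function.comp, ind, Finset.mem_filter, Finset.mem_univ, true_and]
  generalize g i = j
  fin_cases j <;> simp

lemma mem_orbit6 {K : Type*} [Field K] (q : Projectivization K (Fin 4 → K)) :
    q ∈ s4Orbit (![0, 0, 1, 1] : Fin 4 → K) ↔
      ∃ (s : Finset (Fin 4)) (hs : s.card = 2), q = Projectivization.mk K (ind K s) (ind_ne hs) := by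
  constructor
  · rintro ⟨g, h, rfl⟩
    refine ⟨_, perm_card g, ?_⟩
    congr 1
    exact comp_ind g
  · rintro ⟨s, hs, rfl⟩
    obtain ⟨g, hg⟩ := perm_exists s hs
    have e : (![0, 0, 1, 1] : Fin 4 → K) ∘ g = ind K s := by rw [comp_ind, hg]
    refine ⟨g, by rw [e]; exact ind_ne hs, ?_⟩
    congr 1
    exact e.symm

lemma mem_orbit4 {K : Type*} [Field K] (r : K) (q : Projectivization K (Fin 4 → K)) :
    q ∈ s4Orbit (![r, r, r, r + 1] : Fin 4 → K) ↔
      ∃ i, q = Projectivization.mk K (upd r i) (upd_ne r i) := by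
  have e : ∀ g : Equiv.Perm (Fin 4), (![r, r, r, r + 1] : Fin 4 → K) ∘ g = upd r (g.symm 3) := by
    intro g
    funext i
    simp only [Function.comp, upd, Equiv.eq_symm_apply]
    generalize g i = j
    fin_cases j <;> simp
  constructor
  · rintro ⟨g, h, rfl⟩
    refine ⟨g.symm 3, ?_⟩
    congr 1
    exact e g
  · rintro ⟨i, rfl⟩
    have e' := e (Equiv.swap 3 i)
    simp only [Equiv.symm_swap, Equiv.swap_apply_left] at e'
    refine ⟨Equiv.swap 3 i, by rw [e']; exact upd_ne r i, ?_⟩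
    congr 1
    exact e'.symm

lemma ncard6 {K : Type*} [Field K] : (s4Orbit (![0, 0, 1, 1] : Fin 4 → K)).ncard = 6 := by
  let f : {s : Finset (Fin 4) // s.card = 2} → Projectivization K (Fin 4 → K) :=
    fun s => Projectivization.mk K (ind K s.1) (ind_ne s.2)
  have e : s4Orbit (![0, 0, 1, 1] : Fin 4 → K) = Set.range f := by
    ext q
    rw [mem_orbit6]
    simp [f, eq_comm]
  have hf : Function.Injective f := by
    rintro ⟨s, hs⟩ ⟨t, ht⟩ h
    obtain ⟨c, hc⟩ := (Projectivization.mk_eq_mk_iff K _ _ (ind_ne hs) (ind_ne ht)).1 h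
    have hc0 : (c : K) ≠ 0 := c.ne_zero
    apply Subtype.ext
    ext i
    have := congrFun hc i
    simp only [ind, Pi.smul_apply, Units.smul_def, smul_eq_mul] at this
    by_cases h1 : i ∈ s <;> by_cases h2 : i ∈ t <;> simp_all
  rw [e, ← Nat.card_coe_set_eq, Nat.card_range_of_injective hf, Nat.card_eq_fintype_card]
  decide

lemma ncard4 {K : Type*} [Field K] [CharP K 2] (r : K) :
    (s4Orbit (![r, r, r, r + 1] : Fin 4 → K)).ncard = 4 := by
  have h2 : (2 : K) = 0 := CharP.cast_eq_zero K 2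
  let f : Fin 4 → Projectivization K (Fin 4 → K) :=
    fun i => Projectivization.mk K (upd r i) (upd_ne r i)
  have e : s4Orbit (![r, r, r, r + 1] : Fin 4 → K) = Set.range f := by
    ext q
    rw [mem_orbit4]
    simp [f, eq_comm]
  have hf : Function.Injective f := by
    intro i j h
    obtain ⟨c, hc⟩ := (Projectivization.mk_eq_mk_iff' K _ _ (upd_ne r i) (upd_ne r j)).1 h
    have sum : ∀ i, upd r i 0 + upd r i 1 + upd r i 2 + upd r i 3 = 1 := by
      intro i
      fin_cases i <;> simp [upd] <;> grind
    have hc1 : c = 1 := by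
      have s1 := sum i
      rw [← hc] at s1
      simp only [Pi.smul_apply, smul_eq_mul] at s1
      linear_combination s1 - c * sum j
    subst hc1
    have := congrFun hc j
    by_contra hij
    simp [upd, Ne.symm hij] at this
  rw [e, ← Nat.card_coe_set_eq, Nat.card_range_of_injective hf, Nat.card_eq_fintype_card]
  decide

lemma disj {K : Type*} [Field K] [CharP K 2] (r : K) :
    Disjoint (s4Orbit (![0, 0, 1, 1] : Fin 4 → K)) (s4Orbit (![r, r, r, r + 1] : Fin 4 → K)) := by
  have h2 : (2 : K) = 0 := CharP.cast_eq_zero K 2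
  rw [Set.disjoint_left]
  intro q hq hq'
  obtain ⟨s, hs, rfl⟩ := (mem_orbit6 q).1 hq
  obtain ⟨i, hi⟩ := (mem_orbit4 r _).1 hq'
  obtain ⟨c, hc⟩ := (Projectivization.mk_eq_mk_iff' K _ _ (upd_ne r i) (ind_ne hs)).1 hi.symm
  have sum : upd r i 0 + upd r i 1 + upd r i 2 + upd r i 3 = 1 := by
    fin_cases i <;> simp [upd] <;> grind
  have sum' : ind K s 0 + ind K s 1 + ind K s 2 + ind K s 3 = 0 := by
    rcases card_two_cases s hs with rfl | rfl | rfl | rfl | rfl | rfl <;> simp [ind] <;> grind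
  rw [← hc] at sum
  simp only [Pi.smul_apply, smul_eq_mul] at sum
  exact one_ne_zero (α := K) (by linear_combination c * sum' - sum)

lemma orbit_smul_sub {K : Type*} [Field K] (c : K) (hc : c ≠ 0) (v : Fin 4 → K) :
    s4Orbit v ⊆ s4Orbit (c • v) := by
  rintro q ⟨g, h, rfl⟩
  have e : (c • v) ∘ g = c • (v ∘ g) := rfl
  refine ⟨g, by rw [e]; exact smul_ne_zero hc h, ?_⟩
  rw [Projectivization.mk_eq_mk_iff']
  exact ⟨c⁻¹, by rw [e, inv_smul_smul₀ hc]⟩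

lemma orbit_smul {K : Type*} [Field K] (c : K) (hc : c ≠ 0) (v : Fin 4 → K) :
    s4Orbit (c • v) = s4Orbit v := by
  apply Set.Subset.antisymm _ (orbit_smul_sub c hc v)
  have := orbit_smul_sub c⁻¹ (inv_ne_zero hc) (c • v)
  rwa [inv_smul_smul₀ hc] at this

lemma infinite_of {K : Type*} [Field K] [Infinite K] (S : Set (Projectivization K (Fin 4 → K)))
    (f : K → Fin 4 → K) (hf : ∀ t, f t ≠ 0)
    (hi : ∀ (t u c : K), c • f u = f t → t = u)
    (hS : ∀ t, Projectivization.mk K (f t) (hf t) ∈ S) : S.Infinite := by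
  have : Function.Injective (fun t => Projectivization.mk K (f t) (hf t)) := by
    intro t u h
    obtain ⟨c, hc⟩ := (Projectivization.mk_eq_mk_iff' K _ _ (hf t) (hf u)).1 h
    exact hi t u c hc
  exact (Set.infinite_range_of_injective this).mono (by rintro _ ⟨t, rfl⟩; exact hS t)

/-- For any nonzero `a ∈ K⁴` over an algebraically closed field of characteristic 2, the
symmetric quartic `X_a` has the `S₄`-orbit of `[0:0:1:1]` (6 points) among its singular
points, and either `|Sing(X_a)| = 6`, or `|Sing(X_a)| = 10` with the 4 extra singular points
forming the `S₄`-orbit of `[0:0:0:1]` or of some `[1:1:1:b]` with `b ≠ 1`, or `Sing(X_a)` is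
infinite. -/
theorem symQuartic_singular_trichotomy
    {K : Type*} [Field K] [IsAlgClosed K] [CharP K 2]
    (a : Fin 4 → K) (ha : a ≠ 0) :
    s4Orbit (![0, 0, 1, 1] : Fin 4 → K) ⊆ singLocus (symQuartic a) ∧
    (s4Orbit (![0, 0, 1, 1] : Fin 4 → K)).ncard = 6 ∧
    ((singLocus (symQuartic a)).ncard = 6 ∨
      ((singLocus (symQuartic a)).ncard = 10 ∧
        (singLocus (symQuartic a) \ s4Orbit (![0, 0, 1, 1] : Fin 4 → K)
            = s4Orbit (![0, 0, 0, 1] : Fin 4 → K) ∨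
          ∃ b : K, b ≠ 1 ∧
            singLocus (symQuartic a) \ s4Orbit (![0, 0, 1, 1] : Fin 4 → K)
              = s4Orbit (![1, 1, 1, b] : Fin 4 → K))) ∨
      (singLocus (symQuartic a)).Infinite) := by
  have h2 : (2 : K) = 0 := CharP.cast_eq_zero K 2
  have hInf : Infinite K := IsAlgClosed.instInfinite
  have sub : s4Orbit (![0, 0, 1, 1] : Fin 4 → K) ⊆ singLocus (symQuartic a) := by
    intro q hq
    obtain ⟨s, hs, rfl⟩ := (mem_orbit6 q).1 hq
    rw [mem_sing]
    exact qE_ind a hs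
  refine ⟨sub, ncard6, ?_⟩
  by_cases h3 : a 3 = 0
  · right; right
    refine infinite_of _ (fun t => ![1, 1, t, t]) ?_ ?_ ?_
    · intro t h
      simpa using congrFun h 0
    · intro t u c h
      have e0 := congrFun h 0
      have e2 := congrFun h 2
      simp at e0 e2
      rw [← e2, e0, one_mul]
    · intro t
      rw [mem_sing]
      simp only [qE, qF, qD, h3, Matrix.cons_val]
      refine ⟨?_, ?_, ?_, ?_, ?_⟩ <;> grind
  obtain ⟨r, hr'⟩ := IsAlgClosed.exists_pow_nat_eq (a 1 / a 3) (n := 2) (by norm_num)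
  have hr : a 3 * r ^ 2 = a 1 := by rw [hr']; field_simp
  by_cases hC : a 0 * a 3 + a 1 ^ 2 + a 1 * a 2 = 0
  swap
  · left
    rw [← ncard6 (K := K)]
    congr 1
    refine Set.Subset.antisymm ?_ sub
    intro q hq
    induction q using Projectivization.ind with
    | h v hv =>
      rw [mem_sing] at hq
      rcases classify h3 hr hq with ⟨s, hs, c, hc⟩ | ⟨h, -⟩
      · exact (mem_orbit6 _).2 ⟨s, hs, (Projectivization.mk_eq_mk_iff' K _ _ _ _).2 ⟨c, hc⟩⟩
      · exact absurd h hC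
  right
  by_cases hD : a 2 ^ 2 = a 1 * a 3
  · right
    have hD' : a 2 = a 3 * r := by
      have e : (a 2 - a 3 * r) ^ 2 = 0 := by rw [← hr] at hD; grind
      exact sub_eq_zero.1 (pow_eq_zero_iff two_ne_zero |>.1 e)
    refine infinite_of _ (fun t => ![r, r, t, t + 1]) ?_ ?_ ?_
    · intro t h
      have e2 := congrFun h 2
      have e3 := congrFun h 3
      simp at e2 e3
      simp [e2] at e3
    · intro t u c h
      have e2 := congrFun h 2
      have e3 := congrFun h 3
      simp at e2 e3
      have : c = 1 := by linear_combination e3 - e2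
      rw [← e2, this, one_mul]
    · intro t
      rw [mem_sing]
      exact qE_gen h3 hr hC t (Or.inl hD')
  left
  have hU : singLocus (symQuartic a) =
      s4Orbit (![0, 0, 1, 1] : Fin 4 → K) ∪ s4Orbit (![r, r, r, r + 1] : Fin 4 → K) := by
    apply Set.Subset.antisymm
    · intro q hq
      induction q using Projectivization.ind with
      | h v hv =>
        rw [mem_sing] at hq
        rcases classify h3 hr hq with ⟨s, hs, c, hc⟩ | ⟨-, h | ⟨i, c, hc⟩⟩
        · exact Or.inl ((mem_orbit6 _).2
            ⟨s, hs, (Projectivization.mk_eq_mk_iff' K _ _ _ _).2 ⟨c, hc⟩⟩)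
        · exact absurd h hD
        · exact Or.inr ((mem_orbit4 r _).2
            ⟨i, (Projectivization.mk_eq_mk_iff' K _ _ _ _).2 ⟨c, hc⟩⟩)
    · apply Set.union_subset sub
      intro q hq
      obtain ⟨i, rfl⟩ := (mem_orbit4 r q).1 hq
      rw [mem_sing]
      exact qE_upd h3 hr hC i
  have hdiff : singLocus (symQuartic a) \ s4Orbit (![0, 0, 1, 1] : Fin 4 → K)
      = s4Orbit (![r, r, r, r + 1] : Fin 4 → K) := by
    rw [hU, Set.union_sdiff_left]
    exact (disj r).symm.sdiff_eq_left
  refine ⟨?_, ?_⟩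
  · rw [hU, Set.ncard_union_eq (disj r) (Set.finite_of_ncard_ne_zero (by rw [ncard6]; norm_num))
      (Set.finite_of_ncard_ne_zero (by rw [ncard4]; norm_num)), ncard6, ncard4]
  · rw [hdiff]
    by_cases h0 : r = 0
    · left; simp [h0]
    · right
      refine ⟨(r + 1) / r, ?_, ?_⟩
      · intro h
        rw [div_eq_one_iff_eq h0] at h
        simp at h
      · rw [← orbit_smul r h0 ![1, 1, 1, (r + 1) / r]]
        congr 1
        funext j
        fin_cases j <;> simp
        field_simp

end
end

section
/- Let K be an algebraically closed field of characteristic 2 and let a = (a₁,a₂,a₃,a₄) ∈ K⁴ with a₄ ≠ 0. If Sing(X_a) is a finite set, then |Sing(X_a)| ≤ 10. -/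
open MvPolynomial

noncomputable section

namespace SymQ

variable {K : Type*} [Field K]

def s1 (x y z w : K) : K := x + y + z + w
def s2 (x y z w : K) : K := x*y + x*z + x*w + y*z + y*w + z*w
def s3 (x y z w : K) : K := x*y*z + x*y*w + x*z*w + y*z*w
def s4 (x y z w : K) : K := x*y*z*w

/-- value of the quartic -/
def FF (a : Fin 4 → K) (x y z w : K) : K :=
  a 0 * s1 x y z w ^ 4 + a 1 * s1 x y z w ^ 2 * s2 x y z w
    + a 2 * s1 x y z w * s3 x y z w + a 3 * s4 x y z w

/-- value of the partial derivative, `t` being the variable -/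
def DD (a : Fin 4 → K) (x y z w t : K) : K :=
  a 0 * (4 * s1 x y z w ^ 3)
    + a 1 * (2 * s1 x y z w * s2 x y z w + s1 x y z w ^ 2 * (s1 x y z w - t))
    + a 2 * (s3 x y z w + s1 x y z w * (s2 x y z w - t * s1 x y z w + t ^ 2))
    + a 3 * (s3 x y z w - t * s2 x y z w + t ^ 2 * s1 x y z w - t ^ 3)

def Sg (a : Fin 4 → K) (x y z w : K) : Prop :=
  FF a x y z w = 0 ∧ DD a x y z w x = 0 ∧ DD a x y z w y = 0 ∧ DD a x y z w z = 0 ∧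
    DD a x y z w w = 0

theorem es1 : esymm (Fin 4) K 1 = X 0 + X 1 + X 2 + X 3 := by
  rw [esymm_one, Fin.sum_univ_four]

theorem es2 : esymm (Fin 4) K 2 = X 0 * X 1 + X 0 * X 2 + X 0 * X 3 + X 1 * X 2 + X 1 * X 3
    + X 2 * X 3 := by
  have : Finset.powersetCard 2 (Finset.univ : Finset (Fin 4)) =
    {{0,1},{0,2},{0,3},{1,2},{1,3},{2,3}} := by decide
  rw [esymm, this]
  repeat rw [Finset.sum_insert (by decide)]
  rw [Finset.sum_singleton]
  repeat rw [Finset.prod_insert (by decide), Finset.prod_singleton]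
  ring

theorem es3 : esymm (Fin 4) K 3 = X 0 * X 1 * X 2 + X 0 * X 1 * X 3 + X 0 * X 2 * X 3
    + X 1 * X 2 * X 3 := by
  have : Finset.powersetCard 3 (Finset.univ : Finset (Fin 4)) =
    {{0,1,2},{0,1,3},{0,2,3},{1,2,3}} := by decide
  rw [esymm, this]
  repeat rw [Finset.sum_insert (by decide)]
  rw [Finset.sum_singleton]
  repeat rw [Finset.prod_insert (by decide), Finset.prod_insert (by decide), Finset.prod_singleton]
  ring

theorem es4 : esymm (Fin 4) K 4 = X 0 * X 1 * X 2 * X 3 := by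
  have : Finset.powersetCard 4 (Finset.univ : Finset (Fin 4)) = {Finset.univ} := by decide
  rw [esymm, this, Finset.sum_singleton, Fin.prod_univ_four]

theorem eval_FF (a v : Fin 4 → K) :
    eval v (symQuartic a) = FF a (v 0) (v 1) (v 2) (v 3) := by
  simp only [symQuartic, es1, es2, es3, es4, map_add, map_mul, map_pow, eval_C, eval_X, FF, s1, s2,
    s3, s4]

theorem eval_DD (a v : Fin 4 → K) (i : Fin 4) :
    eval v (pderiv i (symQuartic a)) = DD a (v 0) (v 1) (v 2) (v 3) (v i) := by
  rw [symQuartic, es1, es2, es3, es4]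
  fin_cases i <;>
  · simp [pderiv_X, DD, s1, s2, s3,
      Derivation.leibniz_pow]
    ring

theorem sing_iff (a v : Fin 4 → K) :
    (eval v (symQuartic a) = 0 ∧ ∀ i, eval v (pderiv i (symQuartic a)) = 0) ↔
      Sg a (v 0) (v 1) (v 2) (v 3) := by
  simp only [eval_FF, eval_DD, Sg, Fin.forall_fin_succ]
  simp

theorem Sg.swap12 {a : Fin 4 → K} {x y z w : K} (h : Sg a x y z w) : Sg a y x z w := by
  have e1 : s1 y x z w = s1 x y z w := by simp only [s1]; ring
  have e2 : s2 y x z w = s2 x y z w := by simp only [s2]; ring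
  have e3 : s3 y x z w = s3 x y z w := by simp only [s3]; ring
  have e4 : s4 y x z w = s4 x y z w := by simp only [s4]; ring
  simp only [Sg, FF, DD, e1, e2, e3, e4] at *
  tauto

theorem Sg.swap23 {a : Fin 4 → K} {x y z w : K} (h : Sg a x y z w) : Sg a x z y w := by
  have e1 : s1 x z y w = s1 x y z w := by simp only [s1]; ring
  have e2 : s2 x z y w = s2 x y z w := by simp only [s2]; ring
  have e3 : s3 x z y w = s3 x y z w := by simp only [s3]; ring
  have e4 : s4 x z y w = s4 x y z w := by simp only [s4]; ring
  simp only [Sg, FF, DD, e1, e2, e3, e4] at *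
  tauto

theorem Sg.swap34 {a : Fin 4 → K} {x y z w : K} (h : Sg a x y z w) : Sg a x y w z := by
  have e1 : s1 x y w z = s1 x y z w := by simp only [s1]; ring
  have e2 : s2 x y w z = s2 x y z w := by simp only [s2]; ring
  have e3 : s3 x y w z = s3 x y z w := by simp only [s3]; ring
  have e4 : s4 x y w z = s4 x y z w := by simp only [s4]; ring
  simp only [Sg, FF, DD, e1, e2, e3, e4] at *
  tauto

theorem Sg.smul {a : Fin 4 → K} {x y z w : K} (h : Sg a x y z w) (c : K) :
    Sg a (c * x) (c * y) (c * z) (c * w) := by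
  obtain ⟨p, q, r, s, u⟩ := h
  simp only [FF, DD, s1, s2, s3, s4] at p q r s u
  refine ⟨?_, ?_, ?_, ?_, ?_⟩ <;> simp only [FF, DD, s1, s2, s3, s4]
  · linear_combination c^4 * p
  · linear_combination c^3 * q
  · linear_combination c^3 * r
  · linear_combination c^3 * s
  · linear_combination c^3 * u

def Curve (a : Fin 4 → K) : Prop :=
  ∃ z, a 2 = a 3 * z ∧ a 1 = a 3 * z ^ 2 ∧ a 0 = a 3 * (z ^ 4 + z ^ 3)

/-- divided difference -/
theorem divdiff (a : Fin 4 → K) (h2 : (2 : K) = 0) {x y z w p q r : K} (h1 : s1 x y z w = 1)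
    (hp : DD a x y z w p = 0) (hq : DD a x y z w q = 0) (hr : DD a x y z w r = 0)
    (hpq : p ≠ q) (hpr : p ≠ r) (hqr : q ≠ r) : a 3 * (p + q + r) = a 2 + a 3 := by
  simp only [DD, h1] at hp hq hr
  generalize s2 x y z w = e2 at *
  generalize s3 x y z w = e3 at *
  have k1 : a 1 + a 2 * (1 + p + q) + a 3 * (e2 + p + q + p^2+p*q+q^2) = 0 := by
    apply mul_left_cancel₀ (sub_ne_zero.2 hpq)
    grind
  have k2 : a 1 + a 2 * (1 + p + r) + a 3 * (e2 + p + r + p^2+p*r+r^2) = 0 := by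
    apply mul_left_cancel₀ (sub_ne_zero.2 hpr)
    grind
  apply mul_left_cancel₀ (sub_ne_zero.2 hqr)
  grind

theorem pair (a : Fin 4 → K) (ha : a 3 ≠ 0) (h2 : (2 : K) = 0) {x y z : K}
    (h1 : s1 x y z z = 1) (h : Sg a x y z z) : x = z ∨ y = z ∨ Curve a := by
  by_cases hx : x = z
  · exact Or.inl hx
  by_cases hy : y = z
  · exact Or.inr (Or.inl hy)
  refine Or.inr (Or.inr ⟨z, ?_⟩)
  obtain ⟨hF, h3, h4, h5, -⟩ := h
  have hs : y = 1 + x := by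
    simp only [s1] at h1; grind
  have hxy : x ≠ y := by grind
  have k := divdiff a h2 h1 h3 h4 h5 hxy hx hy
  have k2 : a 2 = a 3 * z := by subst hs; grind
  have k1 : a 1 = a 3 * z ^ 2 := by
    simp only [DD, h1] at h3 h4
    have e : s2 x y z z = x*y + z^2 := by simp only [s2]; grind
    rw [e] at h3 h4
    grind
  refine ⟨k2, k1, ?_⟩
  simp only [FF, h1] at hF
  have e : s2 x y z z = x*y + z^2 := by simp only [s2]; grind
  have e3 : s3 x y z z = z^2 := by simp only [s3]; grind
  have e4 : s4 x y z z = x*y*z^2 := by simp only [s4]; ring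
  rw [e, e3, e4] at hF
  grind

theorem triple (a : Fin 4 → K) (h2 : (2 : K) = 0) {x z : K}
    (h1 : s1 x z z z = 1) (h : Sg a x z z z) : a 3 * z ^ 2 = a 1 ∧ x = z + 1 := by
  have hx : x = z + 1 := by simp only [s1] at h1; grind
  refine ⟨?_, hx⟩
  obtain ⟨hF, h3, h4, -, -⟩ := h
  have e2 : s2 x z z z = z := by simp only [s2]; grind
  have e3 : s3 x z z z = z ^ 2 := by simp only [s3]; grind
  simp only [DD, h1, e2, e3] at h3 h4
  subst hx
  grind

theorem curve_Sg (a : Fin 4 → K) (h2 : (2 : K) = 0) (z : K) (hz1 : a 2 = a 3 * z)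
    (hz2 : a 1 = a 3 * z ^ 2) (hz3 : a 0 = a 3 * (z ^ 4 + z ^ 3)) (t : K) :
    Sg a t (1 + t) z z := by
  have h1 : s1 t (1+t) z z = 1 := by simp only [s1]; grind
  have e : s2 t (1+t) z z = t * (1+t) + z^2 := by simp only [s2]; grind
  have e3 : s3 t (1+t) z z = z^2 := by simp only [s3]; grind
  have e4 : s4 t (1+t) z z = t*(1+t)*z^2 := by simp only [s4]; ring
  simp only [Sg, FF, DD, h1, e, e3, e4, hz1, hz2, hz3]
  refine ⟨?_, ?_, ?_, ?_, ?_⟩ <;> grind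

/-- singular points with `σ₁ = 1` -/
theorem case_one (a : Fin 4 → K) (ha : a 3 ≠ 0) (h2 : (2 : K) = 0) (hc : ¬ Curve a) {x y z w : K}
    (h1 : x + y + z + w = 1) (h : Sg a x y z w) :
    ∃ s, a 3 * s ^ 2 = a 1 ∧
      ((x = s + 1 ∧ y = s ∧ z = s ∧ w = s) ∨ (x = s ∧ y = s + 1 ∧ z = s ∧ w = s) ∨
       (x = s ∧ y = s ∧ z = s + 1 ∧ w = s) ∨ (x = s ∧ y = s ∧ z = s ∧ w = s + 1)) := by
  -- one pair suffices
  have key : ∀ {x y z : K}, x + y + z + z = 1 → Sg a x y z z →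
      a 3 * z ^ 2 = a 1 ∧ ((x = z + 1 ∧ y = z) ∨ (x = z ∧ y = z + 1)) := by
    intro x y z h1 h
    rcases pair a ha h2 (by simpa only [s1] using h1) h with rfl | rfl | h'
    · obtain ⟨i, j⟩ := triple a h2 (by simp only [s1]; linear_combination h1) h.swap12
      exact ⟨i, Or.inr ⟨rfl, j⟩⟩
    · obtain ⟨i, j⟩ := triple a h2 (by simp only [s1]; linear_combination h1) h
      exact ⟨i, Or.inl ⟨j, rfl⟩⟩
    · exact absurd h' hc
  by_cases e34 : z = w
  · subst e34; have := key h1 h; grind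
  by_cases e24 : y = w
  · subst e24; have := key (by linear_combination h1) h.swap23; grind
  by_cases e14 : x = w
  · subst e14; have := key (by linear_combination h1) h.swap12.swap23; grind
  by_cases e23 : y = z
  · subst e23; have := key (by linear_combination h1) h.swap34.swap23.swap34; grind
  by_cases e13 : x = z
  · subst e13; have := key (by linear_combination h1) h.swap12.swap23.swap34.swap23.swap34; grind
  by_cases e12 : x = y
  · subst e12
    have := key (by linear_combination h1) h.swap23.swap12.swap34.swap23; grind
  exfalso
  obtain ⟨-, p, q, r, s⟩ := h
  have A := divdiff a h2 (by simpa only [s1] using h1) p q r e12 e13 e23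
  have B := divdiff a h2 (by simpa only [s1] using h1) p q s e12 e14 e24
  apply e34
  apply mul_left_cancel₀ ha
  linear_combination A - B

/-- singular points with `σ₁ = 0` -/
theorem case_zero (a : Fin 4 → K) (ha : a 3 ≠ 0) (h2 : (2 : K) = 0) {x y z w : K}
    (h1 : x + y + z + w = 0) (h : Sg a x y z w) :
    (x = 0 ∧ y = 0 ∧ z = w) ∨ (x = 0 ∧ z = 0 ∧ y = w) ∨ (x = 0 ∧ w = 0 ∧ y = z) ∨
    (y = 0 ∧ z = 0 ∧ x = w) ∨ (y = 0 ∧ w = 0 ∧ x = z) ∨ (z = 0 ∧ w = 0 ∧ x = y) := by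
  have key : ∀ {y z w : K}, y + z + w = 0 → Sg a 0 y z w →
      (y = 0 ∧ z = w) ∨ (z = 0 ∧ y = w) ∨ (w = 0 ∧ y = z) := by
    intro y z w h1 h
    obtain ⟨-, p, q, -, -⟩ := h
    have hs : s1 0 y z w = 0 := by simp only [s1]; linear_combination h1
    have e3 : s3 0 y z w = y * z * w := by simp only [s3]; ring
    have e2 : s2 0 y z w = y * z + y * w + z * w := by simp only [s2]; ring
    simp only [DD, hs, e3, e2] at p q
    have : a 3 * (y * z * w) = 0 := by grind
    have : y * z * w = 0 := by simpa [ha] using this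
    have : y = 0 ∨ z = 0 ∨ w = 0 := by simpa [or_assoc] using this
    grind
  have h4 : x * y * z * w = 0 := by
    have := h.1
    have hs : s1 x y z w = 0 := by simp only [s1]; linear_combination h1
    simp only [FF, hs] at this
    simpa [s4, ha] using this
  have : x = 0 ∨ y = 0 ∨ z = 0 ∨ w = 0 := by simpa [or_assoc] using h4
  rcases this with rfl | rfl | rfl | rfl
  · have := key (by linear_combination h1) h; grind
  · have := key (by linear_combination h1) h.swap12; grind
  · have := key (by linear_combination h1) h.swap23.swap12; grind
  · have := key (by linear_combination h1) h.swap34.swap23.swap12; grind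

/-- the ten candidate vectors -/
def cand (s : K) : Fin 10 → Fin 4 → K :=
  ![![s+1,s,s,s], ![s,s+1,s,s], ![s,s,s+1,s], ![s,s,s,s+1],
    ![0,0,1,1], ![0,1,0,1], ![0,1,1,0], ![1,0,0,1], ![1,0,1,0], ![1,1,0,0]]

theorem cand_ne (s : K) (i : Fin 10) : cand s i ≠ 0 := by
  intro h
  have := congrFun h 0
  have := congrFun h 1
  have := congrFun h 2
  have := congrFun h 3
  fin_cases i <;> simp [cand] at * <;> grind

theorem mem_of_smul {s : K} {v : Fin 4 → K} (hv : v ≠ 0) (i : Fin 10) (c : K)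
    (h : ∀ j, c * cand s i j = v j) :
    Projectivization.mk K v hv ∈ Set.range
      (fun i => Projectivization.mk K (cand s i) (cand_ne s i)) := by
  refine ⟨i, ?_⟩
  symm
  rw [Projectivization.mk_eq_mk_iff']
  exact ⟨c, funext h⟩

theorem not_curve [Infinite K] (h2 : (2 : K) = 0) (a : Fin 4 → K)
    (hfin : (singLocus (symQuartic a)).Finite) : ¬ Curve a := by
  rintro ⟨z, hz1, hz2, hz3⟩
  have hne : ∀ t : K, (![t, 1 + t, z, z] : Fin 4 → K) ≠ 0 := by
    intro t h
    have h0 := congrFun h 0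
    have h1 := congrFun h 1
    simp at h0 h1
    simp [h0] at h1
  refine Set.infinite_of_injective_forall_mem
    (f := fun t : K => Projectivization.mk K ![t, 1 + t, z, z] (hne t)) ?_ ?_ hfin
  · intro t u htu
    simp only [Projectivization.mk_eq_mk_iff'] at htu
    obtain ⟨c, hc⟩ := htu
    have h0 := congrFun hc 0
    have h1 := congrFun hc 1
    simp at h0 h1
    grind
  · intro t v hv hvt
    rw [Projectivization.mk_eq_mk_iff'] at hvt
    obtain ⟨c, rfl⟩ := hvt
    rw [sing_iff]
    exact (curve_Sg a h2 z hz1 hz2 hz3 t).smul c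

end SymQ

/-- For `a ∈ K⁴` with `a₄ ≠ 0` over an algebraically closed field of characteristic 2, if the
singular locus of the symmetric quartic `X_a` is finite, then `|Sing(X_a)| ≤ 10`. -/
theorem symQuartic_singular_count_le_ten
    {K : Type*} [Field K] [IsAlgClosed K] [CharP K 2]
    (a : Fin 4 → K) (ha4 : a 3 ≠ 0)
    (hfin : (singLocus (symQuartic a)).Finite) :
    (singLocus (symQuartic a)).ncard ≤ 10 := by
  have h2 : (2 : K) = 0 := CharTwo.two_eq_zero
  have : Infinite K := IsAlgClosed.instInfinite
  have hc := SymQ.not_curve h2 a hfin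
  obtain ⟨s, hs⟩ := IsAlgClosed.exists_pow_nat_eq (a 1 / a 3) (n := 2) (by norm_num)
  have hsub : singLocus (symQuartic a) ⊆ Set.range
      (fun i => Projectivization.mk K (SymQ.cand s i) (SymQ.cand_ne s i)) := by
    intro p hp
    induction p using Projectivization.ind with
    | h v hv =>
    by_cases h1 : v 0 + v 1 + v 2 + v 3 = 0
    · have h := (SymQ.sing_iff a v).1 (hp v hv rfl)
      have hne : v 0 ≠ 0 ∨ v 1 ≠ 0 ∨ v 2 ≠ 0 ∨ v 3 ≠ 0 := by
        by_contra! hcon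
        apply hv
        funext j
        fin_cases j <;> simp [hcon]
      rcases SymQ.case_zero a ha4 h2 h1 h with h | h | h | h | h | h
      · refine SymQ.mem_of_smul hv 4 (v 3) ?_
        simp [SymQ.cand, Fin.forall_fin_succ, h]
      · refine SymQ.mem_of_smul hv 5 (v 3) ?_
        simp [SymQ.cand, Fin.forall_fin_succ, h]
      · refine SymQ.mem_of_smul hv 6 (v 2) ?_
        simp [SymQ.cand, Fin.forall_fin_succ, h]
      · refine SymQ.mem_of_smul hv 7 (v 3) ?_
        simp [SymQ.cand, Fin.forall_fin_succ, h]
      · refine SymQ.mem_of_smul hv 8 (v 2) ?_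
        simp [SymQ.cand, Fin.forall_fin_succ, h]
      · refine SymQ.mem_of_smul hv 9 (v 1) ?_
        simp [SymQ.cand, Fin.forall_fin_succ, h]
    · set c := v 0 + v 1 + v 2 + v 3 with hcdef
      have hci : c⁻¹ ≠ 0 := inv_ne_zero h1
      have hv' : c⁻¹ • v ≠ 0 := smul_ne_zero hci hv
      have h := (SymQ.sing_iff a _).1 (hp (c⁻¹ • v) hv'
        ((Projectivization.mk_eq_mk_iff' K _ _ _ _).2 ⟨c⁻¹, rfl⟩))
      simp only [Pi.smul_apply, smul_eq_mul] at h
      obtain ⟨t, ht, h'⟩ := SymQ.case_one a ha4 h2 hc (by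
        rw [← mul_add, ← mul_add, ← mul_add, ← hcdef]; exact inv_mul_cancel₀ h1) h
      have hts : t = s := by
        have e : s ^ 2 * a 3 = a 1 := by rw [hs]; field_simp
        have e2 : a 3 * (t - s) ^ 2 = 0 := by
          linear_combination ht - e + (s ^ 2 - t * s) * a 3 * h2
        have e3 : (t - s) ^ 2 = 0 := by simpa [ha4] using e2
        exact sub_eq_zero.1 (by simpa using e3)
      subst hts
      have hm : ∀ j r, c⁻¹ * v j = r → c * r = v j := by
        rintro j r rfl
        rw [mul_inv_cancel_left₀ h1]
      rcases h' with h | h | h | h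
      · refine SymQ.mem_of_smul hv 0 c ?_
        intro j
        apply hm
        fin_cases j <;> simp [SymQ.cand, h]
      · refine SymQ.mem_of_smul hv 1 c ?_
        intro j
        apply hm
        fin_cases j <;> simp [SymQ.cand, h]
      · refine SymQ.mem_of_smul hv 2 c ?_
        intro j
        apply hm
        fin_cases j <;> simp [SymQ.cand, h]
      · refine SymQ.mem_of_smul hv 3 c ?_
        intro j
        apply hm
        fin_cases j <;> simp [SymQ.cand, h]
  refine (Set.ncard_le_ncard hsub (Set.finite_range _)).trans ?_
  rw [← Set.image_univ]
  refine (Set.ncard_image_le Set.finite_univ).trans ?_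
  simp [Set.ncard_univ]

end
end

section
/- Let K be an algebraically closed field of characteristic 2 and let c ∈ K with c ≠ 0. Then the quartic surface X_c = {c·σ₁σ₃ + σ₄ = 0} ⊂ ℙ³_K has exactly 10 singular points: Sing(X_c) is the union of the S₄-orbit of [0:0:1:1] (6 points) and the S₄-orbit of [0:0:0:1] (4 points). -/
open MvPolynomial

noncomputable section

theorem aux_F {K : Type*} [Field K] [CharP K 2] (c : K) (v : Fin 4 → K) :
    eval v (C c * esymm (Fin 4) K 1 * esymm (Fin 4) K 3 + esymm (Fin 4) K 4)
      = c * (v 0 + v 1 + v 2 + v 3) * (v 0 * v 1 * v 2 + v 0 * v 1 * v 3 + v 0 * v 2 * v 3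
        + v 1 * v 2 * v 3) + v 0 * v 1 * v 2 * v 3 ∧
    eval v (pderiv 0 (C c * esymm (Fin 4) K 1 * esymm (Fin 4) K 3 + esymm (Fin 4) K 4))
      = c * ((v 1 + v 2) * (v 1 + v 3) * (v 2 + v 3)) + v 1 * v 2 * v 3 ∧
    eval v (pderiv 1 (C c * esymm (Fin 4) K 1 * esymm (Fin 4) K 3 + esymm (Fin 4) K 4))
      = c * ((v 0 + v 2) * (v 0 + v 3) * (v 2 + v 3)) + v 0 * v 2 * v 3 ∧
    eval v (pderiv 2 (C c * esymm (Fin 4) K 1 * esymm (Fin 4) K 3 + esymm (Fin 4) K 4))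
      = c * ((v 0 + v 1) * (v 0 + v 3) * (v 1 + v 3)) + v 0 * v 1 * v 3 ∧
    eval v (pderiv 3 (C c * esymm (Fin 4) K 1 * esymm (Fin 4) K 3 + esymm (Fin 4) K 4))
      = c * ((v 0 + v 1) * (v 0 + v 2) * (v 1 + v 2)) + v 0 * v 1 * v 2 := by
  have h2 : (2 : K) = 0 := CharTwo.two_eq_zero
  have e1 : esymm (Fin 4) K 1 = X 0 + X 1 + X 2 + X 3 := by
    rw [esymm_one, Fin.sum_univ_four]
  have p3 : Finset.powersetCard 3 (Finset.univ : Finset (Fin 4))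
      = {{0, 1, 2}, {0, 1, 3}, {0, 2, 3}, {1, 2, 3}} := by decide
  have p4 : Finset.powersetCard 4 (Finset.univ : Finset (Fin 4)) = {{0, 1, 2, 3}} := by decide
  have e3 : esymm (Fin 4) K 3
      = X 0 * X 1 * X 2 + X 0 * X 1 * X 3 + X 0 * X 2 * X 3 + X 1 * X 2 * X 3 := by
    rw [esymm, p3, Finset.sum_insert (by decide), Finset.sum_insert (by decide),
      Finset.sum_insert (by decide), Finset.sum_singleton]
    simp
    ring
  have e4 : esymm (Fin 4) K 4 = X 0 * X 1 * X 2 * X 3 := by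
    rw [esymm, p4, Finset.sum_singleton]
    simp
    ring
  rw [e1, e3, e4]
  refine ⟨by simp, ?_, ?_, ?_, ?_⟩ <;>
  · simp [pderiv_X, Pi.single_apply]
    grind

/-- 0/1 vectors -/
def aux_ind (K : Type*) [Field K] (b : Fin 4 → Bool) : Fin 4 → K := fun i => if b i then 1 else 0

theorem aux_ind_ne (K : Type*) [Field K] (b : Fin 4 → Bool) (h : b ≠ fun _ => false) :
    aux_ind K b ≠ 0 := by
  intro h0
  apply h
  funext i
  have := congrFun h0 i
  simpa [aux_ind] using this

/-- the points of the projective space with 0/1 coordinates -/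
def aux_pt (K : Type*) [Field K] (b : {b : Fin 4 → Bool // b ≠ fun _ => false}) :
    Projectivization K (Fin 4 → K) :=
  Projectivization.mk K (aux_ind K b.1) (aux_ind_ne K b.1 b.2)

theorem aux_pt_inj (K : Type*) [Field K] : Function.Injective (aux_pt K) := by
  intro a b h
  rw [aux_pt, aux_pt, Projectivization.mk_eq_mk_iff] at h
  obtain ⟨k, hk⟩ := h
  apply Subtype.ext
  funext i
  have := congrFun hk i
  have hk0 : (k : K) ≠ 0 := k.ne_zero
  simp only [aux_ind, Pi.smul_apply, Units.smul_def, smul_eq_mul] at this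
  cases ha : a.1 i <;> cases hb : b.1 i <;> simp_all

theorem aux_orbit (K : Type*) [Field K] (b₀ : Fin 4 → Bool) (h₀ : b₀ ≠ fun _ => false) :
    s4Orbit (aux_ind K b₀) = aux_pt K '' ((Finset.univ.filter fun b :
      {b : Fin 4 → Bool // b ≠ fun _ => false} => ∃ g : Equiv.Perm (Fin 4), b.1 = b₀ ∘ g :
        Finset _) : Set _) := by
  ext q
  simp only [s4Orbit, Set.mem_setOf_eq, Set.mem_image, Finset.coe_filter, Finset.mem_univ,
    true_and]
  constructor
  · rintro ⟨g, h, rfl⟩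
    refine ⟨⟨b₀ ∘ g, ?_⟩, ⟨g, rfl⟩, rfl⟩
    intro h'
    apply h
    funext i
    have := congrFun h' i
    simp only [Function.comp_apply] at this
    simp [aux_ind, this]
  · rintro ⟨⟨b, hb⟩, ⟨g, hg⟩, rfl⟩
    simp only at hg
    subst hg
    exact ⟨g, aux_ind_ne K _ hb, rfl⟩

theorem aux_alg {K : Type*} [Field K] [CharP K 2] (c : K) (hc : c ≠ 0) (x y z w : K)
    (h0 : c * ((y + z) * (y + w) * (z + w)) + y * z * w = 0)
    (h1 : c * ((x + z) * (x + w) * (z + w)) + x * z * w = 0)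
    (h2 : c * ((x + y) * (x + w) * (y + w)) + x * y * w = 0)
    (h3 : c * ((x + y) * (x + z) * (y + z)) + x * y * z = 0) :
    (x = 0 ∧ y = 0 ∧ z = 0) ∨ (x = 0 ∧ y = 0 ∧ w = 0) ∨ (x = 0 ∧ z = 0 ∧ w = 0) ∨
    (y = 0 ∧ z = 0 ∧ w = 0) ∨ (x = 0 ∧ y = 0 ∧ z = w) ∨ (x = 0 ∧ z = 0 ∧ y = w) ∨
    (x = 0 ∧ w = 0 ∧ y = z) ∨ (y = 0 ∧ z = 0 ∧ x = w) ∨ (y = 0 ∧ w = 0 ∧ x = z) ∨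
    (z = 0 ∧ w = 0 ∧ x = y) := by
  have t : (2 : K) = 0 := CharTwo.two_eq_zero
  have key : ∀ a b : K, a + b = 0 → a = b := fun a b h => by grind
  by_cases hx : x = 0
  · subst hx
    have e1 : z * w * (z + w) = 0 := by grind
    have e2 : y * w * (y + w) = 0 := by grind
    have e3 : y * z * (y + z) = 0 := by grind
    simp only [mul_eq_zero] at e1 e2 e3
    have := key z w
    have := key y w
    have := key y z
    grind
  by_cases hy : y = 0
  · subst hy
    have e1 : z * w * (z + w) = 0 := by grind
    have e2 : x * w * (x + w) = 0 := by grind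
    have e3 : x * z * (x + z) = 0 := by grind
    simp only [mul_eq_zero] at e1 e2 e3
    have := key z w
    have := key x w
    have := key x z
    grind
  by_cases hz : z = 0
  · subst hz
    have e2 : x * w * (x + w) = 0 := by grind
    have e1 : y * w * (y + w) = 0 := by grind
    have e3 : x * y * (x + y) = 0 := by grind
    simp only [mul_eq_zero] at e1 e2 e3
    have := key y w
    have := key x w
    have := key x y
    grind
  by_cases hw : w = 0
  · subst hw
    have e2 : x * z * (x + z) = 0 := by grind
    have e1 : y * z * (y + z) = 0 := by grind
    have e3 : x * y * (x + y) = 0 := by grind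
    simp only [mul_eq_zero] at e1 e2 e3
    have := key y z
    have := key x z
    have := key x y
    grind
  exfalso
  have n1 : x + y ≠ 0 := by
    intro h
    simp [h, hx, hy, hz, hw] at h3
  have n2 : x + z ≠ 0 := by
    intro h
    simp [h, hx, hy, hz, hw] at h3
  have n3 : z + w ≠ 0 := by
    intro h
    simp [h, hx, hy, hz, hw] at h0
  have n4 : y + w ≠ 0 := by
    intro h
    simp [h, hx, hy, hz, hw] at h0
  have n6 : y + z ≠ 0 := by
    intro h
    simp [h, hx, hy, hz, hw] at h0
  have m1 : x * y + z * w = 0 := by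
    have : (c * (x + y) * (z + w)) * (x * y + z * w) = 0 := by
      linear_combination w * h3 + z * h2 - (c * (x + y) ^ 2 * z * w + x * y * z * w) * t
    simpa [hc, n1, n3] using this
  have m2 : x * z + y * w = 0 := by
    have : (c * (x + z) * (y + w)) * (x * z + y * w) = 0 := by
      linear_combination w * h3 + y * h1 - (c * (x + z) ^ 2 * y * w + x * y * z * w) * t
    simpa [hc, n2, n4] using this
  have : w * (y + z) ^ 2 = 0 := by
    linear_combination z * m1 + y * m2 + (w * y * z - x * y * z) * t
  simp [hw, n6] at this

theorem aux_mem {K : Type*} [Field K] (v : Fin 4 → K) (hv : v ≠ 0) (k : K) (b : Fin 4 → Bool)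
    (h : v = k • aux_ind K b)
    (hb : (∃ g : Equiv.Perm (Fin 4), b = ![false, false, true, true] ∘ g) ∨
      ∃ g : Equiv.Perm (Fin 4), b = ![false, false, false, true] ∘ g) :
    ∃ b : {b : Fin 4 → Bool // b ≠ fun _ => false},
      ((∃ g : Equiv.Perm (Fin 4), b.1 = ![false, false, true, true] ∘ g) ∨
      ∃ g : Equiv.Perm (Fin 4), b.1 = ![false, false, false, true] ∘ g) ∧
      aux_pt K b = Projectivization.mk K v hv := by
  have hb0 : b ≠ fun _ => false := by
    rintro rfl
    apply hv
    rw [h]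
    funext i
    simp [aux_ind]
  have hk : k ≠ 0 := by
    rintro rfl
    simp [h] at hv
  refine ⟨⟨b, hb0⟩, hb, ?_⟩
  rw [aux_pt, Projectivization.mk_eq_mk_iff]
  refine ⟨(Units.mk0 k hk)⁻¹, ?_⟩
  rw [h, inv_smul_eq_iff]
  rfl

theorem aux_list : ∀ b : Fin 4 → Bool,
    ((∃ g : Equiv.Perm (Fin 4), b = ![false, false, true, true] ∘ g) ∨
      ∃ g : Equiv.Perm (Fin 4), b = ![false, false, false, true] ∘ g) ↔
    b ∈ [![false, false, false, true], ![false, false, true, false], ![false, true, false, false],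
      ![true, false, false, false], ![false, false, true, true], ![false, true, false, true],
      ![false, true, true, false], ![true, false, false, true], ![true, false, true, false],
      ![true, true, false, false]] := by
  decide +kernel

theorem aux_sing {K : Type*} [Field K] [CharP K 2] (c : K) (hc : c ≠ 0) :
    singLocus (C c * esymm (Fin 4) K 1 * esymm (Fin 4) K 3 + esymm (Fin 4) K 4)
      = aux_pt K '' (((Finset.univ.filter fun b :
      {b : Fin 4 → Bool // b ≠ fun _ => false} => ∃ g : Equiv.Perm (Fin 4),
        b.1 = ![false, false, true, true] ∘ g) ∪ (Finset.univ.filter fun b :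
      {b : Fin 4 → Bool // b ≠ fun _ => false} => ∃ g : Equiv.Perm (Fin 4),
        b.1 = ![false, false, false, true] ∘ g) : Finset _) : Set _) := by
  have t : (2 : K) = 0 := CharTwo.two_eq_zero
  ext p
  simp only [singLocus, Set.mem_setOf_eq, Set.mem_image, Finset.coe_union, Finset.coe_filter,
    Finset.mem_univ, true_and, Set.mem_union]
  constructor
  · intro h
    induction p using Projectivization.ind with
    | h v hv =>
    obtain ⟨-, hd⟩ := h v hv rfl
    obtain ⟨-, f0, f1, f2, f3⟩ := aux_F c v
    have ha := aux_alg c hc (v 0) (v 1) (v 2) (v 3) (f0 ▸ hd 0) (f1 ▸ hd 1) (f2 ▸ hd 2)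
      (f3 ▸ hd 3)
    have fin : ∀ (k : K) (b : Fin 4 → Bool), b ∈ [![false, false, false, true],
      ![false, false, true, false], ![false, true, false, false],
      ![true, false, false, false], ![false, false, true, true], ![false, true, false, true],
      ![false, true, true, false], ![true, false, false, true], ![true, false, true, false],
      ![true, true, false, false]] → (∀ i, v i = k * aux_ind K b i) → _ :=
      fun k b hb hi => aux_mem v hv k b (funext hi) ((aux_list b).2 hb)
    rcases ha with h | h | h | h | h | h | h | h | h | h
    · refine fin (v 3) ![false, false, false, true] (by decide) ?_
      simp [Fin.forall_fin_succ, aux_ind, h]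
    · refine fin (v 2) ![false, false, true, false] (by decide) ?_
      simp [Fin.forall_fin_succ, aux_ind, h]
    · refine fin (v 1) ![false, true, false, false] (by decide) ?_
      simp [Fin.forall_fin_succ, aux_ind, h]
    · refine fin (v 0) ![true, false, false, false] (by decide) ?_
      simp [Fin.forall_fin_succ, aux_ind, h]
    · refine fin (v 3) ![false, false, true, true] (by decide) ?_
      simp [Fin.forall_fin_succ, aux_ind, h]
    · refine fin (v 3) ![false, true, false, true] (by decide) ?_
      simp [Fin.forall_fin_succ, aux_ind, h]
    · refine fin (v 2) ![false, true, true, false] (by decide) ?_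
      simp [Fin.forall_fin_succ, aux_ind, h]
    · refine fin (v 3) ![true, false, false, true] (by decide) ?_
      simp [Fin.forall_fin_succ, aux_ind, h]
    · refine fin (v 2) ![true, false, true, false] (by decide) ?_
      simp [Fin.forall_fin_succ, aux_ind, h]
    · refine fin (v 1) ![true, true, false, false] (by decide) ?_
      simp [Fin.forall_fin_succ, aux_ind, h]
  · rintro ⟨⟨b, hb0⟩, hb, rfl⟩ v hv hp
    rw [aux_pt, Projectivization.mk_eq_mk_iff] at hp
    obtain ⟨k, hk⟩ := hp
    have hi : ∀ i, v i = k * aux_ind K b i := fun i => (congrFun hk i).symm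
    have hl := (aux_list b).1 hb
    clear hb hk
    obtain ⟨f, f0, f1, f2, f3⟩ := aux_F c v
    rw [Fin.forall_fin_succ, Fin.forall_fin_succ, Fin.forall_fin_succ, Fin.forall_fin_one]
    change _ ∧ eval v (pderiv 0 _) = 0 ∧ eval v (pderiv 1 _) = 0 ∧ eval v (pderiv 2 _) = 0 ∧
      eval v (pderiv 3 _) = 0
    rw [f, f0, f1, f2, f3, hi 0, hi 1, hi 2, hi 3]
    clear f f0 f1 f2 f3 hi
    simp only [List.mem_cons, List.not_mem_nil, or_false] at hl
    rcases hl with rfl | rfl | rfl | rfl | rfl | rfl | rfl | rfl | rfl | rfl <;>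
      simp [aux_ind, CharTwo.add_self_eq_zero]

/-- For `c ≠ 0` over an algebraically closed field of characteristic 2, the quartic
`X_c = {c·σ₁σ₃ + σ₄ = 0}` has exactly 10 singular points: the `S₄`-orbit of `[0:0:1:1]`
(6 points) together with the `S₄`-orbit of `[0:0:0:1]` (4 points). -/
theorem pencil_quartic_exactly_ten_singular_points
    {K : Type*} [Field K] [IsAlgClosed K] [CharP K 2]
    (c : K) (hc : c ≠ 0) :
    singLocus (C c * esymm (Fin 4) K 1 * esymm (Fin 4) K 3 + esymm (Fin 4) K 4)
        = s4Orbit (![0, 0, 1, 1] : Fin 4 → K) ∪ s4Orbit (![0, 0, 0, 1] : Fin 4 → K) ∧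
    (singLocus (C c * esymm (Fin 4) K 1 * esymm (Fin 4) K 3
        + esymm (Fin 4) K 4)).ncard = 10 ∧
    (s4Orbit (![0, 0, 1, 1] : Fin 4 → K)).ncard = 6 ∧
    (s4Orbit (![0, 0, 0, 1] : Fin 4 → K)).ncard = 4 := by
  have o1 : (![0, 0, 1, 1] : Fin 4 → K) = aux_ind K ![false, false, true, true] := by
    funext i
    fin_cases i <;> simp [aux_ind]
  have o2 : (![0, 0, 0, 1] : Fin 4 → K) = aux_ind K ![false, false, false, true] := by
    funext i
    fin_cases i <;> simp [aux_ind]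
  rw [o1, o2, aux_orbit K _ (by decide), aux_orbit K _ (by decide), ← Set.image_union,
    ← Finset.coe_union]
  have main := aux_sing c hc
  refine ⟨main, ?_, ?_, ?_⟩
  · rw [main, Set.ncard_image_of_injective _ (aux_pt_inj K), Set.ncard_coe_finset]
    decide +kernel
  · rw [Set.ncard_image_of_injective _ (aux_pt_inj K), Set.ncard_coe_finset]
    decide +kernel
  · rw [Set.ncard_image_of_injective _ (aux_pt_inj K), Set.ncard_coe_finset]
    decide +kernel

end
end
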